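/- arXiv:2204.00412 — 7 statements merged into one kernel-verified Lean document; each statement's English description precedes it below -/
import Mathlib

section
/- Let A ⊆ ℤ⁺ and τ ∈ (0,1) be such that limsup_{x→∞} A(x) · (log x)^{1-τ} / x < ∞. Then limsup_{s→1⁺} (s-1)^τ · A[s] ≤ Γ(τ) · limsup_{x→∞} A(x) · (log x)^{1-τ} / x, where A[s] = ∑_{a∈A} a^{-s}. -/
open Filter Real

/-- Counting function: `A(x) = |A ∩ {1,…,⌊x⌋}|`. -/
noncomputable def cntF (A : Set ℕ) (x : ℝ) : ℕ := (A ∩ Set.Icc 1 ⌊x⌋₊).ncard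

open MeasureTheory Set in
/-- Laplace representation: `a ^ (-s) = ∫_{log a}^∞ s e^{-su} du`. -/
theorem rpow_neg_eq_integral_exp {a s : ℝ} (ha : 0 < a) (hs : 0 < s) :
    a ^ (-s) = ∫ u in Ioi (Real.log a), s * Real.exp (-s * u) := by
  rw [integral_const_mul, integral_exp_mul_Ioi (neg_lt_zero.2 hs), Real.rpow_def_of_pos ha]
  field_simp

theorem card_filter_le_cntF (A : Set ℕ) (hA0 : 0 ∉ A) (F : Finset A) (u : ℝ) :
    (F.filter fun a : A => Real.log ((a : ℕ) : ℝ) < u).card ≤ cntF A (Real.exp u) := by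
  unfold cntF
  rw [← Finset.card_map (Function.Embedding.subtype _), ← Set.ncard_coe_finset]
  refine Set.ncard_le_ncard ?_ ((Set.finite_Icc _ _).inter_of_right _)
  intro n hn
  simp only [Finset.coe_map, Function.Embedding.subtype_apply, Finset.coe_filter, Set.mem_image,
    Set.mem_ofPred_eq] at hn
  obtain ⟨a, ⟨-, ha⟩, rfl⟩ := hn
  have h0 : 0 < (a : ℕ) := Nat.pos_of_ne_zero fun h => hA0 (h ▸ a.2)
  refine ⟨a.2, h0, Nat.le_floor ?_⟩
  exact ((Real.log_lt_iff_lt_exp (by exact_mod_cast h0)).1 ha).le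

open MeasureTheory Set in
theorem tsum_rpow_neg_le_of_cntF_le (A : Set ℕ) (hA0 : 0 ∉ A) {τ c K s : ℝ} (hτ : 0 < τ)
    (hs : 1 < s)
    (h : ∀ u > 0, (cntF A (Real.exp u) : ℝ) ≤ c * (Real.exp u * u ^ (τ - 1)) + K) :
    ∑' a : A, ((a : ℕ) : ℝ) ^ (-s) ≤ s * c * ((1 / (s - 1)) ^ τ * Real.Gamma τ) + K := by
  have hs0 : 0 < s := by linarith
  refine Real.tsum_le_of_sum_le (fun a => by positivity) fun F => ?_
  have hpos : ∀ a : A, (1 : ℝ) ≤ ((a : ℕ) : ℝ) := fun a => by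
    exact_mod_cast Nat.pos_of_ne_zero fun h => hA0 (h ▸ a.2)
  have hexp : IntegrableOn (fun u : ℝ => s * Real.exp (-s * u)) (Ioi 0) :=
    (integrableOn_exp_mul_Ioi (neg_lt_zero.2 hs0) 0).const_mul s
  have hgam : IntegrableOn (fun u : ℝ => u ^ (τ - 1) * Real.exp (-((s - 1) * u))) (Ioi 0) := by
    have := integrableOn_rpow_mul_exp_neg_mul_rpow (s := τ - 1) (p := 1) (b := s - 1)
      (by linarith) one_pos (by linarith)
    simpa only [neg_mul, Real.rpow_one] using this
  have hterm : ∀ a : A, ((a : ℕ) : ℝ) ^ (-s) =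
      ∫ u in Ioi (0 : ℝ), (Ioi (Real.log ((a : ℕ) : ℝ))).indicator
        (fun u => s * Real.exp (-s * u)) u := fun a => by
    rw [rpow_neg_eq_integral_exp (by linarith [hpos a]) hs0,
      setIntegral_indicator measurableSet_Ioi,
      inter_eq_right.2 (Ioi_subset_Ioi (Real.log_nonneg (hpos a)))]
  calc ∑ a ∈ F, ((a : ℕ) : ℝ) ^ (-s)
      = ∫ u in Ioi (0 : ℝ), ∑ a ∈ F, (Ioi (Real.log ((a : ℕ) : ℝ))).indicator
        (fun u => s * Real.exp (-s * u)) u := by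
        rw [integral_finsetSum _ fun a _ => hexp.indicator measurableSet_Ioi]
        exact Finset.sum_congr rfl fun a _ => hterm a
    _ ≤ ∫ u in Ioi (0 : ℝ), (s * c * (u ^ (τ - 1) * Real.exp (-((s - 1) * u)))
        + K * (s * Real.exp (-s * u))) := by
        refine setIntegral_mono_on
          (integrable_finsetSum _ fun a _ => hexp.indicator measurableSet_Ioi)
          ((hgam.const_mul _).add (hexp.const_mul _)) measurableSet_Ioi fun u hu => ?_
        simp only [indicator_apply, mem_Ioi]
        rw [← Finset.sum_filter, Finset.sum_const, nsmul_eq_mul]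
        have hcard : ((F.filter fun a : A => Real.log ((a : ℕ) : ℝ) < u).card : ℝ) ≤
            c * (Real.exp u * u ^ (τ - 1)) + K :=
          le_trans (by exact_mod_cast card_filter_le_cntF A hA0 F u) (h u hu)
        have he : Real.exp (-((s - 1) * u)) = Real.exp u * Real.exp (-s * u) := by
          rw [← Real.exp_add]; ring_nf
        calc _ ≤ (c * (Real.exp u * u ^ (τ - 1)) + K) * (s * Real.exp (-s * u)) := by gcongr
          _ = _ := by rw [he]; ring
    _ = s * c * ((1 / (s - 1)) ^ τ * Real.Gamma τ) + K := by
        rw [integral_add (hgam.const_mul _) (hexp.const_mul _), integral_const_mul,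
          integral_const_mul, Real.integral_rpow_mul_exp_neg_mul_Ioi hτ (by linarith)]
        have h1 := rpow_neg_eq_integral_exp one_pos hs0
        rw [Real.log_one, Real.one_rpow] at h1
        rw [← h1, mul_one]

theorem cntF_le (A : Set ℕ) {x : ℝ} (hx : 0 ≤ x) : (cntF A x : ℝ) ≤ x := by
  refine le_trans (Nat.cast_le.2 ?_) (Nat.floor_le hx)
  calc cntF A x ≤ (Set.Icc 1 ⌊x⌋₊).ncard :=
        Set.ncard_le_ncard Set.inter_subset_right (Set.finite_Icc _ _)
    _ = ⌊x⌋₊ := by rw [Set.ncard_eq_toFinset_card']; simp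

theorem exists_cntF_exp_le (A : Set ℕ) {τ c : ℝ} (hc : 0 ≤ c)
    (h : ∀ᶠ x : ℝ in atTop, (cntF A x : ℝ) * Real.log x ^ (1 - τ) / x ≤ c) :
    ∃ K : ℝ, ∀ u > 0, (cntF A (Real.exp u) : ℝ) ≤ c * (Real.exp u * u ^ (τ - 1)) + K := by
  obtain ⟨u₀, hu₀⟩ := eventually_atTop.1 (Real.tendsto_exp_atTop.eventually h)
  refine ⟨Real.exp u₀, fun u hu => ?_⟩
  have h0 : 0 < u ^ (1 - τ) := Real.rpow_pos_of_pos hu _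
  rcases le_total u₀ u with hle | hle
  · have h1 := hu₀ u hle
    rw [Real.log_exp, div_le_iff₀ (Real.exp_pos u), ← le_div_iff₀ h0] at h1
    have h2 : u ^ (τ - 1) = (u ^ (1 - τ))⁻¹ := by rw [← Real.rpow_neg hu.le]; ring_nf
    rw [h2, ← mul_assoc, ← div_eq_mul_inv]
    linarith [Real.exp_pos u₀]
  · have h1 := (cntF_le A (Real.exp_pos u).le).trans (Real.exp_le_exp.2 hle)
    have : 0 ≤ c * (Real.exp u * u ^ (τ - 1)) := by positivity
    linarith

theorem limsup_tsum_rpow_neg_le (A : Set ℕ) (hA0 : 0 ∉ A) {τ c : ℝ} (hτ : 0 < τ) (hc : 0 ≤ c)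
    (h : ∀ᶠ x : ℝ in atTop, (cntF A x : ℝ) * Real.log x ^ (1 - τ) / x ≤ c) :
    Filter.limsup (fun s : ℝ =>
        (((s - 1) ^ τ * ∑' a : A, ((a : ℕ) : ℝ) ^ (-s) : ℝ) : EReal))
        (nhdsWithin 1 (Set.Ioi 1)) ≤ ((Real.Gamma τ * c : ℝ) : EReal) := by
  obtain ⟨K, hK⟩ := exists_cntF_exp_le A hc h
  have hlim : Tendsto (fun s : ℝ => s * c * Real.Gamma τ + (s - 1) ^ τ * K)
      (nhdsWithin 1 (Set.Ioi 1)) (nhds (Real.Gamma τ * c)) := by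
    have hcont : Continuous fun s : ℝ => s * c * Real.Gamma τ + (s - 1) ^ τ * K := by
      have : Continuous fun s : ℝ => (s - 1) ^ τ :=
        (continuous_id.sub continuous_const).rpow_const fun _ => Or.inr hτ.le
      fun_prop
    have := hcont.tendsto 1
    simp only [sub_self, Real.zero_rpow hτ.ne', one_mul, zero_mul, add_zero] at this
    rw [mul_comm]
    exact this.mono_left nhdsWithin_le_nhds
  rw [← ((continuous_coe_real_ereal.tendsto _).comp hlim).limsup_eq]
  refine limsup_le_limsup ?_
  filter_upwards [self_mem_nhdsWithin] with s hs
  have hs : 1 < s := hs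
  refine EReal.coe_le_coe_iff.2 ?_
  have hp : 0 < (s - 1) ^ τ := Real.rpow_pos_of_pos (by linarith) _
  calc _ ≤ (s - 1) ^ τ * (s * c * ((1 / (s - 1)) ^ τ * Real.Gamma τ) + K) := by
        gcongr; exact tsum_rpow_neg_le_of_cntF_le A hA0 hτ hs hK
    _ = _ := by
        rw [Real.div_rpow zero_le_one (by linarith), Real.one_rpow]
        field_simp

theorem stmt11 (A : Set ℕ) (hA0 : 0 ∉ A) (τ : ℝ) (hτ : τ ∈ Set.Ioo (0 : ℝ) 1)
    (hfin : Filter.limsup (fun x : ℝ =>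
      (((cntF A x : ℝ) * Real.log x ^ (1 - τ) / x : ℝ) : EReal)) Filter.atTop < ⊤) :
    Filter.limsup (fun s : ℝ =>
        (((s - 1) ^ τ * ∑' a : A, ((a : ℕ) : ℝ) ^ (-s) : ℝ) : EReal))
        (nhdsWithin 1 (Set.Ioi 1))
      ≤ ((Real.Gamma τ : ℝ) : EReal) *
        Filter.limsup (fun x : ℝ =>
          (((cntF A x : ℝ) * Real.log x ^ (1 - τ) / x : ℝ) : EReal)) Filter.atTop := by
  set L := Filter.limsup (fun x : ℝ =>
      (((cntF A x : ℝ) * Real.log x ^ (1 - τ) / x : ℝ) : EReal)) Filter.atTop with hL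
  have hL0 : 0 ≤ L := by
    refine le_limsup_of_frequently_le (Eventually.frequently ?_)
    filter_upwards [eventually_ge_atTop 1] with x hx
    have := Real.log_nonneg hx
    exact EReal.coe_nonneg.2 (by positivity)
  lift L to ℝ using ⟨hfin.ne, (lt_of_lt_of_le EReal.bot_lt_zero hL0).ne'⟩ with l
  have hl : 0 ≤ l := EReal.coe_nonneg.1 hL0
  have key : ∀ c > l, Filter.limsup (fun s : ℝ =>
        (((s - 1) ^ τ * ∑' a : A, ((a : ℕ) : ℝ) ^ (-s) : ℝ) : EReal))
        (nhdsWithin 1 (Set.Ioi 1)) ≤ ((Real.Gamma τ * c : ℝ) : EReal) := fun c hc => by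
    refine limsup_tsum_rpow_neg_le A hA0 hτ.1 (hl.trans hc.le) ?_
    have hlt : limsup (fun x : ℝ =>
        (((cntF A x : ℝ) * Real.log x ^ (1 - τ) / x : ℝ) : EReal)) atTop < (c : EReal) :=
      hL ▸ EReal.coe_lt_coe_iff.2 hc
    filter_upwards [eventually_lt_of_limsup_lt hlt] with x hx
    exact (EReal.coe_lt_coe_iff.1 hx).le
  rw [← EReal.coe_mul]
  have hcont : Continuous fun c : ℝ => ((Real.Gamma τ * c : ℝ) : EReal) :=
    continuous_coe_real_ereal.comp (continuous_const.mul continuous_id)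
  refine ge_of_tendsto ((hcont.tendsto l).mono_left (nhdsWithin_le_nhds (s := Set.Ioi l))) ?_
  filter_upwards [self_mem_nhdsWithin] with c hc using key c hc
end

section
/- Let h ∈ ℤ⁺ and let A be a multiplicative basis of order h for ℤ⁺ (A ∈ MB_h). Then limsup_{s→1⁺} (s-1)^{1/h} · A[s] ≥ (h!)^{1/h}, where A[s] = ∑_{a∈A} a^{-s}. -/
open Filter Real

/-- Multiplicative representation function of order `h`. -/
noncomputable def mulRep (h : ℕ) (A : Set ℕ) (n : ℕ) : ℕ :=
  {f : Fin h → ℕ | (∀ i, f i ∈ A) ∧ ∏ i, f i = n}.ncard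

/-- `A` is a multiplicative basis of order `h` for `ℤ⁺`. -/
def IsMB (h : ℕ) (A : Set ℕ) : Prop := ∀ n : ℕ, 1 ≤ n → 1 ≤ mulRep h A n

open scoped ENNReal in
/-- The `h`-th power of a sum expands as a sum over `h`-tuples. -/
theorem ENNReal.tsum_fin_prod_eq_pow {α : Type*} (w : α → ℝ≥0∞) (h : ℕ) :
    ∑' f : Fin h → α, ∏ i, w (f i) = (∑' a, w a) ^ h := by
  induction h with
  | zero => simp
  | succ k ih =>
    rw [← (Fin.consEquiv (fun _ : Fin (k + 1) => α)).tsum_eq,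
      ENNReal.tsum_prod (f := fun a f => ∏ i, w (Fin.consEquiv (fun _ => α) (a, f) i)),
      pow_succ', ← ih, ← ENNReal.tsum_mul_right]
    refine tsum_congr fun a => ?_
    rw [← ENNReal.tsum_mul_left]
    refine tsum_congr fun f => ?_
    simp [Fin.consEquiv, Fin.prod_univ_succ]

open scoped ENNReal in
/-- Integers with a representation by pairwise distinct elements are counted at least `h!` times
in the `h`-th power. -/
theorem factorial_mul_tsum_injective_le (h : ℕ) (A : Set ℕ) (w : ℕ →*₀ ℝ≥0∞) :
    (h.factorial : ℝ≥0∞) *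
        ∑' n : {n | ∃ f : Fin h → A, Function.Injective f ∧ ∏ i, (f i : ℕ) = n}, w n ≤
      (∑' a : A, w a) ^ h := by
  set I := {n | ∃ f : Fin h → A, Function.Injective f ∧ ∏ i, (f i : ℕ) = n}
  have hI : ∀ n : I, ∃ f : Fin h → A, Function.Injective f ∧ ∏ i, (f i : ℕ) = n := fun n => n.2
  choose F hF hFn using hI
  have hinj : Function.Injective
      (fun p : Equiv.Perm (Fin h) × I => F p.2 ∘ p.1) := by
    rintro ⟨σ, n⟩ ⟨τ, m⟩ hp
    have hp' : F n ∘ σ = F m ∘ τ := hp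
    have hnm : n = m := by
      apply Subtype.ext
      rw [← hFn n, ← hFn m, ← Equiv.prod_comp σ (fun i => (F n i : ℕ)),
        ← Equiv.prod_comp τ (fun i => (F m i : ℕ))]
      exact Finset.prod_congr rfl fun i _ => congrArg Subtype.val (congrFun hp' i)
    subst hnm
    refine Prod.ext (Equiv.ext fun i => hF n (congrFun hp' i)) rfl
  rw [← ENNReal.tsum_fin_prod_eq_pow]
  refine le_trans (le_of_eq ?_) (ENNReal.tsum_comp_le_tsum_of_injective hinj _)
  rw [ENNReal.tsum_prod (f := fun (σ : Equiv.Perm (Fin h)) n => ∏ i, w ((F n ∘ σ) i : A))]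
  have : ∀ σ : Equiv.Perm (Fin h),
      ∑' n : I, ∏ i, w ((F n ∘ σ) i : A) = ∑' n : I, w n := by
    intro σ
    refine tsum_congr fun n => ?_
    rw [← map_prod, ← hFn n, ← Equiv.prod_comp σ (fun i => (F n i : ℕ))]
    rfl
  simp only [this]
  rw [tsum_fintype (L := .unconditional _) (fun _ : Equiv.Perm (Fin h) => _)]
  simp [Fintype.card_perm]

open scoped ENNReal in
/-- Integers with a representation in which some element is repeated contribute little. -/
theorem tsum_not_injective_le (k : ℕ) (A : Set ℕ) (w : ℕ →*₀ ℝ≥0∞) :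
    ∑' n : {n | ∃ f : Fin (k + 2) → A, ¬ Function.Injective f ∧ ∏ i, (f i : ℕ) = n}, w n ≤
      (∑' n : ℕ, w n ^ 2) * (∑' a : A, w a) ^ k := by
  set J := {n | ∃ f : Fin (k + 2) → A, ¬ Function.Injective f ∧ ∏ i, (f i : ℕ) = n}
  have hJ : ∀ n : J, ∃ p : ℕ × (Fin k → A), p.1 * (p.1 * ∏ i, (p.2 i : ℕ)) = n := by
    rintro ⟨n, f, hf, rfl⟩
    obtain ⟨i, j, hij, hne⟩ := Function.not_injective_iff.1 hf
    obtain ⟨l, rfl⟩ := Fin.exists_succAbove_eq hne.symm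
    refine ⟨⟨f i, fun m => f (i.succAbove (l.succAbove m))⟩, ?_⟩
    simp only
    rw [Fin.prod_univ_succAbove _ i, Fin.prod_univ_succAbove _ l, ← hij]
  choose G hG using hJ
  have hinj : Function.Injective G := fun n m hnm => Subtype.ext (by rw [← hG n, ← hG m, hnm])
  rw [← ENNReal.tsum_fin_prod_eq_pow, ← ENNReal.tsum_mul_right]
  simp only [← ENNReal.tsum_mul_left]
  rw [← ENNReal.tsum_prod (f := fun (n : ℕ) (f : Fin k → A) => w n ^ 2 * ∏ i, w (f i))]
  refine le_trans (le_of_eq ?_) (ENNReal.tsum_comp_le_tsum_of_injective hinj _)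
  refine tsum_congr fun n => ?_
  rw [← hG n, map_mul, map_mul, map_prod]
  ring

theorem IsMB.exists_rep {h : ℕ} {A : Set ℕ} (hMB : IsMB h A) {n : ℕ} (hn : 1 ≤ n) :
    ∃ f : Fin h → A, ∏ i, (f i : ℕ) = n := by
  obtain ⟨f, hf, hfn⟩ := Set.nonempty_of_ncard_ne_zero (Nat.one_le_iff_ne_zero.1 (hMB n hn))
  exact ⟨fun i => ⟨f i, hf i⟩, hfn⟩

theorem IsMB.one_mem {h : ℕ} {A : Set ℕ} (hh : 1 ≤ h) (hMB : IsMB h A) : 1 ∈ A := by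
  obtain ⟨f, hf⟩ := hMB.exists_rep le_rfl
  have h1 := Finset.prod_eq_one_iff.1 hf ⟨0, hh⟩ (Finset.mem_univ _)
  exact h1 ▸ (f ⟨0, hh⟩).2

open scoped ENNReal in
theorem IsMB.factorial_mul_tsum_le {h : ℕ} {A : Set ℕ} (hh : 1 ≤ h) (hMB : IsMB h A)
    (w : ℕ →*₀ ℝ≥0∞) :
    (h.factorial : ℝ≥0∞) * ∑' n, w n ≤
      (∑' a : A, w a) ^ h + h.factorial * ((∑' n, w n ^ 2) * (∑' a : A, w a) ^ (h - 1)) := by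
  set I := {n | ∃ f : Fin h → A, Function.Injective f ∧ ∏ i, (f i : ℕ) = n}
  set J := {n | ∃ f : Fin h → A, ¬ Function.Injective f ∧ ∏ i, (f i : ℕ) = n}
  have hsplit : ∑' n, w n ≤ ∑' n : I, w n + ∑' n : J, w n := by
    rw [tsum_subtype I w, tsum_subtype J w, ← ENNReal.tsum_add]
    refine ENNReal.tsum_le_tsum fun n => ?_
    rcases Nat.eq_zero_or_pos n with rfl | hn
    · simp
    obtain ⟨f, hf⟩ := hMB.exists_rep hn
    by_cases hfi : Function.Injective f
    · rw [Set.indicator_of_mem (show n ∈ I from ⟨f, hfi, hf⟩)]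
      exact le_self_add
    · rw [Set.indicator_of_mem (show n ∈ J from ⟨f, hfi, hf⟩)]
      exact le_add_self
  have hone : 1 ≤ ∑' a : A, w a := by
    have := ENNReal.le_tsum (f := fun a : A => w a) ⟨1, hMB.one_mem hh⟩
    simpa using this
  have hJle : ∑' n : J, w n ≤ (∑' n, w n ^ 2) * (∑' a : A, w a) ^ (h - 1) := by
    obtain _ | _ | k := h
    · omega
    · have : J = ∅ := by
        refine Set.eq_empty_of_forall_notMem ?_
        rintro n ⟨f, hf, -⟩
        exact hf fun i j _ => Fin.ext (by omega)
      rw [tsum_subtype J w]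
      simp [this]
    · refine (tsum_not_injective_le k A w).trans ?_
      exact mul_le_mul' le_rfl (pow_le_pow_right₀ hone (by omega))
  calc (h.factorial : ℝ≥0∞) * ∑' n, w n
      ≤ h.factorial * (∑' n : I, w n + ∑' n : J, w n) := by gcongr
    _ = h.factorial * ∑' n : I, w n + h.factorial * ∑' n : J, w n := mul_add _ _ _
    _ ≤ _ := by
        gcongr
        exact factorial_mul_tsum_injective_le h A w

/-- The real-variable inequality between the zeta sum and the Dirichlet series of the basis. -/
theorem IsMB.factorial_mul_tsum_rpow_le {h : ℕ} {A : Set ℕ} (hh : 1 ≤ h) (hMB : IsMB h A)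
    {s : ℝ} (hs : 1 < s) :
    (h.factorial : ℝ) * ∑' n : ℕ, 1 / (n : ℝ) ^ s ≤
      (∑' a : A, ((a : ℕ) : ℝ) ^ (-s)) ^ h +
        h.factorial * ((∑' n : ℕ, 1 / (n : ℝ) ^ (2 : ℕ)) *
          (∑' a : A, ((a : ℕ) : ℝ) ^ (-s)) ^ (h - 1)) := by
  have hs0 : -s ≠ 0 := by linarith
  let w : ℕ →*₀ ENNReal :=
    { toFun := fun n => ENNReal.ofReal ((n : ℝ) ^ (-s))
      map_zero' := by simp [Real.zero_rpow hs0]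
      map_one' := by simp
      map_mul' := fun m n => by
        rw [Nat.cast_mul, Real.mul_rpow (by positivity) (by positivity),
          ENNReal.ofReal_mul (by positivity)] }
  have hw : ∀ n, w n = ENNReal.ofReal ((n : ℝ) ^ (-s)) := fun n => rfl
  have hnn : ∀ n : ℕ, 0 ≤ (n : ℝ) ^ (-s) := fun n => by positivity
  have hsum : Summable fun n : ℕ => (n : ℝ) ^ (-s) := Real.summable_nat_rpow.2 (by linarith)
  have hsumA : Summable fun a : A => ((a : ℕ) : ℝ) ^ (-s) := hsum.subtype A
  have hsum2 : Summable fun n : ℕ => 1 / (n : ℝ) ^ (2 : ℕ) :=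
    Real.summable_one_div_nat_pow.2 one_lt_two
  have hZ : ∑' n, w n = ENNReal.ofReal (∑' n : ℕ, 1 / (n : ℝ) ^ s) := by
    simp only [hw]
    rw [← ENNReal.ofReal_tsum_of_nonneg hnn hsum]
    simp [Real.rpow_neg]
  have hA : ∑' a : A, w a = ENNReal.ofReal (∑' a : A, ((a : ℕ) : ℝ) ^ (-s)) := by
    simp only [hw]
    rw [← ENNReal.ofReal_tsum_of_nonneg (fun a : A => hnn a) hsumA]
  have hC : ∑' n, w n ^ 2 ≤ ENNReal.ofReal (∑' n : ℕ, 1 / (n : ℝ) ^ (2 : ℕ)) := by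
    rw [ENNReal.ofReal_tsum_of_nonneg (fun n => by positivity) hsum2]
    refine ENNReal.tsum_le_tsum fun n => ?_
    rw [hw, ← ENNReal.ofReal_pow (hnn n)]
    refine ENNReal.ofReal_le_ofReal ?_
    rcases Nat.eq_zero_or_pos n with rfl | hn
    · simp [Real.zero_rpow hs0]
    have hn1 : (1 : ℝ) ≤ n := by exact_mod_cast hn
    rw [one_div, ← inv_pow]
    gcongr
    rw [← Real.rpow_neg_one]
    exact Real.rpow_le_rpow_of_exponent_le hn1 (by linarith)
  have hA0 : 0 ≤ ∑' a : A, ((a : ℕ) : ℝ) ^ (-s) := tsum_nonneg fun a => hnn a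
  have hC0 : 0 ≤ ∑' n : ℕ, 1 / (n : ℝ) ^ (2 : ℕ) := tsum_nonneg fun n => by positivity
  have key := hMB.factorial_mul_tsum_le hh w
  have key' := key.trans (add_le_add le_rfl (mul_le_mul' le_rfl (mul_le_mul' hC le_rfl)))
  rw [hZ, hA, ← ENNReal.ofReal_natCast, ← ENNReal.ofReal_pow hA0, ← ENNReal.ofReal_pow hA0,
    ← ENNReal.ofReal_mul hC0, ← ENNReal.ofReal_mul (by positivity),
    ← ENNReal.ofReal_mul (by positivity), ← ENNReal.ofReal_add (by positivity) (by positivity)]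
    at key'
  exact (ENNReal.ofReal_le_ofReal_iff (by positivity)).1 key'

theorem stmt12 (h : ℕ) (hh : 1 ≤ h) (A : Set ℕ) (hA0 : 0 ∉ A) (hMB : IsMB h A) :
    (((Nat.factorial h : ℝ) ^ ((1 : ℝ) / h) : ℝ) : EReal) ≤
      Filter.limsup (fun s : ℝ =>
        (((s - 1) ^ ((1 : ℝ) / h) * ∑' a : A, ((a : ℕ) : ℝ) ^ (-s) : ℝ) : EReal))
        (nhdsWithin 1 (Set.Ioi 1)) := by
  have hh0 : h ≠ 0 := by omega
  have hhR : (0 : ℝ) < 1 / h := by positivity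
  by_contra! hlt
  obtain ⟨c, hc1, hc2⟩ := EReal.lt_iff_exists_real_btwn.1 hlt
  have hev := Filter.eventually_lt_of_limsup_lt hc1
  rw [EReal.coe_lt_coe_iff] at hc2
  set C : ℝ := ∑' n : ℕ, 1 / (n : ℝ) ^ (2 : ℕ)
  have hC0 : 0 ≤ C := tsum_nonneg fun n => by positivity
  have hnonneg : ∀ s : ℝ, 1 < s →
      0 ≤ (s - 1) ^ ((1 : ℝ) / h) * ∑' a : A, ((a : ℕ) : ℝ) ^ (-s) := fun s hs =>
    mul_nonneg (Real.rpow_nonneg (by linarith) _) (tsum_nonneg fun a => by positivity)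
  have hbound : ∀ᶠ s : ℝ in nhdsWithin 1 (Set.Ioi 1),
      (h.factorial : ℝ) * ((s - 1) * ∑' n : ℕ, 1 / (n : ℝ) ^ s) ≤
        c ^ h + h.factorial * (C * ((s - 1) ^ ((1 : ℝ) / h) * c ^ (h - 1))) := by
    filter_upwards [hev, self_mem_nhdsWithin] with s hsc hs
    have hs1 : 1 < s := hs
    rw [EReal.coe_lt_coe_iff] at hsc
    have hx := hnonneg s hs1
    have hmain := hMB.factorial_mul_tsum_rpow_le hh hs1
    set T := ∑' a : A, ((a : ℕ) : ℝ) ^ (-s)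
    set ε := (s - 1) ^ ((1 : ℝ) / h) with hε
    have hε0 : 0 ≤ ε := Real.rpow_nonneg (by linarith) _
    have hεh : s - 1 = ε ^ h := by
      rw [hε, one_div, Real.rpow_inv_natCast_pow (by linarith) hh0]
    have hεh' : ε ^ h = ε * ε ^ (h - 1) := by
      rw [← pow_succ', Nat.sub_add_cancel hh]
    calc (h.factorial : ℝ) * ((s - 1) * ∑' n : ℕ, 1 / (n : ℝ) ^ s)
        = ε ^ h * (h.factorial * ∑' n : ℕ, 1 / (n : ℝ) ^ s) := by rw [hεh]; ring
      _ ≤ ε ^ h * (T ^ h + h.factorial * (C * T ^ (h - 1))) := by gcongr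
      _ = (ε * T) ^ h + h.factorial * (C * (ε * (ε * T) ^ (h - 1))) := by
          rw [mul_add, mul_pow, mul_pow, hεh']; ring
      _ ≤ _ := by gcongr
  have hL : Tendsto (fun s : ℝ => (h.factorial : ℝ) * ((s - 1) * ∑' n : ℕ, 1 / (n : ℝ) ^ s))
      (nhdsWithin 1 (Set.Ioi 1)) (nhds (h.factorial * 1)) :=
    tendsto_sub_mul_tsum_nat_rpow.const_mul _
  have hε : Tendsto (fun s : ℝ => (s - 1) ^ ((1 : ℝ) / h))
      (nhdsWithin 1 (Set.Ioi 1)) (nhds 0) := by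
    have hcont : Continuous fun s : ℝ => (s - 1) ^ ((1 : ℝ) / h) :=
      (continuous_id.sub continuous_const).rpow_const fun _ => Or.inr hhR.le
    have := hcont.tendsto 1
    rw [sub_self, Real.zero_rpow hhR.ne'] at this
    exact this.mono_left nhdsWithin_le_nhds
  have hR : Tendsto (fun s : ℝ =>
        c ^ h + h.factorial * (C * ((s - 1) ^ ((1 : ℝ) / h) * c ^ (h - 1))))
      (nhdsWithin 1 (Set.Ioi 1)) (nhds (c ^ h + h.factorial * (C * (0 * c ^ (h - 1))))) :=
    (((hε.mul_const _).const_mul C).const_mul _).const_add _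
  have hfin := le_of_tendsto_of_tendsto hL hR hbound
  have hc0 : 0 ≤ c := by
    obtain ⟨s, hsc, hs⟩ := (hev.and self_mem_nhdsWithin).exists
    rw [EReal.coe_lt_coe_iff] at hsc
    exact (hnonneg s hs).trans hsc.le
  have hlt' : c ^ h < h.factorial := by
    calc c ^ h < ((h.factorial : ℝ) ^ ((1 : ℝ) / h)) ^ h := pow_lt_pow_left₀ hc2 hc0 hh0
      _ = h.factorial := by
        rw [one_div, Real.rpow_inv_natCast_pow (by positivity) hh0]
  simp only [mul_one, zero_mul, mul_zero, add_zero] at hfin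
  linarith
end

section
/- Let h ∈ ℤ⁺, let A be a multiplicative basis of order h for ℤ⁺ (A ∈ MB_h), and set B = A ∪ {a² : a ∈ A}. Then for every n ∈ ℤ⁺, one has S_{A,h}(n)/h! + S_{B,h-1}(n) ≥ 1; equivalently, either S_{A,h}(n) ≥ h! or S_{B,h-1}(n) ≥ 1. -/
open Filter Real

lemma finite_setOf_prod_eq (h : ℕ) (A : Set ℕ) {n : ℕ} (hn : 1 ≤ n) :
    {f : Fin h → ℕ | (∀ i, f i ∈ A) ∧ ∏ i, f i = n}.Finite := by
  refine (Set.finite_Icc (0 : Fin h → ℕ) (fun _ => n)).subset ?_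
  rintro f ⟨-, hf⟩
  refine ⟨fun i => Nat.zero_le _, fun i => Nat.le_of_dvd hn ?_⟩
  exact hf ▸ Finset.dvd_prod_of_mem f (Finset.mem_univ i)

lemma one_le_mulRep_iff {h : ℕ} {A : Set ℕ} {n : ℕ} (hn : 1 ≤ n) :
    1 ≤ mulRep h A n ↔ ∃ f : Fin h → ℕ, (∀ i, f i ∈ A) ∧ ∏ i, f i = n :=
  Set.ncard_pos (finite_setOf_prod_eq h A hn)

lemma factorial_le_mulRep_of_injective {h : ℕ} {A : Set ℕ} {n : ℕ} (hn : 1 ≤ n)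
    {f : Fin h → ℕ} (hf : Function.Injective f) (hfA : ∀ i, f i ∈ A) (hfn : ∏ i, f i = n) :
    Nat.factorial h ≤ mulRep h A n := by
  have hinj : Function.Injective fun σ : Equiv.Perm (Fin h) => f ∘ σ := fun σ τ hστ =>
    Equiv.ext fun i => hf (congrFun hστ i)
  have hsub : Set.range (fun σ : Equiv.Perm (Fin h) => f ∘ σ) ⊆
      {f : Fin h → ℕ | (∀ i, f i ∈ A) ∧ ∏ i, f i = n} := by
    rintro _ ⟨σ, rfl⟩
    exact ⟨fun i => hfA (σ i), (Equiv.prod_comp σ f).trans hfn⟩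
  calc Nat.factorial h = (Set.range fun σ : Equiv.Perm (Fin h) => f ∘ σ).ncard := by
        rw [← Set.image_univ, Set.ncard_image_of_injective _ hinj, Set.ncard_univ,
          Nat.card_eq_fintype_card, Fintype.card_perm, Fintype.card_fin]
    _ ≤ mulRep h A n := Set.ncard_le_ncard hsub (finite_setOf_prod_eq h A hn)

lemma one_le_mulRep_of_eq {k : ℕ} {A : Set ℕ} {n : ℕ} (hn : 1 ≤ n) {f : Fin (k + 1) → ℕ}
    (hfA : ∀ i, f i ∈ A) (hfn : ∏ i, f i = n) {i j : Fin (k + 1)} (hij : f i = f j)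
    (hne : i ≠ j) : 1 ≤ mulRep k (A ∪ (fun a => a ^ 2) '' A) n := by
  obtain ⟨m, rfl⟩ := Fin.exists_succAbove_eq hne
  refine (one_le_mulRep_iff hn).2
    ⟨Function.update (fun l => f (j.succAbove l)) m (f j ^ 2), fun l => ?_, ?_⟩
  · rcases eq_or_ne l m with rfl | hl
    · rw [Function.update_self]
      exact Or.inr ⟨f j, hfA j, rfl⟩
    · rw [Function.update_of_ne hl]
      exact Or.inl (hfA _)
  · rw [Finset.prod_update_of_mem (Finset.mem_univ m), ← hfn, Fin.prod_univ_succAbove f j,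
      ← Finset.mul_prod_erase _ _ (Finset.mem_univ m), hij, Finset.sdiff_singleton_eq_erase,
      sq, mul_assoc]

theorem stmt13 (h : ℕ) (hh : 1 ≤ h) (A : Set ℕ) (hA0 : 0 ∉ A) (hMB : IsMB h A)
    (B : Set ℕ) (hB : B = A ∪ (fun a => a ^ 2) '' A) (n : ℕ) (hn : 1 ≤ n) :
    ((1 : ℝ) ≤ (mulRep h A n : ℝ) / (Nat.factorial h : ℝ) + (mulRep (h - 1) B n : ℝ)) ∧
    (Nat.factorial h ≤ mulRep h A n ∨ 1 ≤ mulRep (h - 1) B n) := by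
  have key : Nat.factorial h ≤ mulRep h A n ∨ 1 ≤ mulRep (h - 1) B n := by
    subst hB
    obtain ⟨k, rfl⟩ := Nat.exists_eq_add_of_le' hh
    obtain ⟨f, hfA, hfn⟩ := (one_le_mulRep_iff hn).1 (hMB n hn)
    by_cases hf : Function.Injective f
    · exact Or.inl (factorial_le_mulRep_of_injective hn hf hfA hfn)
    · obtain ⟨i, j, hij, hne⟩ := Function.not_injective_iff.1 hf
      exact Or.inr (one_le_mulRep_of_eq hn hfA hfn hij hne)
  refine ⟨?_, key⟩
  rcases key with hA | hB
  · have : (1 : ℝ) ≤ (mulRep h A n : ℝ) / (Nat.factorial h : ℝ) := by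
      rw [one_le_div (by positivity)]
      exact_mod_cast hA
    exact this.trans (le_add_of_nonneg_right (Nat.cast_nonneg _))
  · have : (1 : ℝ) ≤ (mulRep (h - 1) B n : ℝ) := by exact_mod_cast hB
    exact this.trans (le_add_of_nonneg_left (by positivity))
end

section
/- Let P = {p_1 < p_2 < ⋯} be the set of prime numbers and let 0 < κ ≤ 1. Let Q ⊆ P satisfy Q(x) = κ·x/log x + O(x/(log x)²) as x → ∞, and suppose there exists K ∈ ℤ⁺ such that Q ∩ {p_n, p_{n+1}, …, p_{n+K}} ≠ ∅ for every n ∈ ℤ⁺. Let 0 < τ < κ and a ∈ (0,∞). Then there exist R ⊆ Q and L ∈ ℤ⁺ such that: (i) R ∩ {p_n, p_{n+1}, …, p_{n+L}} ≠ ∅ for every n ∈ ℤ⁺; (ii) R(x) = τ·x/log x + O(x/(log x)²) as x → ∞; and (iii) lim_{x→∞} (∏_{p≤x, p∈R} p/(p-1)) · (∏_{p≤x, p prime} (p-1)/p)^τ = a. -/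
open Filter Real Asymptotics
open scoped Classical

/-- Sum of `f` over the elements of `A` that are at most `N`. -/
noncomputable def partialSum (A : Set ℕ) (f : ℕ → ℝ) (N : ℕ) : ℝ :=
  ∑ n ∈ Finset.range (N + 1), A.indicator f n

lemma partialSum_succ (A : Set ℕ) (f : ℕ → ℝ) (N : ℕ) :
    partialSum A f (N + 1) = partialSum A f N + A.indicator f (N + 1) :=
  Finset.sum_range_succ _ _

lemma partialSum_zero {A : Set ℕ} (hA : 0 ∉ A) (f : ℕ → ℝ) : partialSum A f 0 = 0 := by
  simp [partialSum, hA]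

lemma partialSum_union {A B : Set ℕ} (h : Disjoint A B) (f : ℕ → ℝ) (N : ℕ) :
    partialSum (A ∪ B) f N = partialSum A f N + partialSum B f N := by
  simp only [partialSum, Set.indicator_union_of_disjoint h, Finset.sum_add_distrib]

/-- A sequence with summable increments converges. -/
lemma exists_tendsto_of_summable_increments {F : ℕ → ℝ}
    (h : Summable fun n => F (n + 1) - F n) : ∃ c, Tendsto F atTop (nhds c) := by
  have h1 := h.hasSum.tendsto_sum_nat
  simp only [Finset.sum_range_sub] at h1
  exact ⟨_, (h1.add_const (F 0)).congr fun n => sub_add_cancel _ _⟩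

lemma summable_sub_succ_of_antitone {t : ℕ → ℝ} (ht : Antitone t) (h0 : ∀ n, 0 ≤ t n) :
    Summable fun n => t n - t (n + 1) := by
  refine summable_of_sum_range_le (c := t 0) (fun n => sub_nonneg.2 (ht n.le_succ)) fun n => ?_
  rw [Finset.sum_range_sub']
  linarith [h0 n]

lemma log_natCast_pos {n : ℕ} (hn : 2 ≤ n) : 0 < Real.log n :=
  Real.log_pos (by exact_mod_cast hn)

lemma one_div_succ_le_log_succ_sub {n : ℕ} (hn : 1 ≤ n) :
    1 / ((n : ℝ) + 1) ≤ Real.log (n + 1) - Real.log n := by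
  have h : (0 : ℝ) < n := by exact_mod_cast hn
  have := Real.one_sub_inv_le_log_of_pos (x := ((n : ℝ) + 1) / n) (by positivity)
  rw [Real.log_div (by positivity) (by positivity)] at this
  refine le_trans (le_of_eq ?_) this
  field_simp
  ring

lemma log_succ_sub_le_one_div {n : ℕ} (hn : 1 ≤ n) :
    Real.log (n + 1) - Real.log n ≤ 1 / (n : ℝ) := by
  have h : (0 : ℝ) < n := by exact_mod_cast hn
  have := Real.log_le_sub_one_of_pos (x := ((n : ℝ) + 1) / n) (by positivity)
  rw [Real.log_div (by positivity) (by positivity)] at this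
  refine le_trans this (le_of_eq ?_)
  field_simp
  ring

lemma summable_inv_log_sub_inv_log_succ :
    Summable fun n : ℕ => 1 / Real.log n - 1 / Real.log (n + 1) := by
  rw [← summable_nat_add_iff 2]
  have := summable_sub_succ_of_antitone (t := fun n : ℕ => 1 / Real.log ((n + 2 : ℕ) : ℝ))
    (fun a b hab => one_div_le_one_div_of_le (log_natCast_pos (by omega))
      (Real.log_le_log (by positivity) (by exact_mod_cast (by omega))))
    (fun n => (one_div_pos.2 (log_natCast_pos (by omega))).le)
  refine this.congr fun n => ?_
  push_cast
  ring_nf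

lemma summable_one_div_mul_log_sub_succ :
    Summable fun n : ℕ => 1 / (n * Real.log n) - 1 / ((n + 1) * Real.log (n + 1)) := by
  rw [← summable_nat_add_iff 2]
  have hpos : ∀ n : ℕ, 0 < ((n + 2 : ℕ) : ℝ) * Real.log ((n + 2 : ℕ) : ℝ) := fun n =>
    mul_pos (by positivity) (log_natCast_pos (by omega))
  have := summable_sub_succ_of_antitone
    (t := fun n : ℕ => 1 / (((n + 2 : ℕ) : ℝ) * Real.log ((n + 2 : ℕ) : ℝ)))
    (fun a b hab => one_div_le_one_div_of_le (hpos a) (mul_le_mul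
      (by exact_mod_cast (by omega))
      (Real.log_le_log (by positivity) (by exact_mod_cast (by omega)))
      (log_natCast_pos (by omega)).le (by positivity)))
    (fun n => (one_div_pos.2 (hpos n)).le)
  refine this.congr fun n => ?_
  push_cast
  ring_nf

lemma summable_one_div_mul_log_sq : Summable fun n : ℕ => 1 / (n * Real.log n ^ 2) := by
  rw [← summable_nat_add_iff 3]
  refine Summable.of_nonneg_of_le (fun n => by positivity) (fun n => ?_)
    ((summable_nat_add_iff 2).2 summable_inv_log_sub_inv_log_succ)
  have h1 : 0 < Real.log ((n + 2 : ℕ) : ℝ) := log_natCast_pos (by omega)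
  have h2 := one_div_succ_le_log_succ_sub (n := n + 2) (by omega)
  have h3 : Real.log ((n + 2 : ℕ) : ℝ) ≤ Real.log (((n + 2 : ℕ) : ℝ) + 1) :=
    Real.log_le_log (by positivity) (by linarith)
  have e : ((n + 3 : ℕ) : ℝ) = ((n + 2 : ℕ) : ℝ) + 1 := by push_cast; ring
  rw [e]
  generalize Real.log ((n + 2 : ℕ) : ℝ) = x at *
  generalize Real.log (((n + 2 : ℕ) : ℝ) + 1) = y at *
  have hy : 0 < y := by linarith
  have hm : (0:ℝ) < ((n + 2 : ℕ) : ℝ) + 1 := by positivity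
  generalize ((n + 2 : ℕ) : ℝ) + 1 = m at *
  calc 1 / (m * y ^ 2) = 1 / m * (1 / y * (1 / y)) := by field_simp
    _ ≤ (y - x) * (1 / x * (1 / y)) := by gcongr
    _ = 1 / x - 1 / y := by field_simp

/-- Abel summation: if `A` has `α n / log n + O(n / log² n)` elements up to `n`, then the sum of
reciprocals of its elements is `α ∑ 1 / (n log n)` up to a convergent error. -/
lemma exists_tendsto_partialSum_inv {A : Set ℕ} (hA : 0 ∉ A) {α : ℝ}
    (h : (fun n : ℕ => partialSum A 1 n - α * n / Real.log n) =O[atTop]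
      fun n : ℕ => (n : ℝ) / Real.log n ^ 2) :
    ∃ c, Tendsto (fun N => partialSum A (fun n => 1 / (n : ℝ)) N -
      α * ∑ n ∈ Finset.range (N + 1), 1 / ((n : ℝ) * Real.log n)) atTop (nhds c) := by
  have hlog : Tendsto (fun n : ℕ => Real.log n) atTop atTop :=
    Real.tendsto_log_atTop.comp tendsto_natCast_atTop_atTop
  have hF : ∃ c, Tendsto (fun N => partialSum A (fun n => 1 / (n : ℝ)) N -
      partialSum A 1 N / (N + 1) -
      α * ∑ n ∈ Finset.range (N + 1), 1 / ((n : ℝ) * Real.log n)) atTop (nhds c) := by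
    apply exists_tendsto_of_summable_increments
    have key : (fun n : ℕ => (partialSum A 1 n - α * n / Real.log n) * (1 / (n * (n + 1))) -
        α / (n * (n + 1) * Real.log n)) =O[atTop] fun n : ℕ => 1 / (n * Real.log n ^ 2) := by
      refine IsBigO.sub ?_ ?_
      · refine (h.mul (isBigO_refl _ _)).trans (IsBigO.of_bound 1 ?_)
        filter_upwards [eventually_ge_atTop 2] with n hn
        have hn0 : (0:ℝ) < n := by positivity
        have := log_natCast_pos hn
        rw [Real.norm_of_nonneg (by positivity), Real.norm_of_nonneg (by positivity), one_mul]
        rw [div_mul_div_comm, div_le_div_iff₀ (by positivity) (by positivity)]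
        have : 0 ≤ (n:ℝ) * Real.log n ^ 2 := by positivity
        nlinarith
      · refine IsBigO.of_bound |α| ?_
        filter_upwards [eventually_ge_atTop 2] with n hn
        have hn0 : (0:ℝ) < n := by positivity
        have := log_natCast_pos hn
        rw [norm_div, Real.norm_eq_abs, Real.norm_of_nonneg (by positivity),
          Real.norm_of_nonneg (by positivity), div_eq_mul_one_div]
        refine mul_le_mul_of_nonneg_left (one_div_le_one_div_of_le (by positivity) ?_)
          (abs_nonneg _)
        have : Real.log n ≤ n + 1 := by linarith [Real.log_le_sub_one_of_pos hn0]
        have h2 : n * Real.log n * Real.log n ≤ n * Real.log n * (n + 1) := by gcongr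
        linarith
    have hs := summable_of_isBigO_nat summable_one_div_mul_log_sq key
    refine ((summable_nat_add_iff 1).2 hs).congr fun n => ?_
    rw [partialSum_succ, partialSum_succ, Finset.sum_range_succ _ (n + 1)]
    by_cases hn : n = 0
    · subst hn
      simp [partialSum_zero hA]
      by_cases h1 : 1 ∈ A <;> simp [h1]; norm_num
    have := log_natCast_pos (show 2 ≤ n + 1 by omega)
    by_cases h1 : n + 1 ∈ A <;> simp [h1] <;> push_cast at * <;> field_simp <;> ring
  obtain ⟨c, hc⟩ := hF
  have h0 : Tendsto (fun N : ℕ => partialSum A 1 N / (N + 1)) atTop (nhds 0) := by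
    have h1 : (fun N : ℕ => partialSum A 1 N / (N + 1)) =O[atTop]
        fun N : ℕ => 1 / Real.log N := by
      have h2 : (fun n : ℕ => partialSum A 1 n) =O[atTop] fun n : ℕ => (n : ℝ) / Real.log n := by
        have h3 : (fun n : ℕ => α * n / Real.log n) =O[atTop]
            fun n : ℕ => (n : ℝ) / Real.log n := by
          simp only [mul_div_assoc]
          exact (isBigO_refl _ _).const_mul_left _
        refine ((h.trans ?_).add h3).congr_left fun n => by ring
        refine IsBigO.of_bound 1 ?_
        filter_upwards [eventually_ge_atTop 2, hlog.eventually_ge_atTop 1] with n hn hn1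
        rw [Real.norm_of_nonneg (by positivity), Real.norm_of_nonneg (by positivity), one_mul]
        gcongr
        nlinarith
      refine (h2.mul (isBigO_refl (fun N : ℕ => 1 / ((N : ℝ) + 1)) _)).trans
        (IsBigO.of_bound 1 ?_) |>.congr_left fun n => by ring
      filter_upwards [eventually_ge_atTop 2] with n hn
      have hn0 : (0:ℝ) < n := by positivity
      have := log_natCast_pos hn
      rw [Real.norm_of_nonneg (by positivity), Real.norm_of_nonneg (by positivity), one_mul,
        div_mul_div_comm, div_le_div_iff₀ (by positivity) (by positivity)]
      nlinarith
    exact h1.trans_tendsto (by simpa using hlog.const_div_atTop 1)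
  refine ⟨c + 0, (hc.add h0).congr fun n => by ring⟩

lemma log_factorial_eq_partialSum (n : ℕ) : Real.log n.factorial =
    partialSum {p | p.Prime} (fun p => n.factorial.factorization p * Real.log p) n := by
  rw [Real.log_nat_eq_sum_factorization, partialSum,
    Finsupp.sum_of_support_subset (s := Finset.range (n + 1))]
  · refine Finset.sum_congr rfl fun p _ => ?_
    by_cases hp : p.Prime
    · simp [hp]
    · simp [hp, Nat.factorization_eq_zero_of_not_prime]
  · intro p hp
    rw [Nat.support_factorization, Nat.mem_primeFactors] at hp
    have := hp.1.dvd_factorial.1 hp.2.1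
    simp
    omega
  · simp

lemma natCast_div_sub_one_le_factorization_factorial {p n : ℕ} (hp : p.Prime) (hpn : p ≤ n) :
    (n : ℝ) / p - 1 ≤ n.factorial.factorization p := by
  have h1 : n / p ≤ n.factorial.factorization p := by
    rw [Nat.factorization_factorial hp (Nat.lt_succ_self _)]
    have h1 : 1 ∈ Finset.Ico 1 (Nat.log p n).succ := by
      simpa using Nat.log_pos hp.one_lt hpn
    simpa using Finset.single_le_sum (f := fun i => n / p ^ i) (fun _ _ => Nat.zero_le _) h1
  have h2 := Nat.lt_floor_add_one ((n : ℝ) / p)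
  rw [Nat.floor_div_eq_div] at h2
  have h3 : ((n / p : ℕ) : ℝ) ≤ n.factorial.factorization p := by exact_mod_cast h1
  linarith

lemma factorization_factorial_le_div {p n : ℕ} (hp : p.Prime) :
    (n.factorial.factorization p : ℝ) ≤ n / ((p : ℝ) - 1) := by
  have h := Nat.sub_one_mul_factorization_factorial (n := n) hp
  have h1 : (p - 1) * n.factorial.factorization p ≤ n := by omega
  have h2 : (1 : ℝ) < p := by exact_mod_cast hp.one_lt
  rw [le_div_iff₀ (by linarith), mul_comm]
  have h3 : (((p - 1 : ℕ) : ℝ)) * n.factorial.factorization p ≤ n := by exact_mod_cast h1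
  rwa [Nat.cast_sub hp.one_le, Nat.cast_one] at h3

lemma summable_log_div_mul_sub_one :
    Summable fun n : ℕ => Real.log n / (n * ((n : ℝ) - 1)) := by
  have h := (Real.summable_nat_rpow_inv (p := 3 / 2)).2 (by norm_num)
  refine summable_of_isBigO_nat h (IsBigO.of_bound 4 ?_)
  filter_upwards [eventually_ge_atTop 2] with n hn
  have hn2 : (2 : ℝ) ≤ n := by exact_mod_cast hn
  have := log_natCast_pos hn
  have hn1 : (0 : ℝ) < n - 1 := by linarith
  rw [Real.norm_of_nonneg (by positivity), Real.norm_of_nonneg (by positivity)]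
  have h1 := Real.log_le_rpow_div (x := n) (ε := 1 / 2) (by positivity) (by norm_num)
  have h2 : (n : ℝ) ^ (3 / 2 : ℝ) * (n : ℝ) ^ (1 / 2 : ℝ) = n ^ 2 := by
    rw [← Real.rpow_add (by positivity)]
    norm_num
  have h3 : (0 : ℝ) < (n : ℝ) ^ (3 / 2 : ℝ) := by positivity
  rw [div_le_iff₀ (by positivity), mul_assoc, inv_mul_eq_div, ← mul_div_assoc,
    le_div_iff₀ (by positivity)]
  calc Real.log n * (n : ℝ) ^ (3 / 2 : ℝ) ≤ (n : ℝ) ^ (1 / 2 : ℝ) / (1 / 2) * n ^ (3 / 2 : ℝ) := by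
        gcongr
    _ = 2 * (n : ℝ) ^ 2 := by rw [← h2]; ring
    _ ≤ 4 * (n * (n - 1)) := by nlinarith

/-- Mertens' first theorem. -/
lemma exists_abs_partialSum_log_div_sub_log_le :
    ∃ C, ∀ n : ℕ, 1 ≤ n →
      |partialSum {p | p.Prime} (fun p => Real.log p / p) n - Real.log n| ≤ C := by
  set c := ∑' n : ℕ, Real.log n / (n * ((n : ℝ) - 1))
  have hc : 0 ≤ c := tsum_nonneg fun n => by
    rcases Nat.lt_or_ge n 2 with h | h
    · interval_cases n <;> simp
    · have : (2 : ℝ) ≤ n := by exact_mod_cast h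
      have := log_natCast_pos h
      have : (0 : ℝ) < n - 1 := by linarith
      positivity
  refine ⟨max (Real.log 4) (1 + c), fun n hn => ?_⟩
  have hn0 : (0 : ℝ) < n := by exact_mod_cast hn
  have hfac := log_factorial_eq_partialSum n
  rw [abs_le]
  constructor
  · have h1 : Real.log n.factorial ≤
        n * partialSum {p | p.Prime} (fun p => Real.log p / p) n + n * c := by
      have h2 : ∑ p ∈ Finset.range (n + 1), Set.indicator {p | p.Prime}
          (fun p : ℕ => Real.log p / (p * ((p : ℝ) - 1))) p ≤ c := by
        refine (Finset.sum_le_sum fun p _ => ?_).trans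
          (summable_log_div_mul_sub_one.sum_le_tsum (Finset.range (n + 1)) fun p _ => ?_)
        · by_cases hp : p.Prime
          · simp [hp]
          · simp only [Set.indicator, Set.mem_ofPred_eq, hp, if_false]
            rcases Nat.lt_or_ge p 2 with h | h
            · interval_cases p <;> simp
            · have : (2 : ℝ) ≤ p := by exact_mod_cast h
              have := log_natCast_pos h
              have : (0 : ℝ) < p - 1 := by linarith
              positivity
        · rcases Nat.lt_or_ge p 2 with h | h
          · interval_cases p <;> simp
          · have : (2 : ℝ) ≤ p := by exact_mod_cast h
            have := log_natCast_pos h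
            have : (0 : ℝ) < p - 1 := by linarith
            positivity
      refine le_trans ?_ (add_le_add_right (mul_le_mul_of_nonneg_left h2 hn0.le) _)
      rw [hfac, partialSum, partialSum, ← mul_add, ← Finset.sum_add_distrib, Finset.mul_sum]
      refine Finset.sum_le_sum fun p _ => ?_
      by_cases hp : p.Prime
      · simp only [Set.indicator, Set.mem_ofPred_eq, hp, if_true]
        have h3 : (1 : ℝ) < p := by exact_mod_cast hp.one_lt
        have h4 : (0 : ℝ) < p - 1 := by linarith
        calc _ ≤ n / ((p : ℝ) - 1) * Real.log p := by
              gcongr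
              exact factorization_factorial_le_div hp
          _ = _ := by field_simp; ring
      · simp [hp]
    have h2 := Stirling.le_log_factorial_stirling (n := n) (by omega)
    have h3 : 0 ≤ Real.log n := Real.log_natCast_nonneg n
    have h4 : 0 ≤ Real.log (2 * Real.pi) := Real.log_nonneg (by linarith [Real.pi_gt_three])
    have h5 : n * (Real.log n - 1 - c) ≤
        n * partialSum {p | p.Prime} (fun p => Real.log p / p) n := by linarith
    have := le_of_mul_le_mul_left h5 hn0
    linarith [le_max_right (Real.log 4) (1 + c)]
  · have h1 : n * partialSum {p | p.Prime} (fun p => Real.log p / p) n ≤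
        Real.log n.factorial + Chebyshev.theta n := by
      rw [hfac, Chebyshev.theta_eq_sum_Icc, Nat.floor_natCast, Finset.sum_filter,
        ← Nat.range_succ_eq_Icc_zero, partialSum, partialSum, ← Finset.sum_add_distrib,
        Finset.mul_sum]
      refine Finset.sum_le_sum fun p hpn => ?_
      by_cases hp : p.Prime
      · simp only [Set.indicator, Set.mem_ofPred_eq, hp, if_true]
        have h3 := natCast_div_sub_one_le_factorization_factorial hp
          (Nat.lt_succ_iff.1 (Finset.mem_range.1 hpn))
        have h4 := Real.log_natCast_nonneg p
        calc _ = ((n : ℝ) / p - 1) * Real.log p + Real.log p := by ring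
          _ ≤ _ := by gcongr
      · simp [hp]
    have h2 := Chebyshev.theta_le_log4_mul_x (x := n) hn0.le
    have h3 : Real.log n.factorial ≤ n * Real.log n := by
      rw [← Real.log_pow]
      exact Real.log_le_log (by positivity) (by exact_mod_cast n.factorial_le_pow)
    have h5 : n * partialSum {p | p.Prime} (fun p => Real.log p / p) n ≤
        n * (Real.log n + Real.log 4) := by linarith
    have := le_of_mul_le_mul_left h5 hn0
    linarith [le_max_left (Real.log 4) (1 + c)]

/-- Mertens' second theorem, with `∑ 1 / (n log n)` in place of `log log`. -/
lemma exists_tendsto_partialSum_prime_inv :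
    ∃ c, Tendsto (fun N => partialSum {p | p.Prime} (fun n => 1 / (n : ℝ)) N -
      ∑ n ∈ Finset.range (N + 1), 1 / ((n : ℝ) * Real.log n)) atTop (nhds c) := by
  obtain ⟨C, hC⟩ := exists_abs_partialSum_log_div_sub_log_le
  set A := fun N => partialSum {p | p.Prime} (fun p => Real.log p / p) N with hA
  have hlog1 : Tendsto (fun n : ℕ => Real.log ((n : ℝ) + 1)) atTop atTop :=
    Real.tendsto_log_atTop.comp (tendsto_natCast_atTop_atTop.atTop_add tendsto_const_nhds)
  have hF : ∃ c, Tendsto (fun N => partialSum {p | p.Prime} (fun n => 1 / (n : ℝ)) N -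
      A N / Real.log (N + 1) -
      ∑ n ∈ Finset.range (N + 1), 1 / ((n : ℝ) * Real.log n)) atTop (nhds c) := by
    apply exists_tendsto_of_summable_increments
    have k1 : Summable fun n : ℕ =>
        (A n - Real.log n) * (1 / Real.log n - 1 / Real.log (n + 1)) := by
      refine summable_of_isBigO_nat summable_inv_log_sub_inv_log_succ (IsBigO.of_bound C ?_)
      filter_upwards [eventually_ge_atTop 1] with n hn
      rw [norm_mul]
      exact mul_le_mul_of_nonneg_right (hC n hn) (norm_nonneg _)
    have k2 : Summable fun n : ℕ =>
        Real.log n * (1 / Real.log n - 1 / Real.log (n + 1)) - 1 / (n * Real.log n) := by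
      refine summable_of_isBigO_nat summable_one_div_mul_log_sub_succ (IsBigO.of_bound 1 ?_)
      filter_upwards [eventually_ge_atTop 2] with n hn
      have h1 := log_natCast_pos hn
      have h2 := one_div_succ_le_log_succ_sub (n := n) (by omega)
      have h3 := log_succ_sub_le_one_div (n := n) (by omega)
      have hn0 : (0 : ℝ) < n := by positivity
      have h4 : Real.log n ≤ Real.log (n + 1) := Real.log_le_log hn0 (by linarith)
      have h5 : 0 < Real.log ((n : ℝ) + 1) := by linarith
      have e : Real.log n * (1 / Real.log n - 1 / Real.log (n + 1)) =
          (Real.log (n + 1) - Real.log n) / Real.log (n + 1) := by field_simp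
      have h6 : (Real.log (n + 1) - Real.log n) / Real.log (n + 1) ≤ 1 / (n * Real.log n) := by
        rw [← div_div]
        gcongr
      have h7 : 1 / ((n + 1) * Real.log (n + 1)) ≤
          (Real.log (n + 1) - Real.log n) / Real.log (n + 1) := by
        rw [← div_div]
        gcongr
      rw [e, one_mul, Real.norm_eq_abs, Real.norm_eq_abs, abs_sub_comm, abs_of_nonneg (by linarith),
        abs_of_nonneg (by linarith)]
      linarith
    refine ((summable_nat_add_iff 1).2 (k1.add k2)).congr fun n => ?_
    rw [Finset.sum_range_succ _ (n + 1), partialSum_succ, hA]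
    simp only [partialSum_succ]
    by_cases hn : n = 0
    · subst hn
      simp [partialSum_zero, Nat.not_prime_zero, Nat.not_prime_one]
    have h1 := log_natCast_pos (show 2 ≤ n + 1 by omega)
    have h2 := log_natCast_pos (show 2 ≤ n + 2 by omega)
    by_cases hp : (n + 1).Prime <;> simp [hp] <;> push_cast at * <;>
      (rw [show (n : ℝ) + 1 + 1 = n + 2 by ring]; field_simp; ring)
  obtain ⟨c, hc⟩ := hF
  have h0 : Tendsto (fun N : ℕ => A N / Real.log (N + 1)) atTop (nhds 1) := by
    have h1 : Tendsto (fun N : ℕ => (A N - Real.log (N + 1)) / Real.log (N + 1)) atTop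
        (nhds 0) := by
      refine squeeze_zero_norm' ?_ (hlog1.const_div_atTop (C + 1))
      filter_upwards [eventually_ge_atTop 1] with n hn
      have h2 := hC n hn
      have h3 := log_succ_sub_le_one_div hn
      have h4 : 1 / (n : ℝ) ≤ 1 := by
        rw [div_le_one (by positivity)]; exact_mod_cast hn
      have hn0 : (0 : ℝ) < n := by positivity
      have h5 : Real.log n ≤ Real.log (n + 1) := Real.log_le_log hn0 (by linarith)
      have h6 : 0 < Real.log ((n : ℝ) + 1) := Real.log_pos (by linarith)
      rw [norm_div, Real.norm_of_nonneg h6.le, Real.norm_eq_abs]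
      gcongr
      rw [abs_le] at *
      constructor <;> linarith
    refine ((h1.add_const 1).congr' ?_).trans (by simp)
    filter_upwards [eventually_ge_atTop 1] with n hn
    have hn0 : (0 : ℝ) < n := by positivity
    have h6 : 0 < Real.log ((n : ℝ) + 1) := Real.log_pos (by linarith)
    field_simp
    ring
  refine ⟨c + 1, (hc.add h0).congr fun n => by ring⟩

lemma tendsto_sum_one_div_mul_log_atTop :
    Tendsto (fun N : ℕ => ∑ n ∈ Finset.range (N + 1), 1 / ((n : ℝ) * Real.log n))
      atTop atTop := by
  obtain ⟨c, hc⟩ := exists_tendsto_partialSum_prime_inv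
  have h : Tendsto (fun N : ℕ => partialSum {p | p.Prime} (fun n => 1 / (n : ℝ)) N)
      atTop atTop := by
    have h1 := (not_summable_iff_tendsto_nat_atTop_of_nonneg (fun n => Set.indicator_nonneg
      (fun n _ => by positivity) n)).1 not_summable_one_div_on_primes
    exact h1.comp (tendsto_add_atTop_nat 1)
  refine (h.atTop_add hc.neg).congr fun n => by ring

lemma partialSum_mono {A : Set ℕ} {f : ℕ → ℝ} (hf : ∀ n ∈ A, 0 ≤ f n) :
    Monotone (partialSum A f) :=
  monotone_nat_of_le_succ fun n => by
    rw [partialSum_succ]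
    linarith [Set.indicator_nonneg hf (n + 1)]

lemma partialSum_nonneg {A : Set ℕ} {f : ℕ → ℝ} (hf : ∀ n ∈ A, 0 ≤ f n) (n : ℕ) :
    0 ≤ partialSum A f n :=
  Finset.sum_nonneg fun m _ => Set.indicator_nonneg hf m

lemma partialSum_one_mono (A : Set ℕ) : Monotone (partialSum A 1) :=
  partialSum_mono fun _ _ => zero_le_one

lemma exists_mem_of_partialSum_lt {A : Set ℕ} {f : ℕ → ℝ} {a b : ℕ} (hab : a ≤ b)
    (h : partialSum A f a < partialSum A f b) : ∃ m ∈ A, a < m ∧ m ≤ b := by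
  by_contra! hne
  refine h.ne ?_
  clear h
  induction b, hab using Nat.le_induction with
  | base => rfl
  | succ n hn ih =>
    rw [partialSum_succ, ← ih fun m hm ham => (hne m hm ham).trans' (by omega)]
    have : n + 1 ∉ A := fun hm => absurd (hne _ hm (by omega)) (by omega)
    simp [this]

lemma partialSum_inter_Ioi {A : Set ℕ} (hA : 0 ∉ A) (f : ℕ → ℝ) (N n : ℕ) :
    partialSum (A ∩ Set.Ioi N) f n = partialSum A f n - partialSum A f (min n N) := by
  induction n with
  | zero => simp [partialSum_zero, hA]
  | succ n ih =>
    rw [partialSum_succ, partialSum_succ, ih]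
    rcases Nat.lt_or_ge N (n + 1) with h | h
    · rw [min_eq_right (by omega), min_eq_right (by omega)]
      by_cases hm : n + 1 ∈ A <;> simp [hm, h]
      · ring
    · rw [min_eq_left (by omega), min_eq_left (by omega), partialSum_succ]
      simp [show ¬ N < n + 1 by omega]

/-- The logarithm of the Euler factor `n / (n - 1)`. -/
noncomputable def logEulerFactor (n : ℕ) : ℝ := Real.log (n / (n - 1))

lemma one_div_le_logEulerFactor {n : ℕ} (hn : 2 ≤ n) : 1 / (n : ℝ) ≤ logEulerFactor n := by
  have h : (2 : ℝ) ≤ n := by exact_mod_cast hn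
  have h1 : (0 : ℝ) < n - 1 := by linarith
  have := Real.one_sub_inv_le_log_of_pos (x := (n : ℝ) / (n - 1)) (by positivity)
  refine le_trans (le_of_eq ?_) this
  field_simp
  ring

lemma logEulerFactor_le_one_div {n : ℕ} (hn : 2 ≤ n) :
    logEulerFactor n ≤ 1 / ((n : ℝ) - 1) := by
  have h : (2 : ℝ) ≤ n := by exact_mod_cast hn
  have h1 : (0 : ℝ) < n - 1 := by linarith
  have := Real.log_le_sub_one_of_pos (x := (n : ℝ) / (n - 1)) (by positivity)
  refine le_trans this (le_of_eq ?_)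
  field_simp
  ring

lemma logEulerFactor_pos {n : ℕ} (hn : 2 ≤ n) : 0 < logEulerFactor n :=
  lt_of_lt_of_le (by positivity) (one_div_le_logEulerFactor hn)

lemma exists_tendsto_partialSum_logEulerFactor_sub {A : Set ℕ} (hA : ∀ n ∈ A, 2 ≤ n) :
    ∃ c, Tendsto (fun N => partialSum A logEulerFactor N -
      partialSum A (fun n => 1 / (n : ℝ)) N) atTop (nhds c) := by
  apply exists_tendsto_of_summable_increments
  have h : (fun n : ℕ => A.indicator logEulerFactor n - A.indicator (fun n => 1 / (n : ℝ)) n)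
      =O[atTop] fun n : ℕ => 1 / (n : ℝ) ^ 2 := by
    refine IsBigO.of_bound 2 (Eventually.of_forall fun n => ?_)
    by_cases hn : n ∈ A
    · have h2 := hA n hn
      have h3 : (2 : ℝ) ≤ n := by exact_mod_cast h2
      have h4 := one_div_le_logEulerFactor h2
      have h5 := logEulerFactor_le_one_div h2
      have h1 : (0 : ℝ) < n - 1 := by linarith
      simp only [hn, Set.indicator_of_mem]
      rw [Real.norm_of_nonneg (by linarith), Real.norm_of_nonneg (by positivity)]
      calc logEulerFactor n - 1 / n ≤ 1 / ((n : ℝ) - 1) - 1 / n := by linarith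
        _ = 1 / ((n : ℝ) * (n - 1)) := by field_simp; ring
        _ ≤ 1 / (n * (n / 2)) := by gcongr; linarith
        _ = 2 * (1 / (n : ℝ) ^ 2) := by field_simp
    · simp [hn]
  have hs := summable_of_isBigO_nat (Real.summable_one_div_nat_pow.2 one_lt_two) h
  refine ((summable_nat_add_iff 1).2 hs).congr fun n => ?_
  simp only [partialSum_succ]
  ring

lemma isLittleO_div_log_sq_div_log :
    (fun n : ℕ => (n : ℝ) / Real.log n ^ 2) =o[atTop] fun n : ℕ => (n : ℝ) / Real.log n := by
  have hlog : Tendsto (fun n : ℕ => Real.log n) atTop atTop :=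
    Real.tendsto_log_atTop.comp tendsto_natCast_atTop_atTop
  rw [isLittleO_iff]
  intro c hc
  filter_upwards [eventually_ge_atTop 2, hlog.eventually_ge_atTop (1 / c)] with n hn hn1
  have h := log_natCast_pos hn
  rw [Real.norm_of_nonneg (by positivity), Real.norm_of_nonneg (by positivity)]
  rw [div_le_iff₀ hc] at hn1
  rw [div_le_iff₀ (by positivity)]
  have : c * (n / Real.log n) * Real.log n ^ 2 = n * (Real.log n * c) := by field_simp
  rw [this]
  exact le_mul_of_one_le_right (by positivity) hn1

/-- A set with `α n / log n + O(n / log² n)` elements up to `n`, where `α > 0`, meets every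
interval `(x, 5 * x / 4]` with `x` large. -/
lemma exists_mem_Ioc_five_fourths {A : Set ℕ} {α : ℝ} (hα : 0 < α)
    (h : (fun n : ℕ => partialSum A 1 n - α * n / Real.log n) =O[atTop]
      fun n : ℕ => (n : ℝ) / Real.log n ^ 2) :
    ∃ X : ℕ, ∀ x ≥ X, ∃ e ∈ A, x < e ∧ 4 * e ≤ 5 * x := by
  have h1 := (h.trans_isLittleO isLittleO_div_log_sq_div_log).bound
    (show 0 < α / 100 by positivity)
  have hlog : Tendsto (fun n : ℕ => Real.log n) atTop atTop :=
    Real.tendsto_log_atTop.comp tendsto_natCast_atTop_atTop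
  obtain ⟨X, hX⟩ := eventually_atTop.1 (h1.and ((eventually_ge_atTop 20).and
    (hlog.eventually_ge_atTop 20)))
  refine ⟨X, fun x hx => ?_⟩
  have hy1 : x ≤ 5 * x / 4 := by omega
  obtain ⟨e, he, hxe, hey⟩ := exists_mem_of_partialSum_lt (A := A) (f := 1) hy1 (by
    obtain ⟨bx, x20, lx⟩ := hX x hx
    obtain ⟨bY, -, -⟩ := hX (5 * x / 4) (by omega)
    have hy2 : 6 * x ≤ 5 * (5 * x / 4) := by omega
    have hy3 : 5 * x / 4 ≤ 2 * x := by omega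
    generalize 5 * x / 4 = y at *
    have hx0 : (0 : ℝ) < x := by positivity
    have hxy : (6 : ℝ) * x ≤ 5 * y := by exact_mod_cast hy2
    have hyx : (y : ℝ) ≤ 2 * x := by exact_mod_cast hy3
    have hy0 : (0 : ℝ) < y := by linarith
    have lxy : Real.log x ≤ Real.log y := Real.log_le_log hx0 (by linarith)
    have ly : Real.log y ≤ 21 / 20 * Real.log x := by
      have := Real.log_le_log hy0 hyx
      rw [Real.log_mul (by norm_num) hx0.ne'] at this
      linarith [Real.log_two_lt_d9]
    have lx0 : 0 < Real.log x := by linarith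
    have ly0 : 0 < Real.log y := by linarith
    rw [Real.norm_eq_abs, Real.norm_of_nonneg (by positivity), abs_le, mul_div_assoc] at bx bY
    have : 8 / 7 * (x / Real.log x) ≤ y / Real.log y := by
      rw [le_div_iff₀ ly0]
      calc 8 / 7 * (x / Real.log x) * Real.log y
          ≤ 8 / 7 * (x / Real.log x) * (21 / 20 * Real.log x) := by gcongr
        _ = 6 / 5 * x := by field_simp; norm_num
        _ ≤ y := by linarith
    have hx1 : 0 < x / Real.log x := by positivity
    generalize (x : ℝ) / Real.log x = a at *
    generalize (y : ℝ) / Real.log y = b at *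
    nlinarith [mul_le_mul_of_nonneg_left this hα.le, mul_pos hα hx1])
  exact ⟨e, he, hxe, by omega⟩

/-- What is left of `s` after the greedy algorithm has subtracted `u m` for those `m ∈ E` with
`m ≤ n` for which the result stays nonnegative. -/
noncomputable def greedyRemainder (E : Set ℕ) (u : ℕ → ℝ) (s : ℝ) : ℕ → ℝ
  | 0 => s
  | n + 1 => if n + 1 ∈ E ∧ u (n + 1) ≤ greedyRemainder E u s n then
      greedyRemainder E u s n - u (n + 1) else greedyRemainder E u s n

/-- The elements of `E` selected by the greedy algorithm representing `s` as a sum of values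
of `u`. -/
def greedySet (E : Set ℕ) (u : ℕ → ℝ) (s : ℝ) : Set ℕ :=
  {m | ∃ n, m = n + 1 ∧ m ∈ E ∧ u m ≤ greedyRemainder E u s n}

lemma zero_notMem_greedySet {E : Set ℕ} {u : ℕ → ℝ} {s : ℝ} : 0 ∉ greedySet E u s := by
  rintro ⟨n, h, -⟩
  omega

lemma succ_mem_greedySet {E : Set ℕ} {u : ℕ → ℝ} {s : ℝ} {n : ℕ} :
    n + 1 ∈ greedySet E u s ↔ n + 1 ∈ E ∧ u (n + 1) ≤ greedyRemainder E u s n := by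
  constructor
  · rintro ⟨m, h, h1⟩
    obtain rfl : n = m := by omega
    exact h1
  · intro h
    exact ⟨n, rfl, h⟩

lemma greedyRemainder_succ (E : Set ℕ) (u : ℕ → ℝ) (s : ℝ) (n : ℕ) :
    greedyRemainder E u s (n + 1) =
      greedyRemainder E u s n - (greedySet E u s).indicator u (n + 1) := by
  rw [greedyRemainder]
  by_cases h : n + 1 ∈ greedySet E u s
  · rw [if_pos (succ_mem_greedySet.1 h), Set.indicator_of_mem h]
  · rw [if_neg (mt succ_mem_greedySet.2 h), Set.indicator_of_notMem h, sub_zero]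

lemma partialSum_greedySet (E : Set ℕ) (u : ℕ → ℝ) (s : ℝ) (n : ℕ) :
    partialSum (greedySet E u s) u n = s - greedyRemainder E u s n := by
  induction n with
  | zero => simp [partialSum_zero zero_notMem_greedySet, greedyRemainder]
  | succ n ih => rw [partialSum_succ, ih, greedyRemainder_succ]; ring

lemma greedyRemainder_nonneg (E : Set ℕ) (u : ℕ → ℝ) {s : ℝ} (hs : 0 ≤ s) (n : ℕ) :
    0 ≤ greedyRemainder E u s n := by
  induction n with
  | zero => exact hs
  | succ n ih =>
    rw [greedyRemainder]
    split_ifs with h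
    · linarith [h.2]
    · exact ih

lemma exists_notMem_greedySet {E : Set ℕ} {u : ℕ → ℝ} {s : ℝ} (hs : 0 ≤ s)
    (hdiv : Tendsto (partialSum E u) atTop atTop) (Y : ℕ) :
    ∃ e ≥ Y, e ∈ E ∧ e ∉ greedySet E u s := by
  by_contra! hall
  have h : ∀ n ≥ Y, partialSum E u n - partialSum E u Y =
      partialSum (greedySet E u s) u n - partialSum (greedySet E u s) u Y := by
    intro n hn
    induction n, hn using Nat.le_induction with
    | base => simp
    | succ n hn ih =>
      have hiff : n + 1 ∈ greedySet E u s ↔ n + 1 ∈ E :=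
        ⟨fun h => (succ_mem_greedySet.1 h).1, hall _ (by omega)⟩
      rw [partialSum_succ, partialSum_succ]
      by_cases he : n + 1 ∈ E
      · rw [Set.indicator_of_mem he, Set.indicator_of_mem (hiff.2 he)]
        linarith
      · rw [Set.indicator_of_notMem he, Set.indicator_of_notMem (mt hiff.1 he)]
        linarith
  obtain ⟨n, hn, hn1⟩ := ((eventually_ge_atTop Y).and (hdiv.eventually_gt_atTop
    (partialSum E u Y + s - partialSum (greedySet E u s) u Y))).exists
  have := h n hn
  rw [partialSum_greedySet _ _ _ n] at this
  linarith [greedyRemainder_nonneg E u hs n]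

/-- If `E` has divergent sum and no large multiplicative gaps, every `s ≥ 0` is the sum of
`logEulerFactor` over a subset of `E` of logarithmic counting function. -/
lemma exists_sparse_subset_tendsto {E : Set ℕ} (hE : ∀ e ∈ E, 2 ≤ e)
    (hdiv : Tendsto (partialSum E logEulerFactor) atTop atTop)
    (hgap : ∃ X : ℕ, ∀ x ≥ X, ∃ e ∈ E, x < e ∧ 4 * e ≤ 5 * x) {s : ℝ} (hs : 0 ≤ s) :
    ∃ D ⊆ E, Tendsto (partialSum D logEulerFactor) atTop (nhds s) ∧
      ∃ C, ∀ n : ℕ, partialSum D 1 n ≤ C + 2 * Real.log (n + 1) := by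
  obtain ⟨X, hX⟩ := hgap
  set u := logEulerFactor
  set r := greedyRemainder E u s
  set G := greedySet E u s
  have hr0 : ∀ n, 0 ≤ r n := greedyRemainder_nonneg E u hs
  have hGE : G ⊆ E := by rintro _ ⟨n, rfl, h, -⟩; exact h
  obtain ⟨n0, hn0, hn0E, hn0G⟩ := exists_notMem_greedySet hs hdiv (max X 6)
  have hratio : ∀ e ≥ n0, ∀ m : ℕ, 4 * m ≤ 5 * e → 2 ≤ m → u e ≤ 3 / 2 * u m := by
    intro e he m hm hm2
    have he6 : (6 : ℝ) ≤ e := by exact_mod_cast (le_max_right X 6).trans (hn0.trans he)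
    have hm' : (4 : ℝ) * m ≤ 5 * e := by exact_mod_cast hm
    have hm0 : (0 : ℝ) < m := by positivity
    have he1 : (0 : ℝ) < e - 1 := by linarith
    calc u e ≤ 1 / ((e : ℝ) - 1) := logEulerFactor_le_one_div (by
          exact_mod_cast (by linarith : (2 : ℝ) ≤ e))
      _ ≤ 3 / 2 * (1 / m) := by
          rw [show 3 / 2 * (1 / (m : ℝ)) = 3 / (2 * m) by field_simp,
            div_le_div_iff₀ he1 (by positivity)]
          linarith
      _ ≤ 3 / 2 * u m := by gcongr; exact one_div_le_logEulerFactor hm2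
  have hnext : ∀ e ≥ n0, ∀ n, e ≤ n → (∀ m ∈ E, m ≤ n → m ≤ e) → 4 * (n + 1) ≤ 5 * e := by
    intro e he n hen hmax
    obtain ⟨m, hm, hem, hme⟩ := hX e ((le_max_left X 6).trans (hn0.trans he))
    have : n < m := by
      by_contra! hmn
      exact absurd (hmax m hm hmn) (by omega)
    omega
  have inv : ∀ n ≥ n0, ∃ e ∈ E, n0 ≤ e ∧ e ≤ n ∧ (∀ m ∈ E, m ≤ n → m ≤ e) ∧ r n < u e := by
    intro n hn
    induction n, hn using Nat.le_induction with
    | base =>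
      refine ⟨n0, hn0E, le_rfl, le_rfl, fun m _ h => h, ?_⟩
      obtain ⟨k, rfl⟩ : ∃ k, n0 = k + 1 := ⟨n0 - 1, by have := hE _ hn0E; omega⟩
      have h1 : r (k + 1) = r k := by
        simp only [r, greedyRemainder_succ]
        rw [Set.indicator_of_notMem hn0G, sub_zero]
      rw [h1]
      by_contra! hle
      exact hn0G (succ_mem_greedySet.2 ⟨hn0E, hle⟩)
    | succ n hn ih =>
      obtain ⟨e, he, hne, hen, hmax, hru⟩ := ih
      by_cases hnE : n + 1 ∈ E
      · refine ⟨n + 1, hnE, by omega, le_rfl, fun m _ h => h, ?_⟩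
        have hpos := logEulerFactor_pos (hE _ hnE)
        simp only [r, greedyRemainder]
        split_ifs with h
        · have := hratio e hne (n + 1) (hnext e hne n hen hmax) (hE _ hnE)
          simp only [u, r] at *
          linarith
        · exact not_le.1 fun hle => h ⟨hnE, hle⟩
      · refine ⟨e, he, hne, by omega, fun m hm hmn => hmax m hm ?_, ?_⟩
        · rcases hmn.lt_or_eq with h | rfl
          · omega
          · exact absurd hm hnE
        · simpa [r, greedyRemainder, hnE] using hru
  refine ⟨G, hGE, ?_, ?_⟩
  · have hr : Tendsto r atTop (nhds 0) := by
      have hlim : Tendsto (fun n : ℕ => (3 : ℝ) / n) atTop (nhds 0) :=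
        tendsto_natCast_atTop_atTop.const_div_atTop 3
      refine squeeze_zero' (Eventually.of_forall hr0) ?_ hlim
      filter_upwards [eventually_ge_atTop n0] with n hn
      obtain ⟨e, he, hne, hen, hmax, hru⟩ := inv n hn
      have he6 : (6 : ℝ) ≤ e := by exact_mod_cast (le_max_right X 6).trans (hn0.trans hne)
      have hnx : (4 : ℝ) * (n + 1) ≤ 5 * e := by exact_mod_cast hnext e hne n hen hmax
      have hen' : (e : ℝ) ≤ n := by exact_mod_cast hen
      have h1 : u e ≤ 1 / ((e : ℝ) - 1) := logEulerFactor_le_one_div (hE e he)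
      refine hru.le.trans (h1.trans ?_)
      rw [div_le_div_iff₀ (by linarith) (by linarith)]
      linarith
    refine (hr.const_sub s).congr' (Eventually.of_forall fun n => ?_) |>.trans (by simp)
    exact (partialSum_greedySet E u s n).symm
  · set W : ℕ → ℝ := fun n => (2 : ℝ) ^ partialSum G 1 n
    have hW0 : ∀ n, 0 < W n := fun n => by positivity
    have hG0 : ∀ n, 0 ≤ partialSum G 1 n := partialSum_nonneg fun _ _ => zero_le_one
    set C := max (W n0 * r n0) (W n0)
    have hC1 : 1 ≤ C := le_max_of_le_right (Real.one_le_rpow one_le_two (hG0 n0))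
    have hW : ∀ n ≥ n0, W n * r n ≤ C ∧ W n ≤ 2 * C * n := by
      intro n hn
      induction n, hn using Nat.le_induction with
      | base =>
        refine ⟨le_max_left _ _, (le_max_right _ _ : W n0 ≤ C).trans ?_⟩
        have : (2 : ℝ) ≤ n0 := by exact_mod_cast hE _ hn0E
        nlinarith
      | succ n hn ih =>
        obtain ⟨h1, h2⟩ := ih
        obtain ⟨e, he, hne, hen, hmax, hru⟩ := inv n hn
        by_cases hnG : n + 1 ∈ G
        · obtain ⟨hnE, hle⟩ := succ_mem_greedySet.1 hnG
          have hWs : W (n + 1) = 2 * W n := by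
            simp only [W]
            rw [partialSum_succ, Set.indicator_of_mem hnG, Pi.one_apply,
              Real.rpow_add two_pos, Real.rpow_one, mul_comm]
          have hrs : r (n + 1) = r n - u (n + 1) := by
            simp only [r, greedyRemainder_succ]
            rw [Set.indicator_of_mem hnG]
          have h3 := hratio e hne (n + 1) (hnext e hne n hen hmax) (hE _ hnE)
          have h4 : 1 / ((n + 1 : ℕ) : ℝ) ≤ u (n + 1) := one_div_le_logEulerFactor (hE _ hnE)
          have h5 : 1 / ((n + 1 : ℕ) : ℝ) ≤ r n := h4.trans hle
          have hWn := hW0 n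
          have hupos := logEulerFactor_pos (hE _ hnE)
          rw [hWs, hrs]
          constructor
          · have : W n * (2 * (r n - u (n + 1))) ≤ W n * r n := by
              refine mul_le_mul_of_nonneg_left ?_ hWn.le
              simp only [u] at *
              linarith
            linarith
          · have h6 : W n * (1 / ((n + 1 : ℕ) : ℝ)) ≤ C :=
              (mul_le_mul_of_nonneg_left h5 hWn.le).trans h1
            rw [mul_one_div, div_le_iff₀ (by positivity)] at h6
            linarith
        · have hWs : W (n + 1) = W n := by
            simp only [W]
            rw [partialSum_succ, Set.indicator_of_notMem hnG, add_zero]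
          have hrs : r (n + 1) = r n := by
            simp only [r, greedyRemainder_succ]
            rw [Set.indicator_of_notMem hnG, sub_zero]
          rw [hWs, hrs]
          refine ⟨h1, h2.trans ?_⟩
          push_cast
          nlinarith
    refine ⟨2 * Real.log (2 * C) + partialSum G 1 n0, fun n => ?_⟩
    have hlogC : 0 ≤ Real.log (2 * C) := Real.log_nonneg (by linarith)
    have hlogn : 0 ≤ Real.log ((n : ℝ) + 1) := Real.log_nonneg (by
      linarith [(Nat.cast_nonneg n : (0 : ℝ) ≤ n)])
    rcases le_total n n0 with hn | hn
    · linarith [partialSum_one_mono G hn]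
    · have h1 := Real.log_le_log (hW0 n) (hW n hn).2
      have hn1 : (0 : ℝ) < n := by
        have := hE _ hn0E
        exact_mod_cast (by omega : 0 < n)
      rw [Real.log_rpow two_pos, Real.log_mul (by positivity) (by positivity)] at h1
      have h2 : Real.log n ≤ Real.log (n + 1) := Real.log_le_log hn1 (by linarith)
      nlinarith [Real.log_two_gt_d9, hG0 n, hG0 n0]

lemma exists_tendsto_partialSum_logEulerFactor {A : Set ℕ} (hA : ∀ n ∈ A, 2 ≤ n) {α : ℝ}
    (h : (fun n : ℕ => partialSum A 1 n - α * n / Real.log n) =O[atTop]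
      fun n : ℕ => (n : ℝ) / Real.log n ^ 2) :
    ∃ c, Tendsto (fun N => partialSum A logEulerFactor N -
      α * ∑ n ∈ Finset.range (N + 1), 1 / ((n : ℝ) * Real.log n)) atTop (nhds c) := by
  obtain ⟨c, hc⟩ := exists_tendsto_partialSum_logEulerFactor_sub hA
  obtain ⟨d, hd⟩ := exists_tendsto_partialSum_inv
    (fun h0 => absurd (hA 0 h0) (by norm_num)) h
  exact ⟨c + d, (hc.add hd).congr fun n => by ring⟩

lemma exists_tendsto_partialSum_prime_logEulerFactor :
    ∃ c, Tendsto (fun N => partialSum {p | p.Prime} logEulerFactor N -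
      ∑ n ∈ Finset.range (N + 1), 1 / ((n : ℝ) * Real.log n)) atTop (nhds c) := by
  obtain ⟨c, hc⟩ := exists_tendsto_partialSum_logEulerFactor_sub
    (A := {p | p.Prime}) fun p hp => Nat.Prime.two_le hp
  obtain ⟨d, hd⟩ := exists_tendsto_partialSum_prime_inv
  exact ⟨c + d, (hc.add hd).congr fun n => by ring⟩

lemma tendsto_partialSum_logEulerFactor_atTop {A : Set ℕ} (hA : ∀ n ∈ A, 2 ≤ n) {α : ℝ}
    (hα : 0 < α) (h : (fun n : ℕ => partialSum A 1 n - α * n / Real.log n) =O[atTop]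
      fun n : ℕ => (n : ℝ) / Real.log n ^ 2) :
    Tendsto (partialSum A logEulerFactor) atTop atTop := by
  obtain ⟨c, hc⟩ := exists_tendsto_partialSum_logEulerFactor hA h
  exact ((tendsto_sum_one_div_mul_log_atTop.const_mul_atTop hα).atTop_add hc).congr
    fun n => by ring

/-- The subset of `Q` obtained by keeping the `n`-th element when `⌊θ n⌋` jumps. -/
def beattySubset (Q : Set ℕ) (θ : ℝ) : Set ℕ :=
  {m | ∃ n, m = n + 1 ∧ m ∈ Q ∧ ⌊θ * partialSum Q 1 n⌋ < ⌊θ * partialSum Q 1 (n + 1)⌋}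

lemma beattySubset_subset (Q : Set ℕ) (θ : ℝ) : beattySubset Q θ ⊆ Q := by
  rintro _ ⟨n, rfl, h, -⟩
  exact h

lemma zero_notMem_beattySubset (Q : Set ℕ) (θ : ℝ) : 0 ∉ beattySubset Q θ := by
  rintro ⟨n, h, -⟩
  omega

lemma partialSum_beattySubset {Q : Set ℕ} (hQ : 0 ∉ Q) {θ : ℝ} (h0 : 0 ≤ θ) (h1 : θ ≤ 1)
    (n : ℕ) : partialSum (beattySubset Q θ) 1 n = ⌊θ * partialSum Q 1 n⌋ := by
  induction n with
  | zero => simp [partialSum_zero hQ, partialSum_zero (zero_notMem_beattySubset Q θ)]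
  | succ n ih =>
    have hiff : n + 1 ∈ beattySubset Q θ ↔
        n + 1 ∈ Q ∧ ⌊θ * partialSum Q 1 n⌋ < ⌊θ * partialSum Q 1 (n + 1)⌋ := by
      constructor
      · rintro ⟨m, h, h1⟩
        obtain rfl : n = m := by omega
        exact h1
      · exact fun h => ⟨n, rfl, h⟩
    rw [partialSum_succ (beattySubset Q θ), ih]
    by_cases hn : n + 1 ∈ Q
    · have e : partialSum Q 1 (n + 1) = partialSum Q 1 n + 1 := by
        rw [partialSum_succ]
        simp [hn]
      have hle : ⌊θ * partialSum Q 1 n⌋ ≤ ⌊θ * partialSum Q 1 (n + 1)⌋ :=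
        Int.floor_le_floor (by rw [e]; nlinarith)
      have hge : ⌊θ * partialSum Q 1 (n + 1)⌋ ≤ ⌊θ * partialSum Q 1 n⌋ + 1 := by
        rw [← Int.floor_add_one]
        exact Int.floor_le_floor (by rw [e]; nlinarith)
      by_cases hb : n + 1 ∈ beattySubset Q θ
      · have := (hiff.1 hb).2
        have e2 : ⌊θ * partialSum Q 1 (n + 1)⌋ = ⌊θ * partialSum Q 1 n⌋ + 1 := by omega
        rw [e2, Set.indicator_of_mem hb]
        simp
      · have : ¬ ⌊θ * partialSum Q 1 n⌋ < ⌊θ * partialSum Q 1 (n + 1)⌋ :=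
          fun h => hb (hiff.2 ⟨hn, h⟩)
        have e2 : ⌊θ * partialSum Q 1 (n + 1)⌋ = ⌊θ * partialSum Q 1 n⌋ := by omega
        rw [e2, Set.indicator_of_notMem hb, add_zero]
    · have hb : n + 1 ∉ beattySubset Q θ := fun h => hn (hiff.1 h).1
      rw [partialSum_succ, Set.indicator_of_notMem hn, Set.indicator_of_notMem hb]
      simp

lemma abs_partialSum_beattySubset_sub_le {Q : Set ℕ} (hQ : 0 ∉ Q) {θ : ℝ} (h0 : 0 ≤ θ)
    (h1 : θ ≤ 1) (n : ℕ) :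
    |partialSum (beattySubset Q θ) 1 n - θ * partialSum Q 1 n| ≤ 1 := by
  rw [partialSum_beattySubset hQ h0 h1, abs_le]
  have := Int.floor_le (θ * partialSum Q 1 n)
  have := Int.lt_floor_add_one (θ * partialSum Q 1 n)
  constructor <;> linarith

lemma exists_nth_prime_mem_beattySubset {Q : Set ℕ} (hQP : ∀ q ∈ Q, Nat.Prime q) {K : ℕ}
    (hK : ∀ n : ℕ, ∃ k ≤ K, Nat.nth Nat.Prime (n + k) ∈ Q) {θ : ℝ} (h0 : 0 < θ)
    (h1 : θ ≤ 1) : ∃ L, ∀ n : ℕ, ∃ i, n < i ∧ i ≤ n + L ∧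
      Nat.nth Nat.Prime i ∈ beattySubset Q θ := by
  have hQ0 : 0 ∉ Q := fun h => Nat.not_prime_zero (hQP 0 h)
  have hmono : StrictMono (Nat.nth Nat.Prime) :=
    Nat.nth_strictMono Nat.infinite_setOfPred_prime
  have hstep : ∀ j, partialSum Q 1 (Nat.nth Nat.Prime j) + 1 ≤
      partialSum Q 1 (Nat.nth Nat.Prime (j + (K + 1))) := by
    intro j
    obtain ⟨k, hk, hq⟩ := hK (j + 1)
    have hlt := hmono (show j < j + 1 + k by omega)
    have hle := hmono.monotone (show j + 1 + k ≤ j + (K + 1) by omega)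
    refine le_trans ?_ (partialSum_one_mono Q hle)
    obtain ⟨m, hm⟩ : ∃ m, Nat.nth Nat.Prime (j + 1 + k) = m + 1 :=
      ⟨Nat.nth Nat.Prime (j + 1 + k) - 1, by omega⟩
    rw [hm] at hq hlt ⊢
    rw [partialSum_succ, Set.indicator_of_mem hq, Pi.one_apply]
    linarith [partialSum_one_mono Q (show Nat.nth Nat.Prime j ≤ m by omega)]
  have hsteps : ∀ M j : ℕ, partialSum Q 1 (Nat.nth Nat.Prime j) + M ≤
      partialSum Q 1 (Nat.nth Nat.Prime (j + M * (K + 1))) := by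
    intro M j
    induction M with
    | zero => simp
    | succ M ih =>
      have := hstep (j + M * (K + 1))
      rw [show j + (M + 1) * (K + 1) = j + M * (K + 1) + (K + 1) by ring]
      push_cast
      linarith
  obtain ⟨M, hM⟩ := exists_nat_ge (1 / θ)
  rw [div_le_iff₀ h0] at hM
  refine ⟨M * (K + 1), fun n => ?_⟩
  obtain ⟨m, hm, hlt, hle⟩ := exists_mem_of_partialSum_lt (A := beattySubset Q θ) (f := 1)
    (hmono.monotone (show n ≤ n + M * (K + 1) by omega)) (by
      rw [partialSum_beattySubset hQ0 h0.le h1, partialSum_beattySubset hQ0 h0.le h1]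
      have h2 : ⌊θ * partialSum Q 1 (Nat.nth Nat.Prime n)⌋ + 1 ≤
          ⌊θ * partialSum Q 1 (Nat.nth Nat.Prime (n + M * (K + 1)))⌋ := by
        rw [← Int.floor_add_one]
        exact Int.floor_le_floor (by nlinarith [hsteps M n])
      exact_mod_cast h2)
  have hp := hQP m (beattySubset_subset Q θ hm)
  refine ⟨Nat.count Nat.Prime m, ?_, ?_, by rwa [Nat.nth_count hp]⟩
  · exact hmono.lt_iff_lt.1 (by rwa [Nat.nth_count hp])
  · exact hmono.le_iff_le.1 (by rwa [Nat.nth_count hp])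

lemma cast_cntF {A : Set ℕ} (hA : 0 ∉ A) (x : ℝ) : (cntF A x : ℝ) = partialSum A 1 ⌊x⌋₊ := by
  have h : A ∩ Set.Icc 1 ⌊x⌋₊ = ↑((Finset.range (⌊x⌋₊ + 1)).filter (· ∈ A)) := by
    ext n
    simp only [Set.mem_inter_iff, Set.mem_Icc, Finset.coe_filter, Finset.mem_range,
      Set.mem_ofPred_eq]
    refine ⟨fun h => ⟨by omega, h.1⟩, fun h => ⟨h.2, ?_, by omega⟩⟩
    rcases Nat.eq_zero_or_pos n with rfl | h1
    · exact absurd h.2 hA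
    · exact h1
  rw [cntF, h, Set.ncard_coe_finset, partialSum, Finset.card_filter]
  push_cast
  rfl

lemma prod_filter_eq_exp_partialSum {A : Set ℕ} (hA : ∀ n ∈ A, 2 ≤ n) (N : ℕ) :
    ∏ p ∈ (Finset.Icc 1 N).filter (fun p => p ∈ A), ((p : ℝ) / ((p : ℝ) - 1)) =
      Real.exp (partialSum A logEulerFactor N) := by
  rw [partialSum, Real.exp_sum, Finset.prod_filter]
  have h0 : (0 : ℕ) ∉ A := fun h => absurd (hA 0 h) (by norm_num)
  rw [Finset.range_eq_Ico, Finset.prod_eq_prod_Ico_succ_bot (by omega),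
    Set.indicator_of_notMem h0, Real.exp_zero, one_mul]
  refine Finset.prod_congr (by ext; simp) fun n _ => ?_
  by_cases hn : n ∈ A
  · have : (2 : ℝ) ≤ n := by exact_mod_cast hA n hn
    have h1 : (0 : ℝ) < n - 1 := by linarith
    rw [if_pos hn, Set.indicator_of_mem hn, logEulerFactor, Real.exp_log (by positivity)]
  · rw [if_neg hn, Set.indicator_of_notMem hn, Real.exp_zero]

lemma prod_filter_inv_eq_exp_neg_partialSum (N : ℕ) :
    ∏ p ∈ (Finset.Icc 1 N).filter (fun p => Nat.Prime p), (((p : ℝ) - 1) / (p : ℝ)) =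
      Real.exp (-partialSum {p | p.Prime} logEulerFactor N) := by
  rw [Real.exp_neg, ← prod_filter_eq_exp_partialSum (A := {p | p.Prime}) fun p hp => Nat.Prime.two_le hp,
    ← Finset.prod_inv_distrib]
  exact Finset.prod_congr (by ext; simp) fun p _ => by rw [inv_div]

lemma isBigO_const_add_log (C D : ℝ) : (fun x : ℝ => C + D * Real.log x) =O[atTop]
    fun x : ℝ => x / Real.log x ^ 2 := by
  have h1 : (fun x : ℝ => C + D * Real.log x) =O[atTop] fun x : ℝ => Real.log x :=
    (Real.isLittleO_const_log_atTop).isBigO.add ((isBigO_refl _ _).const_mul_left D)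
  refine h1.trans ?_
  have h2 : (fun x : ℝ => Real.log x ^ 3) =o[atTop] fun x => x := isLittleO_pow_log_id_atTop
  refine IsBigO.of_bound 1 ?_
  filter_upwards [h2.bound one_pos, Filter.eventually_gt_atTop 1] with x hx hx1
  have hl := Real.log_pos hx1
  rw [Real.norm_of_nonneg (by positivity), Real.norm_of_nonneg (by positivity), one_mul] at hx ⊢
  rw [le_div_iff₀ (by positivity)]
  linarith [show Real.log x * Real.log x ^ 2 = Real.log x ^ 3 by ring]

theorem stmt14 (κ : ℝ) (hκ0 : 0 < κ) (hκ1 : κ ≤ 1) (Q : Set ℕ)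
    (hQP : ∀ q ∈ Q, Nat.Prime q)
    (hQcnt : (fun x : ℝ => (cntF Q x : ℝ) - κ * x / Real.log x) =O[Filter.atTop]
      (fun x : ℝ => x / Real.log x ^ 2))
    (K : ℕ) (hK1 : 1 ≤ K) (hK : ∀ n : ℕ, ∃ k ≤ K, Nat.nth Nat.Prime (n + k) ∈ Q)
    (τ a : ℝ) (hτ0 : 0 < τ) (hτκ : τ < κ) (ha : 0 < a) :
    ∃ R : Set ℕ, R ⊆ Q ∧ ∃ L : ℕ, 1 ≤ L ∧
      (∀ n : ℕ, ∃ k ≤ L, Nat.nth Nat.Prime (n + k) ∈ R) ∧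
      ((fun x : ℝ => (cntF R x : ℝ) - τ * x / Real.log x) =O[Filter.atTop]
        (fun x : ℝ => x / Real.log x ^ 2)) ∧
      Filter.Tendsto (fun x : ℝ =>
          (∏ p ∈ (Finset.Icc 1 ⌊x⌋₊).filter (fun p => p ∈ R), ((p : ℝ) / ((p : ℝ) - 1))) *
            (∏ p ∈ (Finset.Icc 1 ⌊x⌋₊).filter (fun p => Nat.Prime p),
              (((p : ℝ) - 1) / (p : ℝ))) ^ τ)
        Filter.atTop (nhds a) := by
  have hQ2 : ∀ q ∈ Q, 2 ≤ q := fun q hq => (hQP q hq).two_le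
  have hQ0 : 0 ∉ Q := fun h => Nat.not_prime_zero (hQP 0 h)
  obtain ⟨θ, hθ⟩ : ∃ θ, θ = τ / κ := ⟨_, rfl⟩
  have hθ0 : 0 < θ := hθ ▸ div_pos hτ0 hκ0
  have hθ1 : θ < 1 := by rw [hθ, div_lt_one hκ0]; exact hτκ
  have hθκ : θ * κ = τ := by rw [hθ]; field_simp
  have hQn : (fun n : ℕ => partialSum Q 1 n - κ * n / Real.log n) =O[atTop]
      fun n : ℕ => (n : ℝ) / Real.log n ^ 2 := by
    refine (hQcnt.comp_tendsto tendsto_natCast_atTop_atTop).congr_left fun n => ?_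
    simp [cast_cntF hQ0]
  set B := beattySubset Q θ
  have hBQ : B ⊆ Q := beattySubset_subset Q θ
  have hB0 : 0 ∉ B := fun h => hQ0 (hBQ h)
  have hBabs := abs_partialSum_beattySubset_sub_le hQ0 hθ0.le hθ1.le
  have hBn : (fun n : ℕ => partialSum B 1 n - τ * n / Real.log n) =O[atTop]
      fun n : ℕ => (n : ℝ) / Real.log n ^ 2 := by
    have h1 : (fun n : ℕ => partialSum B 1 n - θ * partialSum Q 1 n) =O[atTop]
        fun n : ℕ => (n : ℝ) / Real.log n ^ 2 := by
      refine IsBigO.trans (IsBigO.of_bound 1 (Eventually.of_forall fun n => ?_))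
        ((isBigO_const_add_log 1 0).comp_tendsto tendsto_natCast_atTop_atTop)
      simpa using hBabs n
    refine (h1.add (hQn.const_mul_left θ)).congr_left fun n => ?_
    rw [← hθκ]
    ring
  have hEB : Disjoint B (Q \ B) := Set.disjoint_sdiff_right
  have hEn : (fun n : ℕ => partialSum (Q \ B) 1 n - (κ - τ) * n / Real.log n) =O[atTop]
      fun n : ℕ => (n : ℝ) / Real.log n ^ 2 := by
    refine (hQn.sub hBn).congr_left fun n => ?_
    have h1 := partialSum_union hEB 1 n
    rw [Set.union_sdiff_cancel hBQ] at h1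
    rw [h1]
    ring
  have hE2 : ∀ q ∈ Q \ B, 2 ≤ q := fun q hq => hQ2 q hq.1
  have hB2 : ∀ q ∈ B, 2 ≤ q := fun q hq => hQ2 q (hBQ hq)
  obtain ⟨l, hl⟩ : ∃ l, Tendsto (fun N => partialSum B logEulerFactor N -
      τ * partialSum {p | p.Prime} logEulerFactor N) atTop (nhds l) := by
    obtain ⟨c, hc⟩ := exists_tendsto_partialSum_logEulerFactor hB2 hBn
    obtain ⟨d, hd⟩ := exists_tendsto_partialSum_prime_logEulerFactor
    exact ⟨c - τ * d, (hc.sub (hd.const_mul τ)).congr fun n => by ring⟩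
  obtain ⟨N, hN⟩ := ((tendsto_partialSum_logEulerFactor_atTop hB2 hτ0 hBn).eventually_ge_atTop
    (l - Real.log a)).exists
  obtain ⟨D, hDE, hD, C, hC⟩ := exists_sparse_subset_tendsto hE2
    (tendsto_partialSum_logEulerFactor_atTop hE2 (sub_pos.2 hτκ) hEn)
    (exists_mem_Ioc_five_fourths (sub_pos.2 hτκ) hEn)
    (s := Real.log a - l + partialSum B logEulerFactor N) (by linarith)
  have hdisj : Disjoint (B ∩ Set.Ioi N) D :=
    hEB.mono Set.inter_subset_left hDE
  have hRQ : B ∩ Set.Ioi N ∪ D ⊆ Q :=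
    Set.union_subset (Set.inter_subset_left.trans hBQ) (hDE.trans Set.sdiff_subset)
  have hR0 : 0 ∉ B ∩ Set.Ioi N ∪ D := fun h => hQ0 (hRQ h)
  have hsum : ∀ f n, partialSum (B ∩ Set.Ioi N ∪ D) f n =
      partialSum B f n - partialSum B f (min n N) + partialSum D f n := fun f n => by
    rw [partialSum_union hdisj, partialSum_inter_Ioi hB0]
  obtain ⟨L, hL⟩ := exists_nth_prime_mem_beattySubset hQP hK hθ0 hθ1.le
  refine ⟨B ∩ Set.Ioi N ∪ D, hRQ, N + L + 1, by omega, fun n => ?_, ?_, ?_⟩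
  · obtain ⟨i, hi, hiL, hiB⟩ := hL (n + N)
    refine ⟨i - n, by omega, ?_⟩
    rw [show n + (i - n) = i by omega]
    refine Or.inl ⟨hiB, ?_⟩
    have hmono : StrictMono (Nat.nth Nat.Prime) :=
      Nat.nth_strictMono Nat.infinite_setOfPred_prime
    have := hmono.id_le i
    simp only [id, Set.mem_Ioi] at *
    omega
  · have h1 : (fun x : ℝ => (cntF (B ∩ Set.Ioi N ∪ D) x : ℝ) - θ * cntF Q x) =O[atTop]
        fun x : ℝ => x / Real.log x ^ 2 := by
      refine IsBigO.trans (IsBigO.of_bound 1 ?_)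
        (isBigO_const_add_log (1 + partialSum B 1 N + |C| + 2 * Real.log 2) 2)
      filter_upwards [eventually_ge_atTop 1] with x hx
      rw [cast_cntF hR0, cast_cntF hQ0, hsum]
      have h2 := abs_le.1 (hBabs ⌊x⌋₊)
      have h3 := hC ⌊x⌋₊
      have h4 := partialSum_one_mono B (min_le_right ⌊x⌋₊ N)
      have h5 := partialSum_nonneg (A := B) (f := 1) (fun _ _ => zero_le_one) (min ⌊x⌋₊ N)
      have h6 := partialSum_nonneg (A := D) (f := 1) (fun _ _ => zero_le_one) ⌊x⌋₊
      have h7 : Real.log ((⌊x⌋₊ : ℝ) + 1) ≤ Real.log 2 + Real.log x := by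
        rw [← Real.log_mul two_ne_zero (by positivity)]
        exact Real.log_le_log (by positivity)
          (by linarith [Nat.floor_le (show 0 ≤ x by linarith)])
      have h8 := Real.log_nonneg hx
      have h9 := Real.log_nonneg one_le_two
      have h10 := le_abs_self C
      have h11 := abs_nonneg C
      rw [one_mul, Real.norm_eq_abs, Real.norm_eq_abs, abs_of_nonneg (by linarith :
        0 ≤ 1 + partialSum B 1 N + |C| + 2 * Real.log 2 + 2 * Real.log x), abs_le]
      constructor <;> linarith
    refine (h1.add (hQcnt.const_mul_left θ)).congr_left fun x => ?_
    rw [← hθκ]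
    ring
  · have h1 : Tendsto (fun n => partialSum (B ∩ Set.Ioi N ∪ D) logEulerFactor n -
        τ * partialSum {p | p.Prime} logEulerFactor n) atTop (nhds (Real.log a)) := by
      have h2 := (hl.add hD).sub_const (partialSum B logEulerFactor N)
      rw [show l + (Real.log a - l + partialSum B logEulerFactor N) -
        partialSum B logEulerFactor N = Real.log a by ring] at h2
      refine h2.congr' ?_
      filter_upwards [eventually_ge_atTop N] with n hn
      rw [hsum, min_eq_right hn]
      ring
    have h3 := (Real.continuous_exp.tendsto _).comp (h1.comp (tendsto_nat_floor_atTop (α := ℝ)))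
    rw [Real.exp_log ha] at h3
    refine h3.congr fun x => ?_
    rw [prod_filter_eq_exp_partialSum fun n hn => hQ2 n (hRQ hn),
      prod_filter_inv_eq_exp_neg_partialSum, ← Real.exp_mul, ← Real.exp_add]
    simp only [Function.comp_apply]
    ring_nf
end

section
/- Let h ∈ ℤ⁺, let τ_1,…,τ_h ∈ (0,1) with τ_1 + ⋯ + τ_h = 1, and let a_1,…,a_h ∈ (0,∞) with a_1⋯a_h = 1. Then the set P of prime numbers can be partitioned as P = P_1 ∪ ⋯ ∪ P_h with P_i ∩ P_j = ∅ for i ≠ j, such that for every 1 ≤ i ≤ h: (i) P_i(x) = τ_i·x/log x + O(x/(log x)²) as x → ∞; and (ii) lim_{x→∞} (∏_{p≤x, p∈P_i} p/(p-1)) · (∏_{p≤x, p prime} (p-1)/p)^{τ_i} = a_i. -/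
open Filter Real Asymptotics
open scoped Classical

/-- The difference between `x ^ (-s)` and the integral of `u ^ (-s)` over `[x, x + 1]`. -/
noncomputable def zetaTerm (x : ℝ) (s : ℂ) : ℂ :=
  (x : ℂ) ^ (-s) - (((x + 1 : ℝ) : ℂ) ^ (1 - s) - (x : ℂ) ^ (1 - s)) / (1 - s)

lemma zetaTerm_eq_integral {x : ℝ} (hx : 0 < x) {s : ℂ} (hs : s ≠ 1) :
    zetaTerm x s = ∫ u in x..(x + 1), ((x : ℂ) ^ (-s) - (u : ℂ) ^ (-s)) := by
  have h0 : (0 : ℝ) ∉ Set.uIcc x (x + 1) := by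
    rw [Set.uIcc_of_le (by linarith)]; exact fun h => absurd h.1 (by linarith)
  have hr : -s ≠ -1 := fun h => hs (neg_injective h)
  rw [intervalIntegral.integral_sub (by simp)
    (intervalIntegral.intervalIntegrable_cpow (Or.inr h0)),
    integral_cpow (Or.inr ⟨hr, h0⟩)]
  simp only [intervalIntegral.integral_const, zetaTerm]
  rw [show -s + 1 = 1 - s by ring]
  simp

lemma norm_cpow_sub_cpow_le {x u : ℝ} (hx : 0 < x) (hu : u ∈ Set.Icc x (x + 1)) {s : ℂ}
    (hs : 0 < s.re) :
    ‖(x : ℂ) ^ (-s) - (u : ℂ) ^ (-s)‖ ≤ ‖s‖ * x ^ (-s.re - 1) := by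
  have hs0 : -s ≠ 0 := by
    intro h; rw [neg_eq_zero] at h; simp [h] at hs
  have h1 : ∀ y ∈ Set.Icc x (x + 1), HasDerivWithinAt (fun y : ℝ => (y : ℂ) ^ (-s))
      (-s * (y : ℂ) ^ (-s - 1)) (Set.Icc x (x + 1)) y := fun y hy =>
    (hasDerivAt_ofReal_cpow_const (by linarith [hy.1] : y ≠ 0) hs0).hasDerivWithinAt
  have h2 : ∀ y ∈ Set.Icc x (x + 1), ‖-s * (y : ℂ) ^ (-s - 1)‖ ≤ ‖s‖ * x ^ (-s.re - 1) := by
    intro y hy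
    rw [norm_mul, norm_neg, Complex.norm_cpow_eq_rpow_re_of_pos (by linarith [hy.1])]
    gcongr
    simp only [Complex.sub_re, Complex.neg_re, Complex.one_re]
    exact Real.rpow_le_rpow_of_nonpos hx hy.1 (by linarith)
  have h3 := Convex.norm_image_sub_le_of_norm_hasDerivWithin_le h1 h2 (convex_Icc _ _) hu
    (Set.left_mem_Icc.2 (by linarith))
  refine h3.trans ?_
  have : ‖x - u‖ ≤ 1 := by
    rw [Real.norm_eq_abs, abs_le]; constructor <;> linarith [hu.1, hu.2]
  exact mul_le_of_le_one_right (by positivity) this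

lemma norm_cpow_sub_cpow_le' {x u : ℝ} (hx : 0 < x) (hu : u ∈ Set.Icc x (x + 1)) {s : ℂ}
    (hs : 0 < s.re) :
    ‖(x : ℂ) ^ (-s) - (u : ℂ) ^ (-s)‖ ≤ 2 * x ^ (-s.re) := by
  refine (norm_sub_le _ _).trans ?_
  rw [Complex.norm_cpow_eq_rpow_re_of_pos hx,
    Complex.norm_cpow_eq_rpow_re_of_pos (by linarith [hu.1]), Complex.neg_re]
  have := Real.rpow_le_rpow_of_nonpos hx hu.1 (by linarith : -s.re ≤ 0)
  linarith

lemma norm_zetaTerm_le {x : ℝ} (hx : 0 < x) {s : ℂ} (hs : 0 < s.re) (hs1 : s ≠ 1) {θ : ℝ}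
    (h0 : 0 ≤ θ) (h1 : θ ≤ 1) :
    ‖zetaTerm x s‖ ≤ 2 * ‖s‖ ^ θ * x ^ (-s.re - θ) := by
  rw [zetaTerm_eq_integral hx hs1]
  have key : ∀ u ∈ Set.uIoc x (x + 1), ‖(x : ℂ) ^ (-s) - (u : ℂ) ^ (-s)‖ ≤
      2 * ‖s‖ ^ θ * x ^ (-s.re - θ) := by
    intro u hu
    rw [Set.uIoc_of_le (by linarith)] at hu
    have hu' := Set.Ioc_subset_Icc_self hu
    have hA := norm_cpow_sub_cpow_le hx hu' hs
    have hB := norm_cpow_sub_cpow_le' hx hu' hs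
    set X := ‖(x : ℂ) ^ (-s) - (u : ℂ) ^ (-s)‖
    have hX : 0 ≤ X := norm_nonneg _
    calc X = X ^ θ * X ^ (1 - θ) := by
          rw [← Real.rpow_add_of_nonneg hX h0 (by linarith)]; simp
      _ ≤ (‖s‖ * x ^ (-s.re - 1)) ^ θ * (2 * x ^ (-s.re)) ^ (1 - θ) := by
          gcongr
      _ = 2 ^ (1 - θ) * ‖s‖ ^ θ * x ^ (-s.re - θ) := by
          rw [Real.mul_rpow (norm_nonneg _) (by positivity),
            Real.mul_rpow (by norm_num) (by positivity),
            ← Real.rpow_mul hx.le, ← Real.rpow_mul hx.le,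
            show -s.re - θ = (-s.re - 1) * θ + -s.re * (1 - θ) by ring, Real.rpow_add hx]
          ring
      _ ≤ 2 * ‖s‖ ^ θ * x ^ (-s.re - θ) := by
          gcongr
          calc (2 : ℝ) ^ (1 - θ) ≤ 2 ^ (1 : ℝ) :=
                Real.rpow_le_rpow_of_exponent_le (by norm_num) (by linarith)
            _ = 2 := by simp
  have := intervalIntegral.norm_integral_le_of_norm_le_const key
  simpa using this

lemma differentiableAt_zetaTerm {x : ℝ} (hx : 0 < x) {s : ℂ} (hs : s ≠ 1) :
    DifferentiableAt ℂ (zetaTerm x) s := by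
  unfold zetaTerm
  have hx0 : (x : ℂ) ≠ 0 := by exact_mod_cast hx.ne'
  have hx1 : ((x + 1 : ℝ) : ℂ) ≠ 0 := by exact_mod_cast (by linarith : x + 1 ≠ 0)
  have h1 : 1 - s ≠ 0 := sub_ne_zero.2 hs.symm
  refine DifferentiableAt.sub ?_ (DifferentiableAt.div (DifferentiableAt.sub ?_ ?_) ?_ h1)
  · exact (differentiableAt_id.neg).const_cpow (Or.inl hx0)
  · exact (differentiableAt_id.const_sub _).const_cpow (Or.inl hx1)
  · exact (differentiableAt_id.const_sub _).const_cpow (Or.inl hx0)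
  · exact differentiableAt_id.const_sub _

lemma hasSum_zetaTerm {s : ℂ} (hs : 1 < s.re) :
    HasSum (fun m : ℕ => zetaTerm (m + 1) s) (riemannZeta s - 1 / (s - 1)) := by
  have hs1 : s ≠ 1 := fun h => by simp [h] at hs
  have hA : HasSum (fun m : ℕ => ((m + 1 : ℝ) : ℂ) ^ (-s)) (riemannZeta s) := by
    rw [zeta_eq_tsum_one_div_nat_add_one_cpow hs]
    have h : Summable fun m : ℕ => 1 / ((m : ℂ) + 1) ^ s := by
      have := (summable_nat_add_iff 1).2 (Complex.summable_one_div_nat_cpow.2 hs)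
      simpa using this
    convert h.hasSum using 2 with m
    rw [Complex.cpow_neg, one_div]; push_cast; rfl
  have hB : HasSum (fun m : ℕ => (((m + 1 + 1 : ℝ) : ℂ) ^ (1 - s) - ((m + 1 : ℝ) : ℂ) ^ (1 - s))
      / (1 - s)) (1 / (s - 1)) := by
    have hsum : Summable (fun m : ℕ => (((m + 1 + 1 : ℝ) : ℂ) ^ (1 - s) -
        ((m + 1 : ℝ) : ℂ) ^ (1 - s)) / (1 - s)) := by
      have h1 : Summable fun m : ℕ => zetaTerm (m + 1) s := by
        refine Summable.of_norm_bounded (g := fun m : ℕ => 2 * ‖s‖ ^ (0 : ℝ) *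
          ((m + 1 : ℕ) : ℝ) ^ (-s.re - 0)) ?_ ?_
        · refine Summable.mul_left _ ((summable_nat_add_iff 1).2
            (Real.summable_nat_rpow.2 (by linarith)))
        · intro m
          push_cast
          exact norm_zetaTerm_le (by positivity) (by linarith) hs1 le_rfl zero_le_one
      have := hA.summable.sub h1
      refine this.congr fun m => ?_
      simp [zetaTerm]
    rw [hsum.hasSum_iff_tendsto_nat]
    have ht : Tendsto (fun n : ℕ => (((n + 1 : ℝ) : ℂ) ^ (1 - s) - 1) / (1 - s)) atTop
        (nhds ((0 - 1) / (1 - s))) := by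
      refine Tendsto.div_const (Tendsto.sub_const ?_ _) _
      rw [tendsto_zero_iff_norm_tendsto_zero]
      have h2 : Tendsto (fun n : ℕ => ((n : ℝ) + 1) ^ (-(s.re - 1))) atTop (nhds 0) :=
        (tendsto_rpow_neg_atTop (by linarith)).comp
          (tendsto_atTop_add_const_right _ _ tendsto_natCast_atTop_atTop)
      refine h2.congr fun n => ?_
      rw [Complex.norm_cpow_eq_rpow_re_of_pos (by positivity)]
      simp
    have he : (0 - 1) / (1 - s) = 1 / (s - 1) := by
      rw [← neg_sub s 1, div_neg]; ring
    rw [he] at ht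
    refine ht.congr fun n => ?_
    rw [← Finset.sum_div]
    congr 1
    have := Finset.sum_range_sub (fun m : ℕ => ((m + 1 : ℝ) : ℂ) ^ (1 - s)) n
    push_cast at this ⊢
    rw [this]
    simp
  exact hA.sub hB

lemma isOpen_halfStrip (a b : ℝ) : IsOpen {s : ℂ | a < s.re ∧ b < s.im} :=
  (isOpen_lt continuous_const Complex.continuous_re).inter
    (isOpen_lt continuous_const Complex.continuous_im)

lemma tsum_zetaTerm_norm_le {s : ℂ} (hs : 31 / 32 < s.re) (hs1 : s ≠ 1) (m : ℕ) :
    ‖zetaTerm (m + 1) s‖ ≤ 2 * ‖s‖ ^ (1 / 16 : ℝ) * ((m + 1 : ℕ) : ℝ) ^ (-(33 / 32) : ℝ) := by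
  refine (norm_zetaTerm_le (by positivity) (by linarith) hs1 (θ := 1 / 16)
    (by norm_num) (by norm_num)).trans ?_
  push_cast
  gcongr
  · linarith [Nat.cast_nonneg (α := ℝ) m]
  · linarith

lemma summable_nat_add_one_rpow : Summable fun m : ℕ => ((m + 1 : ℕ) : ℝ) ^ (-(33 / 32) : ℝ) :=
  (summable_nat_add_iff 1).2 (Real.summable_nat_rpow.2 (by norm_num))

lemma riemannZeta_sub_eq_tsum {s : ℂ} (hs : 31 / 32 < s.re) (him : 0 < s.im) :
    riemannZeta s - 1 / (s - 1) = ∑' m : ℕ, zetaTerm (m + 1) s := by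
  set U : Set ℂ := {s : ℂ | 31 / 32 < s.re ∧ 0 < s.im} with hU
  have hUo : IsOpen U := isOpen_halfStrip _ _
  have hUc : Convex ℝ U :=
    (convex_halfSpace_re_gt _).inter (convex_halfSpace_im_gt _)
  have hU1 : ∀ z ∈ U, z ≠ 1 := by
    rintro z hz rfl; simp [hU] at hz
  have hf : DifferentiableOn ℂ (fun s => riemannZeta s - 1 / (s - 1)) U := by
    intro z hz
    have h1 := hU1 z hz
    have : z - 1 ≠ 0 := sub_ne_zero.2 h1
    exact ((differentiableAt_riemannZeta h1).sub ((differentiableAt_const _).div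
      (differentiableAt_id.sub_const _) this)).differentiableWithinAt
  have hg : DifferentiableOn ℂ (fun s => ∑' m : ℕ, zetaTerm (m + 1) s) U := by
    intro z hz
    set V : Set ℂ := U ∩ Metric.ball 0 (‖z‖ + 1) with hV
    have hVo : IsOpen V := hUo.inter Metric.isOpen_ball
    have hzV : z ∈ V := ⟨hz, by simp⟩
    have : DifferentiableOn ℂ (fun s => ∑' m : ℕ, zetaTerm (m + 1) s) V := by
      refine Complex.differentiableOn_tsum_of_summable_norm
        (u := fun m : ℕ => 2 * (‖z‖ + 1) ^ (1 / 16 : ℝ) * ((m + 1 : ℕ) : ℝ) ^ (-(33 / 32) : ℝ))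
        (summable_nat_add_one_rpow.mul_left _) ?_ hVo ?_
      · intro m w hw
        exact (differentiableAt_zetaTerm (by positivity) (hU1 w hw.1)).differentiableWithinAt
      · intro m w hw
        refine (tsum_zetaTerm_norm_le hw.1.1 (hU1 w hw.1) m).trans ?_
        have : ‖w‖ ≤ ‖z‖ + 1 := by simpa using (Metric.mem_ball.1 hw.2).le
        gcongr
    exact (this.differentiableAt (hVo.mem_nhds hzV)).differentiableWithinAt
  have hz0 : (2 + Complex.I) ∈ U := by simp [hU]; norm_num
  have hev : (fun s => riemannZeta s - 1 / (s - 1)) =ᶠ[nhds (2 + Complex.I)]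
      (fun s => ∑' m : ℕ, zetaTerm (m + 1) s) := by
    filter_upwards [(isOpen_halfStrip 1 0).mem_nhds (show 2 + Complex.I ∈ _ by simp)] with z hz
    exact (hasSum_zetaTerm hz.1).tsum_eq.symm
  exact (hf.analyticOnNhd hUo).eqOn_of_preconnected_of_eventuallyEq (hg.analyticOnNhd hUo)
    hUc.isPreconnected hz0 hev ⟨hs, him⟩

/-- Subconvex growth of the zeta function slightly to the left of the line `re s = 1`. -/
lemma exists_norm_riemannZeta_le : ∃ C : ℝ, 1 ≤ C ∧ ∀ s : ℂ, 31 / 32 < s.re → s.re ≤ 4 →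
    1 ≤ |s.im| → ‖riemannZeta s‖ ≤ C * |s.im| ^ (1 / 16 : ℝ) := by
  set K : ℝ := ∑' m : ℕ, ((m + 1 : ℕ) : ℝ) ^ (-(33 / 32) : ℝ) with hK
  have hK0 : 0 ≤ K := tsum_nonneg fun m => by positivity
  refine ⟨1 + 2 * 5 ^ (1 / 16 : ℝ) * K, by
    have : 0 ≤ 2 * (5 : ℝ) ^ (1 / 16 : ℝ) * K := by positivity
    linarith, ?_⟩
  have main : ∀ s : ℂ, 31 / 32 < s.re → s.re ≤ 4 → 1 ≤ s.im →
      ‖riemannZeta s‖ ≤ (1 + 2 * 5 ^ (1 / 16 : ℝ) * K) * |s.im| ^ (1 / 16 : ℝ) := by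
    intro s h1 h2 h3
    have hs1 : s ≠ 1 := by rintro rfl; simp at h3; linarith
    have hns : ‖s‖ ≤ 5 * |s.im| := by
      have := Complex.norm_le_abs_re_add_abs_im s
      rw [abs_of_pos (by linarith : 0 < s.re)] at this
      rw [abs_of_pos (by linarith : 0 < s.im)] at this ⊢
      linarith
    have hA : ‖1 / (s - 1)‖ ≤ 1 := by
      rw [norm_div, norm_one]
      apply div_le_one_of_le₀ _ (norm_nonneg _)
      have := Complex.abs_im_le_norm (s - 1)
      rw [Complex.sub_im, Complex.one_im, sub_zero, abs_of_pos (by linarith)] at this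
      linarith
    have hB : ‖∑' m : ℕ, zetaTerm (m + 1) s‖ ≤ 2 * ‖s‖ ^ (1 / 16 : ℝ) * K := by
      refine tsum_of_norm_bounded (g := fun m : ℕ => 2 * ‖s‖ ^ (1 / 16 : ℝ) *
        ((m + 1 : ℕ) : ℝ) ^ (-(33 / 32) : ℝ)) ?_ (tsum_zetaTerm_norm_le h1 hs1)
      exact summable_nat_add_one_rpow.hasSum.mul_left _
    have h1t : 1 ≤ |s.im| ^ (1 / 16 : ℝ) :=
      Real.one_le_rpow (by rwa [abs_of_pos (by linarith)]) (by norm_num)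
    calc ‖riemannZeta s‖ = ‖1 / (s - 1) + ∑' m : ℕ, zetaTerm (m + 1) s‖ := by
          rw [← riemannZeta_sub_eq_tsum h1 (by linarith)]; congr 1; ring
      _ ≤ 1 + 2 * ‖s‖ ^ (1 / 16 : ℝ) * K := (norm_add_le _ _).trans (add_le_add hA hB)
      _ ≤ 1 * |s.im| ^ (1 / 16 : ℝ) + 2 * (5 * |s.im|) ^ (1 / 16 : ℝ) * K := by
          gcongr; linarith
      _ = _ := by rw [Real.mul_rpow (by norm_num) (abs_nonneg _)]; ring
  intro s h1 h2 h3
  rcases le_total 0 s.im with h | h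
  · exact main s h1 h2 (by rwa [abs_of_nonneg h] at h3)
  · have := main ((starRingEnd ℂ) s) (by simpa) (by simpa)
      (by simpa [abs_of_nonpos h] using h3)
    rwa [riemannZeta_conj, Complex.norm_conj, Complex.conj_im, abs_neg] at this

lemma riemannZeta₁_eq {s : ℂ} (hs : s ≠ 1) : riemannZeta₁ s = (s - 1) * riemannZeta s := by
  rw [riemannZeta_eq_inv_sub_mul hs, mul_inv_cancel_left₀ (sub_ne_zero.2 hs)]

lemma abs_im_sub_le {s z : ℂ} {r : ℝ} (h : ‖z - s‖ ≤ r) : |z.im - s.im| ≤ r := by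
  simpa using (Complex.abs_im_le_norm (z - s)).trans h

lemma abs_re_sub_le {s z : ℂ} {r : ℝ} (h : ‖z - s‖ ≤ r) : |z.re - s.re| ≤ r := by
  simpa using (Complex.abs_re_le_norm (z - s)).trans h

lemma two_mul_rpow_le {t : ℝ} (ht : 0 ≤ t) : (2 * t) ^ (1 / 16 : ℝ) ≤ 2 * t ^ (1 / 16 : ℝ) := by
  rw [Real.mul_rpow (by norm_num) ht]
  gcongr
  calc (2 : ℝ) ^ (1 / 16 : ℝ) ≤ 2 ^ (1 : ℝ) :=
        Real.rpow_le_rpow_of_exponent_le (by norm_num) (by norm_num)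
    _ = 2 := by simp

lemma exists_norm_deriv_riemannZeta_le : ∃ C : ℝ, 1 ≤ C ∧ ∀ s : ℂ, 63 / 64 < s.re → s.re ≤ 3 →
    3 / 2 ≤ |s.im| → ‖deriv riemannZeta s‖ ≤ C * |s.im| ^ (1 / 16 : ℝ) := by
  obtain ⟨C, hC, hb⟩ := exists_norm_riemannZeta_le
  refine ⟨C * 2 / (1 / 128), by norm_num; linarith, fun s h1 h2 h3 => ?_⟩
  have hd : DiffContOnCl ℂ riemannZeta (Metric.ball s (1 / 128)) := by
    apply DifferentiableOn.diffContOnCl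
    rw [closure_ball _ (by norm_num)]
    intro z hz
    rw [mem_closedBall_iff_norm] at hz
    refine (differentiableAt_riemannZeta ?_).differentiableWithinAt
    rintro rfl
    have := abs_im_sub_le hz
    simp at this
    linarith
  have := Complex.norm_deriv_le_of_forall_mem_sphere_norm_le (C := C * 2 * |s.im| ^ (1 / 16 : ℝ))
    (by norm_num) hd ?_
  · refine this.trans (le_of_eq ?_); ring
  · intro z hz
    have hz' : ‖z - s‖ ≤ 1 / 128 := (mem_sphere_iff_norm.1 hz).le
    have hi := abs_im_sub_le hz'
    have hr := abs_le.1 (abs_re_sub_le hz')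
    have hi1 := abs_sub_abs_le_abs_sub z.im s.im
    have hi2 := abs_sub_abs_le_abs_sub s.im z.im
    rw [abs_sub_comm] at hi2
    refine (hb z (by linarith) (by linarith) (by linarith)).trans ?_
    rw [mul_assoc]
    gcongr
    refine le_trans ?_ (two_mul_rpow_le (abs_nonneg _))
    gcongr
    linarith

lemma exists_norm_riemannZeta_one_add_le : ∃ C : ℝ, 1 ≤ C ∧ ∀ x : ℝ, 0 < x → x ≤ 1 →
    ‖riemannZeta (1 + x)‖ ≤ C / x := by
  obtain ⟨C, hC⟩ := (isCompact_Icc (a := (0 : ℝ)) (b := 1)).exists_bound_of_continuousOn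
    (f := fun x : ℝ => riemannZeta₁ (1 + x))
    ((differentiable_riemannZeta₁.continuous.comp (by fun_prop)).continuousOn)
  refine ⟨max C 1, le_max_right _ _, fun x h0 h1 => ?_⟩
  have hx : (1 + x : ℂ) ≠ 1 := by simpa using h0.ne'
  rw [riemannZeta_eq_inv_sub_mul hx, norm_mul, add_sub_cancel_left, norm_inv, Complex.norm_real,
    Real.norm_of_nonneg h0.le, inv_mul_eq_div]
  gcongr
  exact (hC x ⟨h0.le, h1⟩).trans (le_max_left _ _)

lemma one_le_norm_riemannZeta_product {x : ℝ} (hx : 0 < x) (y : ℝ) :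
    1 ≤ ‖riemannZeta (1 + x)‖ ^ 3 * ‖riemannZeta (1 + x + Complex.I * y)‖ ^ 4 *
      ‖riemannZeta (1 + x + 2 * Complex.I * y)‖ := by
  have := DirichletCharacter.norm_LFunction_product_ge_one (1 : DirichletCharacter ℂ 1) hx y
  simpa [DirichletCharacter.LFunctionTrivChar, DirichletCharacter.LFunction_modOne_eq] using this

/-- Polynomial lower bound for the zeta function to the right of the line `re s = 1`. -/
lemma exists_le_norm_riemannZeta : ∃ c : ℝ, 0 < c ∧ ∀ s : ℂ, 1 ≤ s.re → s.re ≤ 2 →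
    2 ≤ |s.im| → c / (|s.im| ^ (1 / 16 : ℝ)) ^ 4 ≤ ‖riemannZeta s‖ := by
  obtain ⟨C, hC, hb⟩ := exists_norm_riemannZeta_le
  obtain ⟨D, hD, hd⟩ := exists_norm_deriv_riemannZeta_le
  obtain ⟨E, hE, he⟩ := exists_norm_riemannZeta_one_add_le
  set k : ℝ := 1 / (2 * C * E ^ 3) with hk
  have hk0 : 0 < k := by positivity
  set d : ℝ := min 1 (k / (16 * D ^ 4)) with hdd
  have hd0 : 0 < d := lt_min one_pos (by positivity)
  have hd1 : d ≤ 1 := min_le_left _ _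
  have hd2 : 16 * D ^ 4 * d ≤ k := by
    have : d ≤ k / (16 * D ^ 4) := min_le_right _ _
    rwa [le_div_iff₀' (by positivity)] at this
  refine ⟨D * d, by positivity, fun s h1 h2 h3 => ?_⟩
  set q : ℝ := |s.im| ^ (1 / 16 : ℝ) with hq
  have hq1 : 1 ≤ q := Real.one_le_rpow (by linarith) (by norm_num)
  have hq0 : 0 < q := by linarith
  have far : ∀ x : ℝ, d / q ^ 5 ≤ x → x ≤ 1 →
      2 * (D * d / q ^ 4) ≤ ‖riemannZeta (1 + x + Complex.I * s.im)‖ := by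
    intro x hx hx1
    have hx0 : 0 < x := lt_of_lt_of_le (by positivity) hx
    have hp := one_le_norm_riemannZeta_product hx0 s.im
    have hA := he x hx0 hx1
    have hB : ‖riemannZeta (1 + x + 2 * Complex.I * s.im)‖ ≤ C * (2 * q) := by
      refine (hb _ (by simp; linarith) (by simp; linarith) (by simp [abs_mul]; linarith)).trans ?_
      gcongr
      refine le_trans (le_of_eq ?_) (two_mul_rpow_le (abs_nonneg _))
      simp [abs_mul]
    set X := ‖riemannZeta (1 + x + Complex.I * s.im)‖
    have hX0 : 0 ≤ X := norm_nonneg _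
    have h4 : 1 ≤ (E / x) ^ 3 * X ^ 4 * (C * (2 * q)) := by
      refine hp.trans ?_
      gcongr
    have h5 : k * x ^ 3 / q ≤ X ^ 4 := by
      rw [hk, div_le_iff₀ hq0, div_mul_eq_mul_div, div_le_iff₀ (by positivity)]
      have : (E / x) ^ 3 * X ^ 4 * (C * (2 * q)) = (X ^ 4 * q * (2 * C * E ^ 3)) / x ^ 3 := by
        field_simp
      rw [this, le_div_iff₀ (by positivity)] at h4
      linarith
    refine le_of_pow_le_pow_left₀ (n := 4) (by norm_num) hX0 (le_trans ?_ h5)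
    calc (2 * (D * d / q ^ 4)) ^ 4 = (16 * D ^ 4 * d) * (d / q ^ 5) ^ 3 / q := by field_simp; ring
      _ ≤ k * x ^ 3 / q := by gcongr
  have hs : s = 1 + ((s.re - 1 : ℝ) : ℂ) + Complex.I * s.im := by
    apply Complex.ext <;> simp
  rcases le_total (d / q ^ 5) (s.re - 1) with h | h
  · have := far (s.re - 1) h (by linarith)
    rw [← hs] at this
    have h0 : 0 ≤ D * d / q ^ 4 := by positivity
    linarith
  · have hle : d / q ^ 5 ≤ 1 := div_le_one_of_le₀ (hd1.trans (one_le_pow₀ hq1)) (by positivity)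
    set w : ℂ := 1 + ((d / q ^ 5 : ℝ) : ℂ) + Complex.I * s.im with hw
    have hfar := far (d / q ^ 5) le_rfl hle
    have hwre : w.re = 1 + d / q ^ 5 := by
      simp only [hw, Complex.add_re, Complex.one_re, Complex.ofReal_re, Complex.mul_re,
        Complex.I_re, Complex.I_im, Complex.ofReal_im]; ring
    have hwim : w.im = s.im := by
      simp only [hw, Complex.add_im, Complex.one_im, Complex.ofReal_re, Complex.mul_im,
        Complex.I_re, Complex.I_im, Complex.ofReal_im]; ring
    have hsub : w - s = ((d / q ^ 5 - (s.re - 1) : ℝ) : ℂ) := by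
      apply Complex.ext
      · rw [Complex.sub_re, hwre, Complex.ofReal_re]; ring
      · rw [Complex.sub_im, hwim, Complex.ofReal_im]; ring
    have hseg : ∀ z ∈ segment ℝ s w, 1 ≤ z.re ∧ z.re ≤ 3 ∧ z.im = s.im := by
      rintro z ⟨a, b, ha, hb', hab, rfl⟩
      simp only [Complex.add_re, Complex.add_im, Complex.smul_re, Complex.smul_im, hwre, hwim,
        smul_eq_mul]
      refine ⟨?_, ?_, ?_⟩
      · nlinarith [show 0 ≤ d / q ^ 5 by positivity]
      · nlinarith
      · rw [← add_mul, hab, one_mul]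
    have hmv := Convex.norm_image_sub_le_of_norm_hasDerivWithin_le (𝕜 := ℂ) (f := riemannZeta)
      (f' := deriv riemannZeta) (s := segment ℝ s w) (C := D * q) (x := s) (y := w) ?_ ?_
      (convex_segment _ _) (left_mem_segment _ _ _) (right_mem_segment _ _ _)
    · have hn : ‖w - s‖ ≤ d / q ^ 5 := by
        rw [hsub, Complex.norm_real, Real.norm_eq_abs, abs_le]
        constructor <;> linarith
      have h6 : ‖riemannZeta w - riemannZeta s‖ ≤ D * d / q ^ 4 := by
        refine hmv.trans ((mul_le_mul_of_nonneg_left hn (by positivity)).trans (le_of_eq ?_))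
        field_simp
      have := norm_sub_norm_le (riemannZeta w) (riemannZeta s)
      linarith
    · intro z hz
      refine (differentiableAt_riemannZeta ?_).hasDerivAt.hasDerivWithinAt
      rintro rfl
      have := (hseg _ hz).2.2
      rw [← this] at h3
      simp at h3
      linarith
    · intro z hz
      obtain ⟨ha, hb', hc⟩ := hseg z hz
      have := hd z (by linarith) hb' (by rw [hc]; linarith)
      rwa [hc] at this

/-- The analytic continuation of the Mellin transform of `ψ(t) - t`. -/
noncomputable def psiMellin (s : ℂ) : ℂ := -(deriv riemannZeta₁ s / riemannZeta₁ s + 1) / s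

lemma riemannZeta₁_ne_zero {s : ℂ} (hs : 1 ≤ s.re) : riemannZeta₁ s ≠ 0 := by
  rcases eq_or_ne s 1 with rfl | h
  · simp
  · rw [riemannZeta₁_eq h]
    exact mul_ne_zero (sub_ne_zero.2 h) (riemannZeta_ne_zero_of_one_le_re hs)

lemma logDeriv_riemannZeta₁ {s : ℂ} (hs : s ≠ 1) (h0 : riemannZeta s ≠ 0) :
    deriv riemannZeta₁ s / riemannZeta₁ s =
      1 / (s - 1) + deriv riemannZeta s / riemannZeta s := by
  have hs1 : s - 1 ≠ 0 := sub_ne_zero.2 hs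
  have hev : riemannZeta₁ =ᶠ[nhds s] fun z => (z - 1) * riemannZeta z := by
    filter_upwards [isOpen_ne.mem_nhds hs] with z hz using riemannZeta₁_eq hz
  have hd : HasDerivAt (fun z => (z - 1) * riemannZeta z)
      (1 * riemannZeta s + (s - 1) * deriv riemannZeta s) s :=
    ((hasDerivAt_id s).sub_const 1).mul (differentiableAt_riemannZeta hs).hasDerivAt
  rw [hev.deriv_eq, hd.deriv, riemannZeta₁_eq hs]
  field_simp

lemma differentiableAt_psiMellin {s : ℂ} (hs : s ≠ 0) (h : riemannZeta₁ s ≠ 0) :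
    DifferentiableAt ℂ psiMellin s := by
  have h1 : DifferentiableAt ℂ (deriv riemannZeta₁) s :=
    (differentiable_riemannZeta₁.analyticAt s).deriv.differentiableAt
  exact (((h1.div differentiable_riemannZeta₁.differentiableAt h).add_const 1).neg).div
    differentiableAt_id hs

lemma analyticAt_psiMellin {s : ℂ} (hs : 1 ≤ s.re) : AnalyticAt ℂ psiMellin s := by
  have hs0 : s ≠ 0 := by rintro rfl; simp at hs; linarith
  rw [Complex.analyticAt_iff_eventually_differentiableAt]
  filter_upwards [differentiable_riemannZeta₁.continuous.continuousAt.eventually_ne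
    (riemannZeta₁_ne_zero hs), isOpen_ne.mem_nhds hs0] with z h1 h2
  exact differentiableAt_psiMellin h2 h1

lemma exists_norm_deriv_deriv_psiMellin_le_of_two_le : ∃ C : ℝ, ∀ s : ℂ, 1 ≤ s.re → s.re ≤ 2 →
    2 ≤ |s.im| → ‖deriv (deriv psiMellin) s‖ ≤ C := by
  obtain ⟨D, hD, hd⟩ := exists_norm_deriv_riemannZeta_le
  obtain ⟨c, hc, hl⟩ := exists_le_norm_riemannZeta
  set e : ℝ := min (1 / 128) (c / (4 * D)) with he
  have he0 : 0 < e := lt_min (by norm_num) (by positivity)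
  have he1 : e ≤ 1 / 128 := min_le_left _ _
  have he2 : 4 * D * e ≤ c := by
    have : e ≤ c / (4 * D) := min_le_right _ _
    rwa [le_div_iff₀' (by positivity)] at this
  refine ⟨2 * (2 * (4 * D / c + 2)) / e ^ 2, fun s h1 h2 h3 => ?_⟩
  set q : ℝ := |s.im| ^ (1 / 16 : ℝ) with hq
  have hq1 : 1 ≤ q := Real.one_le_rpow (by linarith) (by norm_num)
  have hq0 : 0 < q := by linarith
  have hq16 : q ^ 16 = |s.im| := by
    rw [hq, ← Real.rpow_natCast, ← Real.rpow_mul (abs_nonneg _)]; norm_num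
  set r : ℝ := e / q ^ 5 with hr
  have hr0 : 0 < r := by positivity
  have hr1 : r ≤ 1 / 128 := (div_le_self he0.le (one_le_pow₀ hq1)).trans he1
  have hball : ∀ z : ℂ, ‖z - s‖ ≤ r → 63 / 64 < z.re ∧ z.re ≤ 3 ∧ 3 / 2 ≤ |z.im| ∧
      |s.im| / 2 ≤ |z.im| ∧ |z.im| ≤ 2 * |s.im| := by
    intro z hz
    have hi := abs_im_sub_le hz
    have hr := abs_le.1 (abs_re_sub_le hz)
    have hi1 := abs_sub_abs_le_abs_sub z.im s.im
    have hi2 := abs_sub_abs_le_abs_sub s.im z.im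
    rw [abs_sub_comm] at hi2
    refine ⟨?_, ?_, ?_, ?_, ?_⟩ <;> linarith
  have hne1 : ∀ z : ℂ, ‖z - s‖ ≤ r → z ≠ 1 := by
    rintro z hz rfl
    have := (hball _ hz).2.2.1
    simp at this
    linarith
  have hder : ∀ z : ℂ, ‖z - s‖ ≤ r → ‖deriv riemannZeta z‖ ≤ 2 * D * q := by
    intro z hz
    obtain ⟨a1, a2, a3, a4, a5⟩ := hball z hz
    refine (hd z a1 a2 a3).trans ?_
    have : |z.im| ^ (1 / 16 : ℝ) ≤ 2 * q := by
      refine le_trans ?_ (two_mul_rpow_le (abs_nonneg _))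
      gcongr
    calc D * |z.im| ^ (1 / 16 : ℝ) ≤ D * (2 * q) := by gcongr
      _ = _ := by ring
  have hlow : ∀ z : ℂ, ‖z - s‖ ≤ r → c / (2 * q ^ 4) ≤ ‖riemannZeta z‖ := by
    intro z hz
    have hmv := Convex.norm_image_sub_le_of_norm_hasDerivWithin_le (𝕜 := ℂ) (f := riemannZeta)
      (f' := deriv riemannZeta) (s := Metric.closedBall s r) (C := 2 * D * q) (x := z) (y := s)
      (fun w hw => (differentiableAt_riemannZeta
        (hne1 w (mem_closedBall_iff_norm.1 hw))).hasDerivAt.hasDerivWithinAt)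
      (fun w hw => hder w (mem_closedBall_iff_norm.1 hw)) (convex_closedBall _ _)
      (mem_closedBall_iff_norm.2 hz) (Metric.mem_closedBall_self hr0.le)
    have h6 : ‖riemannZeta s - riemannZeta z‖ ≤ c / (2 * q ^ 4) := by
      rw [norm_sub_rev] at hz
      refine hmv.trans ((mul_le_mul_of_nonneg_left hz (by positivity)).trans ?_)
      calc 2 * D * q * r = (4 * D * e) / (2 * q ^ 4) := by rw [hr]; field_simp; ring
        _ ≤ _ := by gcongr
    have h7 := norm_sub_norm_le (riemannZeta s) (riemannZeta z)
    have h8 := hl s h1 h2 h3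
    have h9 : c / q ^ 4 = c / (2 * q ^ 4) + c / (2 * q ^ 4) := by field_simp; ring
    linarith
  have hz0 : ∀ z : ℂ, ‖z - s‖ ≤ r → riemannZeta z ≠ 0 := fun z hz => by
    rw [← norm_pos_iff]
    exact lt_of_lt_of_le (by positivity) (hlow z hz)
  have hbound : ∀ z : ℂ, ‖z - s‖ ≤ r → ‖psiMellin z‖ ≤ 2 * (4 * D / c + 2) * q ^ 5 / q ^ 16 := by
    intro z hz
    obtain ⟨a1, a2, a3, a4, a5⟩ := hball z hz
    have hzn : q ^ 16 / 2 ≤ ‖z‖ := by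
      rw [hq16]; exact a4.trans (Complex.abs_im_le_norm z)
    have b1 : ‖1 / (z - 1)‖ ≤ 1 := by
      rw [norm_div, norm_one]
      apply div_le_one_of_le₀ _ (norm_nonneg _)
      have := Complex.abs_im_le_norm (z - 1)
      rw [Complex.sub_im, Complex.one_im, sub_zero] at this
      linarith
    have b2 : ‖deriv riemannZeta z / riemannZeta z‖ ≤ 4 * D / c * q ^ 5 := by
      rw [norm_div]
      calc _ ≤ 2 * D * q / (c / (2 * q ^ 4)) :=
            div_le_div₀ (by positivity) (hder z hz) (by positivity) (hlow z hz)
        _ = _ := by field_simp; ring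
    have b3 : ‖deriv riemannZeta₁ z / riemannZeta₁ z + 1‖ ≤ (4 * D / c + 2) * q ^ 5 := by
      rw [logDeriv_riemannZeta₁ (hne1 z hz) (hz0 z hz)]
      have := norm_add₃_le (a := 1 / (z - 1)) (b := deriv riemannZeta z / riemannZeta z)
        (c := (1 : ℂ))
      rw [norm_one] at this
      have hq5 : 1 ≤ q ^ 5 := one_le_pow₀ hq1
      linarith
    rw [psiMellin, norm_div, norm_neg]
    calc _ ≤ (4 * D / c + 2) * q ^ 5 / (q ^ 16 / 2) :=
          div_le_div₀ (by positivity) b3 (by positivity) hzn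
      _ = _ := by field_simp
  have hdc : DiffContOnCl ℂ psiMellin (Metric.ball s r) := by
    apply DifferentiableOn.diffContOnCl
    rw [closure_ball _ hr0.ne']
    intro z hz
    rw [mem_closedBall_iff_norm] at hz
    refine (differentiableAt_psiMellin ?_ ?_).differentiableWithinAt
    · rintro rfl
      have := (hball _ hz).1
      simp at this
      linarith
    · rw [riemannZeta₁_eq (hne1 z hz)]
      exact mul_ne_zero (sub_ne_zero.2 (hne1 z hz)) (hz0 z hz)
  have := Complex.norm_iteratedDeriv_le_of_forall_mem_sphere_norm_le 2 hr0 hdc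
    (fun z hz => hbound z (mem_sphere_iff_norm.1 hz).le)
  rw [iteratedDeriv_succ, iteratedDeriv_one] at this
  refine this.trans ?_
  have hfac : ((Nat.factorial 2 : ℕ) : ℝ) = 2 := by norm_num [Nat.factorial]
  rw [hfac]
  calc 2 * (2 * (4 * D / c + 2) * q ^ 5 / q ^ 16) / r ^ 2
      = (2 * (2 * (4 * D / c + 2)) / e ^ 2) / q := by rw [hr]; field_simp
    _ ≤ _ := div_le_self (by positivity) hq1

/-- The second derivative of `psiMellin` is bounded in the strip `1 ≤ re s ≤ 2`. -/
lemma exists_norm_deriv_deriv_psiMellin_le : ∃ C : ℝ, ∀ s : ℂ, 1 ≤ s.re → s.re ≤ 2 →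
    ‖deriv (deriv psiMellin) s‖ ≤ C := by
  obtain ⟨C, hC⟩ := exists_norm_deriv_deriv_psiMellin_le_of_two_le
  have hK : IsCompact (Set.Icc (1 : ℝ) 2 ×ℂ Set.Icc (-2 : ℝ) 2) :=
    isCompact_Icc.reProdIm isCompact_Icc
  obtain ⟨D, hD⟩ := hK.exists_bound_of_continuousOn (f := deriv (deriv psiMellin))
    (fun z hz => (analyticAt_psiMellin hz.1.1).deriv.deriv.continuousAt.continuousWithinAt)
  refine ⟨max C D, fun s h1 h2 => ?_⟩
  rcases le_total 2 |s.im| with h | h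
  · exact (hC s h1 h2 h).trans (le_max_left _ _)
  · exact (hD s ⟨⟨h1, h2⟩, abs_le.1 h⟩).trans (le_max_right _ _)

/-- The error term `ψ(t) - t` for `t > 1`, extended by zero. -/
noncomputable def psiError : ℝ → ℂ :=
  Set.indicator (Set.Ioi 1) fun t => ((Chebyshev.psi t - t : ℝ) : ℂ)

lemma locallyIntegrable_psiError : MeasureTheory.LocallyIntegrable psiError := by
  have h : MeasureTheory.LocallyIntegrable (fun t : ℝ => Chebyshev.psi t - t) :=
    Chebyshev.psi_mono.locallyIntegrable.sub continuous_id.locallyIntegrable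
  have h2 : MeasureTheory.LocallyIntegrable (fun t : ℝ => ((Chebyshev.psi t - t : ℝ) : ℂ)) := by
    intro x
    obtain ⟨U, hU, hi⟩ := h x
    exact ⟨U, hU, hi.ofReal⟩
  exact h2.indicator measurableSet_Ioi

lemma exists_abs_psi_sub_le : ∃ K : ℝ, 0 < K ∧ ∀ t : ℝ, 0 ≤ t → |Chebyshev.psi t - t| ≤ K * t := by
  refine ⟨log 4 + 4 + 1, by positivity, fun t ht => ?_⟩
  have h1 := Chebyshev.psi_le_const_mul_self ht
  have h2 := Chebyshev.psi_nonneg t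
  have h3 : 0 ≤ (log 4 + 4) * t := by positivity
  rw [abs_le]
  constructor <;> linarith

lemma isBigO_psiError_atTop : psiError =O[atTop] fun t : ℝ => t ^ (-(-1) : ℝ) := by
  obtain ⟨K, hK, h⟩ := exists_abs_psi_sub_le
  refine IsBigO.of_bound K ?_
  filter_upwards [eventually_gt_atTop 1] with t ht
  rw [psiError, Set.indicator_of_mem (Set.mem_Ioi.2 ht), Complex.norm_real, neg_neg, Real.rpow_one,
    Real.norm_eq_abs, Real.norm_of_nonneg (by linarith)]
  exact h t (by linarith)

lemma eventually_psiError_eq_zero : ∀ᶠ t in nhdsWithin (0 : ℝ) (Set.Ioi 0), psiError t = 0 := by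
  filter_upwards [nhdsWithin_le_nhds (Iio_mem_nhds one_pos)] with t ht
  exact Set.indicator_of_notMem (by simpa using (Set.mem_Iio.1 ht).le) _

lemma isBigO_zero_of_eventually_eq_zero {f : ℝ → ℂ} {g : ℝ → ℝ}
    (h : ∀ᶠ t in nhdsWithin (0 : ℝ) (Set.Ioi 0), f t = 0) :
    f =O[nhdsWithin 0 (Set.Ioi 0)] g := by
  refine IsBigO.of_bound 0 ?_
  filter_upwards [h] with t ht
  simp [ht]

lemma locallyIntegrableOn_log_smul {f : ℝ → ℂ}
    (hf : MeasureTheory.LocallyIntegrableOn f (Set.Ioi 0)) :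
    MeasureTheory.LocallyIntegrableOn (fun t => log t • f t) (Set.Ioi 0) :=
  hf.continuousOn_smul isOpen_Ioi.isLocallyClosed
    (Real.continuousOn_log.mono fun t ht => (ne_of_gt ht : t ≠ 0))

lemma hasDerivAt_mellin_psiError {w : ℂ} (hw : w.re < -1) :
    HasDerivAt (mellin psiError) (mellin (fun t => log t • psiError t) w) w :=
  (mellin_hasDerivAt_of_isBigO_rpow (b := w.re - 1)
    (locallyIntegrable_psiError.locallyIntegrableOn _)
    isBigO_psiError_atTop hw (isBigO_zero_of_eventually_eq_zero eventually_psiError_eq_zero)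
    (by linarith)).2

lemma mellin_log_psiError {w : ℂ} (hw : w.re < -1) :
    MellinConvergent (fun t => log t • log t • psiError t) w ∧
      HasDerivAt (mellin fun t => log t • psiError t)
        (mellin (fun t => log t • log t • psiError t) w) w := by
  refine mellin_hasDerivAt_of_isBigO_rpow (a := (w.re - 1) / 2) (b := w.re - 1)
    (locallyIntegrableOn_log_smul (locallyIntegrable_psiError.locallyIntegrableOn _))
    (isBigO_rpow_top_log_smul (by linarith) isBigO_psiError_atTop) (by linarith)
    (isBigO_zero_of_eventually_eq_zero ?_) (by linarith)
  filter_upwards [eventually_psiError_eq_zero] with t ht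
  simp [ht]

lemma mellin_psiError {s : ℂ} (hs : 1 < s.re) : mellin psiError (-s) = psiMellin s := by
  have hs1 : s ≠ 1 := by rintro rfl; simp at hs
  have hs0 : s ≠ 0 := by rintro rfl; simp at hs; linarith
  have hpsi : LSeries (fun n => ((ArithmeticFunction.vonMangoldt n : ℝ) : ℂ)) s =
      s * ∫ t in Set.Ioi (1 : ℝ), (Chebyshev.psi t : ℂ) * (t : ℂ) ^ (-(s + 1)) := by
    rw [LSeries_eq_mul_integral_of_nonneg (fun n => ArithmeticFunction.vonMangoldt n) zero_le_one
      hs ?_ fun n => ArithmeticFunction.vonMangoldt_nonneg]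
    · congr 1
      refine MeasureTheory.setIntegral_congr_fun measurableSet_Ioi fun t ht => ?_
      simp only [Chebyshev.psi]
      push_cast
      rfl
    · refine IsBigO.of_bound (log 4 + 4) (Eventually.of_forall fun n => ?_)
      have h1 := Chebyshev.psi_le_const_mul_self (Nat.cast_nonneg (α := ℝ) n)
      have h2 := Chebyshev.psi_nonneg (n : ℝ)
      have h3 : ∑ k ∈ Finset.Icc 1 n, ArithmeticFunction.vonMangoldt k = Chebyshev.psi n := by
        rw [Chebyshev.psi, Nat.floor_natCast]; rfl
      rw [h3, Real.rpow_one, Real.norm_of_nonneg h2, Real.norm_of_nonneg (Nat.cast_nonneg n)]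
      exact h1
  have hconv : MellinConvergent psiError (-s) := mellinConvergent_of_isBigO_rpow
    (locallyIntegrable_psiError.locallyIntegrableOn _) isBigO_psiError_atTop
    (b := -s.re - 1) (by simpa using hs)
    (isBigO_zero_of_eventually_eq_zero eventually_psiError_eq_zero) (by simp)
  have hint2 : MeasureTheory.IntegrableOn (fun t : ℝ => (t : ℂ) ^ (-s)) (Set.Ioi 1) :=
    integrableOn_Ioi_cpow_of_lt (by simpa using hs) one_pos
  have hval2 : ∫ t in Set.Ioi (1 : ℝ), (t : ℂ) ^ (-s) = 1 / (s - 1) := by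
    rw [integral_Ioi_cpow_of_lt (by simpa using hs) one_pos]
    rw [show -s + 1 = -(s - 1) by ring, div_neg, neg_div]
    simp
  have hmel : mellin psiError (-s) = ∫ t in Set.Ioi (1 : ℝ),
      ((Chebyshev.psi t : ℂ) * (t : ℂ) ^ (-(s + 1)) - (t : ℂ) ^ (-s)) := by
    refine (MeasureTheory.setIntegral_eq_of_subset_of_forall_sdiff_eq_zero
      measurableSet_Ioi (Set.Ioi_subset_Ioi zero_le_one) fun t ht => ?_).trans
      (MeasureTheory.setIntegral_congr_fun measurableSet_Ioi fun t ht => ?_)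
    · rw [psiError, Set.indicator_of_notMem ht.2, smul_zero]
    · have ht0 : (t : ℂ) ≠ 0 := by
        exact_mod_cast (lt_trans one_pos (Set.mem_Ioi.1 ht)).ne'
      simp only [psiError, Set.indicator_of_mem ht, smul_eq_mul]
      rw [show -(s + 1) = -s - 1 by ring, Complex.cpow_sub _ _ ht0, Complex.cpow_one]
      push_cast
      field_simp
  have hint : MeasureTheory.IntegrableOn (fun t : ℝ =>
      (Chebyshev.psi t : ℂ) * (t : ℂ) ^ (-(s + 1))) (Set.Ioi 1) := by
    have h1 : MeasureTheory.IntegrableOn (fun t : ℝ => (t : ℂ) ^ (-s - 1) • psiError t)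
        (Set.Ioi 1) := hconv.mono_set (Set.Ioi_subset_Ioi zero_le_one)
    refine (h1.add hint2).congr_fun (fun t ht => ?_) measurableSet_Ioi
    have ht0 : (t : ℂ) ≠ 0 := by
      exact_mod_cast (lt_trans one_pos (Set.mem_Ioi.1 ht)).ne'
    simp only [Pi.add_apply, psiError, Set.indicator_of_mem ht, smul_eq_mul]
    rw [show -(s + 1) = -s - 1 by ring, Complex.cpow_sub _ _ ht0, Complex.cpow_one]
    push_cast
    field_simp
    ring
  rw [hmel, MeasureTheory.integral_sub hint hint2, hval2]
  have h0 := riemannZeta_ne_zero_of_one_le_re hs.le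
  rw [ArithmeticFunction.LSeries_vonMangoldt_eq_deriv_riemannZeta_div hs] at hpsi
  have h2 : ∫ t in Set.Ioi (1 : ℝ), (Chebyshev.psi t : ℂ) * (t : ℂ) ^ (-(s + 1)) =
      -deriv riemannZeta s / riemannZeta s / s := by
    rw [hpsi, mul_div_cancel_left₀ _ hs0]
  rw [h2, psiMellin, logDeriv_riemannZeta₁ hs1 h0]
  have hs1' : s - 1 ≠ 0 := sub_ne_zero.2 hs1
  field_simp
  ring

lemma mellin_log_log_psiError {s : ℂ} (hs : 1 < s.re) :
    mellin (fun t => log t • log t • psiError t) (-s) = deriv (deriv psiMellin) s := by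
  have hU : IsOpen {z : ℂ | 1 < z.re} := isOpen_lt continuous_const Complex.continuous_re
  have h1 : ∀ z : ℂ, 1 < z.re →
      deriv psiMellin z = -mellin (fun t => log t • psiError t) (-z) := by
    intro z hz
    have hev : psiMellin =ᶠ[nhds z] fun z => mellin psiError (-z) := by
      filter_upwards [hU.mem_nhds hz] with y hy using (mellin_psiError hy).symm
    have hd := (hasDerivAt_mellin_psiError (w := -z) (by simpa using hz)).comp z
      (hasDerivAt_neg z)
    rw [hev.deriv_eq]
    simpa [Function.comp_def] using hd.deriv
  have hev : deriv psiMellin =ᶠ[nhds s] fun z => -mellin (fun t => log t • psiError t) (-z) := by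
    filter_upwards [hU.mem_nhds hs] with y hy using h1 y hy
  have hd := ((mellin_log_psiError (w := -s) (by simpa using hs)).2.comp s (hasDerivAt_neg s)).neg
  rw [hev.deriv_eq]
  symm
  simpa [Function.comp_def] using hd.deriv

open scoped FourierTransform SchwartzMap in
/-- A bound for the Fourier transform of `F` bounds the integral of `F` against all translates and
dilates of a Schwartz function. -/
lemma norm_integral_mul_schwartz_le {F : ℝ → ℂ} (hF : MeasureTheory.Integrable F) {C : ℝ}
    (hC : ∀ ξ, ‖𝓕 F ξ‖ ≤ C) (φ : 𝓢(ℝ, ℂ)) (p : ℝ) {δ : ℝ} (hδ : 0 < δ) :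
    ‖∫ u, F u * φ ((u - p) / δ)‖ ≤ C * ∫ ξ, ‖(𝓕⁻ φ : 𝓢(ℝ, ℂ)) ξ‖ := by
  set χ₀ : 𝓢(ℝ, ℂ) := 𝓕⁻ φ with hχ₀
  set χ : ℝ → ℂ := fun ξ => (δ : ℂ) * (Complex.exp (↑(2 * π * (p * ξ)) * Complex.I) * χ₀ (δ * ξ))
    with hχdef
  have hnorm : ∀ ξ, ‖χ ξ‖ = δ * ‖χ₀ (δ * ξ)‖ := fun ξ => by
    rw [hχdef]
    simp only [norm_mul, Complex.norm_exp_ofReal_mul_I, one_mul, Complex.norm_real,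
      Real.norm_of_nonneg hδ.le]
  have hint0 : MeasureTheory.Integrable (fun ξ => χ₀ (δ * ξ)) :=
    χ₀.integrable.comp_mul_left' hδ.ne'
  have hint : MeasureTheory.Integrable χ := by
    refine (hint0.norm.const_mul δ).mono' ?_ (Eventually.of_forall fun ξ => (hnorm ξ).le)
    have : Continuous χ := by
      have := χ₀.continuous
      fun_prop
    exact this.aestronglyMeasurable
  have hfour : ∀ u, 𝓕 χ u = φ ((u - p) / δ) := by
    intro u
    have h1 : φ = 𝓕 χ₀ := by rw [hχ₀, FourierTransform.fourier_fourierInv_eq]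
    rw [h1, SchwartzMap.fourier_coe, Real.fourier_eq', Real.fourier_eq']
    have h2 := MeasureTheory.Measure.integral_comp_mul_left (fun η : ℝ =>
      Complex.exp (↑(-2 * π * inner ℝ η ((u - p) / δ)) * Complex.I) • χ₀ η) δ
    rw [abs_of_pos (inv_pos.2 hδ), eq_inv_smul_iff₀ hδ.ne', ← MeasureTheory.integral_smul] at h2
    rw [← h2]
    congr 1
    funext ξ
    simp only [hχdef, smul_eq_mul, Complex.real_smul, Real.inner_apply]
    rw [mul_left_comm, ← mul_assoc (Complex.exp _), ← Complex.exp_add]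
    congr 3
    push_cast
    have : (δ : ℂ) ≠ 0 := by exact_mod_cast hδ.ne'
    field_simp
    ring
  have hflip : ∫ ξ, 𝓕 F ξ * χ ξ = ∫ u, F u * φ ((u - p) / δ) := by
    simp_rw [← hfour]
    simpa using! (VectorFourier.integral_fourierIntegral_smul_eq_flip (L := innerₗ ℝ)
      Real.continuous_fourierChar continuous_inner hF hint)
  rw [← hflip, ← MeasureTheory.integral_const_mul]
  have hC0 : 0 ≤ C := (norm_nonneg _).trans (hC 0)
  calc ‖∫ ξ, 𝓕 F ξ * χ ξ‖ ≤ ∫ ξ, C * (δ * ‖χ₀ (δ * ξ)‖) := by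
        refine MeasureTheory.norm_integral_le_of_norm_le
          ((hint0.norm.const_mul δ).const_mul C) (Eventually.of_forall fun ξ => ?_)
        rw [norm_mul, hnorm]
        gcongr
        exact hC ξ
    _ = ∫ ξ, C * ‖χ₀ ξ‖ := by
        rw [MeasureTheory.integral_const_mul, MeasureTheory.integral_const_mul,
          MeasureTheory.integral_const_mul,
          MeasureTheory.Measure.integral_comp_mul_left (fun ξ => ‖χ₀ ξ‖) δ,
          abs_of_pos (inv_pos.2 hδ), smul_eq_mul, mul_inv_cancel_left₀ hδ.ne']

/-- The logarithmic form of the weighted error term `t ^ (-σ) (log t)² (ψ(t) - t)`, at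
`t = exp (-u)`. -/
noncomputable def psiErrorLog (σ : ℝ) (u : ℝ) : ℂ :=
  exp (σ * u) • (log (exp (-u)) • log (exp (-u)) • psiError (exp (-u)))

lemma integrable_psiErrorLog {σ : ℝ} (hσ : 1 < σ) : MeasureTheory.Integrable (psiErrorLog σ) := by
  have hf := (mellin_log_psiError (w := -σ) (by simpa using hσ)).1
  have hderiv : ∀ x ∈ (Set.univ : Set ℝ),
      HasDerivWithinAt (rexp ∘ Neg.neg) (-rexp (-x)) Set.univ x := fun x _ =>
    mul_neg_one (rexp (-x)) ▸
      ((Real.hasDerivAt_exp (-x)).comp x (hasDerivAt_neg x)).hasDerivWithinAt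
  have himage : rexp ∘ Neg.neg '' Set.univ = Set.Ioi 0 := by
    rw [Set.image_comp, Set.image_univ_of_surjective neg_surjective, Set.image_univ, Real.range_exp]
  rw [MellinConvergent, ← himage, MeasureTheory.integrableOn_image_iff_integrableOn_abs_deriv_smul
    MeasurableSet.univ hderiv (Real.exp_injective.injOn.comp neg_injective.injOn
      (Set.univ.mapsTo_univ _)), MeasureTheory.integrableOn_univ] at hf
  refine hf.congr (Eventually.of_forall fun u => ?_)
  have : (exp (-u) : ℂ) * (((exp (-u) : ℝ) : ℂ) ^ (-(σ : ℂ) - 1)) = ((exp (σ * u) : ℝ) : ℂ) := by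
    push_cast
    rw [Complex.cpow_sub _ _ (Complex.exp_ne_zero _), Complex.cpow_one,
      mul_div_cancel₀ _ (Complex.exp_ne_zero _),
      Complex.cpow_def_of_ne_zero (Complex.exp_ne_zero _), Complex.log_exp (by simp [pi_pos]) (by simpa using pi_nonneg)]
    ring_nf
  simp only [psiErrorLog, Function.comp_apply, abs_neg, Complex.real_smul, smul_eq_mul,
    abs_of_pos (exp_pos _)]
  rw [← this, mul_assoc]

open scoped FourierTransform in
lemma exists_norm_fourier_psiErrorLog_le :
    ∃ C : ℝ, ∀ σ : ℝ, 1 < σ → σ ≤ 2 → ∀ ξ : ℝ, ‖𝓕 (psiErrorLog σ) ξ‖ ≤ C := by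
  obtain ⟨C, hC⟩ := exists_norm_deriv_deriv_psiMellin_le
  refine ⟨C, fun σ h1 h2 ξ => ?_⟩
  set s : ℂ := ⟨σ, -(2 * π * ξ)⟩ with hs
  have h3 := mellin_log_log_psiError (s := s) h1
  rw [mellin_eq_fourier] at h3
  have h4 : (-s).im / (2 * π) = ξ := by
    rw [hs]
    simp
  rw [h4] at h3
  have h5 : (fun u : ℝ => rexp (-(-s).re * u) •
      (log (rexp (-u)) • log (rexp (-u)) • psiError (rexp (-u)))) = psiErrorLog σ := by
    funext u
    simp [psiErrorLog, hs]
  rw [h5] at h3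
  rw [h3]
  exact hC s h1.le h2

/-- If `ψ(e ^ v) - e ^ v` has constant sign and relative size at least `a` on the interval
`[m - δ, m + δ]`, then `a (m - δ)² δ` is bounded. -/
lemma exists_mul_sq_mul_le : ∃ C : ℝ, ∀ m δ a ε : ℝ, 0 < δ → 1 ≤ m - δ → 0 ≤ a →
    (∀ v ∈ Set.Icc (m - δ) (m + δ), a * exp v ≤ ε * (Chebyshev.psi (exp v) - exp v)) → |ε| = 1 →
    a * (m - δ) ^ 2 * δ ≤ C := by
  obtain ⟨C, hC⟩ := exists_norm_fourier_psiErrorLog_le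
  let b : ContDiffBump (0 : ℝ) := ⟨1 / 2, 1, by norm_num, by norm_num⟩
  let φ : SchwartzMap ℝ ℂ := HasCompactSupport.toSchwartzMap (f := fun x => ((b x : ℝ) : ℂ))
    (b.hasCompactSupport.comp_left Complex.ofReal_zero)
    (Complex.ofRealCLM.contDiff.comp b.contDiff)
  have hφ : ∀ x, φ x = ((b x : ℝ) : ℂ) := fun x => rfl
  set D : ℝ := C * ∫ ξ, ‖(FourierTransformInv.fourierInv φ : SchwartzMap ℝ ℂ) ξ‖ with hD
  refine ⟨exp 1 * D, fun m δ a ε hδ hw ha hv hε => ?_⟩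
  have hm : 1 ≤ m + δ := by linarith
  set σ : ℝ := 1 + 1 / (m + δ) with hσ
  have hσ1 : 1 < σ := by
    have : 0 < 1 / (m + δ) := by positivity
    linarith
  have hσ2 : σ ≤ 2 := by
    have : 1 / (m + δ) ≤ 1 := by rw [div_le_one (by linarith)]; exact hm
    linarith
  set G : ℝ → ℝ := fun u => (psiErrorLog σ u).re with hG
  have hGF : ∀ u, psiErrorLog σ u = ((G u : ℝ) : ℂ) := by
    intro u
    rw [hG]
    by_cases h : exp (-u) ∈ Set.Ioi (1 : ℝ)
    · simp only [psiErrorLog, psiError, Set.indicator_of_mem h]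
      simp only [Complex.real_smul]
      norm_cast
    · simp only [psiErrorLog, psiError, Set.indicator_of_notMem h]
      simp
  have hbound := norm_integral_mul_schwartz_le (integrable_psiErrorLog hσ1) (hC σ hσ1 hσ2) φ (-m) hδ
  rw [← hD] at hbound
  have hGint : MeasureTheory.Integrable G := (integrable_psiErrorLog hσ1).re
  have hHint : MeasureTheory.Integrable (fun u => ε * (G u * b ((u - -m) / δ))) := by
    refine (hGint.mul_bdd (c := 1) ?_ (Eventually.of_forall fun u => ?_)).const_mul ε
    · have := b.continuous
      have : Continuous fun u : ℝ => b ((u - -m) / δ) := by fun_prop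
      exact this.aestronglyMeasurable
    · rw [Real.norm_of_nonneg b.nonneg]
      exact b.le_one
  have hlower : ∀ u ∈ Set.Icc (-m - δ) (-m + δ), exp (-1) * (a * (m - δ) ^ 2) ≤ ε * G u := by
    intro u hu
    have h1 := hv (-u) ⟨by linarith [hu.2], by linarith [hu.1]⟩
    have hu1 : 1 < exp (-u) := by rw [Real.one_lt_exp_iff]; linarith [hu.2]
    have h2 : ε * G u = exp (σ * u) * (u ^ 2 * (ε * (Chebyshev.psi (exp (-u)) - exp (-u)))) := by
      rw [hG]
      simp only [psiErrorLog, psiError, Set.indicator_of_mem (Set.mem_Ioi.2 hu1), log_exp]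
      simp only [Complex.real_smul, ← Complex.ofReal_mul, Complex.ofReal_re]
      ring
    rw [h2]
    calc exp (-1) * (a * (m - δ) ^ 2) ≤ exp ((σ - 1) * u) * (a * u ^ 2) := by
          have h3 : (m - δ) ^ 2 ≤ u ^ 2 := by
            rw [← neg_sq u]
            exact pow_le_pow_left₀ (by linarith) (by linarith [hu.2]) 2
          have h4 : -1 ≤ (σ - 1) * u := by
            rw [hσ, add_sub_cancel_left, one_div_mul_eq_div, le_div_iff₀ (by linarith)]
            linarith [hu.1]
          gcongr
      _ = exp (σ * u) * (u ^ 2 * (a * exp (-u))) := by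
          rw [show (σ - 1) * u = σ * u + -u by ring, exp_add]
          ring
      _ ≤ _ := by gcongr
  have hpoint : ∀ u, Set.indicator (Set.Icc (-m - δ / 2) (-m + δ / 2))
      (fun _ => exp (-1) * (a * (m - δ) ^ 2)) u ≤ ε * (G u * b ((u - -m) / δ)) := by
    intro u
    by_cases h1 : u ∈ Set.Icc (-m - δ / 2) (-m + δ / 2)
    · rw [Set.indicator_of_mem h1]
      have hb : b ((u - -m) / δ) = 1 := by
        refine b.one_of_mem_closedBall ?_
        rw [mem_closedBall_zero_iff, Real.norm_eq_abs, abs_div, abs_of_pos hδ,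
          div_le_iff₀ hδ, abs_le]
        change -(1 / 2 * δ) ≤ _ ∧ _ ≤ 1 / 2 * δ
        constructor <;> linarith [h1.1, h1.2]
      rw [hb, mul_one]
      exact hlower u ⟨by linarith [h1.1], by linarith [h1.2]⟩
    · rw [Set.indicator_of_notMem h1]
      by_cases h2 : u ∈ Set.Icc (-m - δ) (-m + δ)
      · rw [← mul_assoc]
        exact mul_nonneg (le_trans (by positivity) (hlower u h2)) b.nonneg
      · have hb : b ((u - -m) / δ) = 0 := by
          refine b.zero_of_le_dist ?_
          rw [dist_zero_right, Real.norm_eq_abs, abs_div, abs_of_pos hδ, le_div_iff₀ hδ]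
          change 1 * δ ≤ _
          by_contra! h3
          rw [abs_lt] at h3
          exact h2 ⟨by linarith [h3.1], by linarith [h3.2]⟩
        rw [hb, mul_zero, mul_zero]
  have hind : ∫ u, Set.indicator (Set.Icc (-m - δ / 2) (-m + δ / 2))
      (fun _ => exp (-1) * (a * (m - δ) ^ 2)) u = δ * (exp (-1) * (a * (m - δ) ^ 2)) := by
    rw [MeasureTheory.integral_indicator measurableSet_Icc, MeasureTheory.setIntegral_const,
      MeasureTheory.measureReal_def, Real.volume_Icc, smul_eq_mul]
    congr 1
    rw [ENNReal.toReal_ofReal] <;> linarith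
  have hle : δ * (exp (-1) * (a * (m - δ) ^ 2)) ≤ ∫ u, ε * (G u * b ((u - -m) / δ)) := by
    rw [← hind]
    refine MeasureTheory.integral_mono ?_ hHint hpoint
    rw [MeasureTheory.integrable_indicator_iff measurableSet_Icc]
    exact MeasureTheory.integrableOn_const (by simp)
  have heq : ∫ u, psiErrorLog σ u * φ ((u - -m) / δ) =
      ((∫ u, G u * b ((u - -m) / δ) : ℝ) : ℂ) := by
    rw [← integral_complex_ofReal]
    congr 1
    funext u
    rw [hGF, hφ]
    push_cast
    rfl
  rw [heq, Complex.norm_real, Real.norm_eq_abs] at hbound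
  have h5 : ∫ u, ε * (G u * b ((u - -m) / δ)) ≤ D := by
    rw [MeasureTheory.integral_const_mul]
    refine (le_abs_self _).trans ?_
    rw [abs_mul, hε, one_mul]
    exact hbound
  have h6 := mul_le_mul_of_nonneg_left (hle.trans h5) (exp_pos 1).le
  have h7 : exp 1 * exp (-1) = 1 := by rw [← exp_add]; simp
  calc a * (m - δ) ^ 2 * δ = (exp 1 * exp (-1)) * (a * (m - δ) ^ 2 * δ) := by rw [h7, one_mul]
    _ = exp 1 * (δ * (exp (-1) * (a * (m - δ) ^ 2))) := by ring
    _ ≤ _ := h6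

/-- The prime number theorem with error term: `ψ(e ^ v) - e ^ v = O(e ^ v / v)`. -/
lemma exists_abs_psi_exp_sub_le : ∃ M : ℝ, ∀ v : ℝ, 2 ≤ v →
    |Chebyshev.psi (exp v) - exp v| ≤ M * (exp v / v) := by
  obtain ⟨C₀, hC₀⟩ := exists_mul_sq_mul_le
  obtain ⟨C, hC0, hC⟩ : ∃ C : ℝ, 0 ≤ C ∧ ∀ m δ a ε : ℝ, 0 < δ → 1 ≤ m - δ → 0 ≤ a →
      (∀ v ∈ Set.Icc (m - δ) (m + δ), a * exp v ≤ ε * (Chebyshev.psi (exp v) - exp v)) →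
      |ε| = 1 → a * (m - δ) ^ 2 * δ ≤ C :=
    ⟨max C₀ 0, le_max_right _ _, fun m δ a ε h1 h2 h3 h4 h5 =>
      (hC₀ m δ a ε h1 h2 h3 h4 h5).trans (le_max_left _ _)⟩
  obtain ⟨K, hK, hpsi⟩ := exists_abs_psi_sub_le
  refine ⟨√(8 * (1 + K) * C + 32 * C), fun v₀ hv₀ => ?_⟩
  have hE := exp_pos v₀
  have hsuff : ∀ c : ℝ, 0 ≤ c → c ^ 2 * v₀ ^ 2 ≤ 8 * (1 + K) * C + 32 * C →
      c * exp v₀ ≤ √(8 * (1 + K) * C + 32 * C) * (exp v₀ / v₀) := by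
    intro c hc h
    have h1 : c * v₀ ≤ √(8 * (1 + K) * C + 32 * C) := by
      refine Real.le_sqrt_of_sq_le ?_
      rwa [mul_pow]
    calc c * exp v₀ = (c * v₀) * (exp v₀ / v₀) := by field_simp
      _ ≤ _ := by gcongr
  rcases lt_trichotomy (Chebyshev.psi (exp v₀) - exp v₀) 0 with hneg | hzero | hpos
  · rw [abs_of_neg hneg]
    set c : ℝ := -(Chebyshev.psi (exp v₀) - exp v₀) / exp v₀ with hc
    have hc0 : 0 < c := div_pos (by linarith) hE
    have hcE : -(Chebyshev.psi (exp v₀) - exp v₀) = c * exp v₀ := by rw [hc]; field_simp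
    have hc1 : c ≤ 1 := by
      rw [hc, div_le_one hE]
      linarith [Chebyshev.psi_nonneg (exp v₀)]
    rw [hcE]
    refine hsuff c hc0.le ?_
    have h1 := hC (v₀ - c / 4) (c / 4) (c / 2) (-1) (by positivity) (by linarith) (by positivity)
      (fun v hv => ?_) (by simp)
    · have h2 : (v₀ / 2) ^ 2 ≤ (v₀ - c / 4 - c / 4) ^ 2 :=
        pow_le_pow_left₀ (by linarith) (by linarith) 2
      have h3 : c / 2 * (v₀ / 2) ^ 2 * (c / 4) ≤ C := le_trans (by gcongr) h1
      have h4 : 0 ≤ 8 * (1 + K) * C := by positivity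
      nlinarith
    · have hmono := Chebyshev.psi_mono (exp_le_exp.2 (show v ≤ v₀ by linarith [hv.2]))
      have h2 : exp v₀ = exp (v₀ - v) * exp v := by rw [← exp_add]; ring_nf
      have h3 : exp (v₀ - v) * (1 - c / 2) ≤ 1 := by
        have h5 : 1 - c / 2 ≤ exp (-(c / 2)) := one_sub_le_exp_neg _
        calc exp (v₀ - v) * (1 - c / 2) ≤ exp (v₀ - v) * exp (-(c / 2)) := by gcongr
          _ = exp (v₀ - v - c / 2) := by rw [← exp_add]; ring_nf
          _ ≤ 1 := by rw [exp_le_one_iff]; linarith [hv.1]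
      have h4 : (1 - c) * exp (v₀ - v) ≤ 1 - c / 2 := by
        have h6 : (1 - c) ≤ (1 - c / 2) * (1 - c / 2) := by nlinarith [sq_nonneg c]
        have h7 := exp_pos (v₀ - v)
        calc (1 - c) * exp (v₀ - v) ≤ (1 - c / 2) * (1 - c / 2) * exp (v₀ - v) := by gcongr
          _ = (1 - c / 2) * (exp (v₀ - v) * (1 - c / 2)) := by ring
          _ ≤ (1 - c / 2) * 1 := by
            have : 0 ≤ 1 - c / 2 := by linarith
            gcongr
          _ = _ := mul_one _
      have h8 := mul_le_mul_of_nonneg_right h4 (exp_pos v).le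
      have h9 : Chebyshev.psi (exp v₀) = (1 - c) * exp (v₀ - v) * exp v := by
        rw [mul_assoc, ← h2]; linarith
      linarith
  · rw [hzero, abs_zero]; positivity
  · rw [abs_of_pos hpos]
    set c : ℝ := (Chebyshev.psi (exp v₀) - exp v₀) / exp v₀ with hc
    have hc0 : 0 < c := div_pos (by linarith) hE
    have hcE : Chebyshev.psi (exp v₀) - exp v₀ = c * exp v₀ := by rw [hc]; field_simp
    have hcK : c ≤ K := by
      rw [hc, div_le_iff₀ hE]
      exact (le_abs_self _).trans (hpsi _ hE.le)
    rw [hcE]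
    refine hsuff c hc0.le ?_
    set δ : ℝ := c / (4 * (1 + K)) with hδ
    have hδ0 : 0 < δ := by positivity
    have hδc : 2 * δ * (1 + K) = c / 2 := by rw [hδ]; field_simp; ring
    have h1 := hC (v₀ + δ) δ (c / 2) 1 hδ0 (by linarith) (by positivity)
      (fun v hv => ?_) (by simp)
    · rw [add_sub_cancel_right] at h1
      have h2 : c ^ 2 * v₀ ^ 2 = (c / 2 * v₀ ^ 2 * δ) * (8 * (1 + K)) := by
        rw [hδ]; field_simp; ring
      rw [h2]
      have : c / 2 * v₀ ^ 2 * δ * (8 * (1 + K)) ≤ C * (8 * (1 + K)) := by gcongr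
      linarith
    · have hmono := Chebyshev.psi_mono (exp_le_exp.2 (show v₀ ≤ v by linarith [hv.1]))
      have h2 : exp v₀ = exp (v₀ - v) * exp v := by rw [← exp_add]; ring_nf
      have h3 : 1 - 2 * δ ≤ exp (v₀ - v) := by
        have := add_one_le_exp (v₀ - v)
        linarith [hv.2]
      have h4 : 1 + c / 2 ≤ (1 + c) * exp (v₀ - v) := by
        calc 1 + c / 2 ≤ (1 + c) * (1 - 2 * δ) := by nlinarith
          _ ≤ _ := by gcongr
      have h8 := mul_le_mul_of_nonneg_right h4 (exp_pos v).le
      have h9 : Chebyshev.psi (exp v₀) = (1 + c) * exp (v₀ - v) * exp v := by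
        rw [mul_assoc, ← h2]; linarith
      linarith

lemma psi_sub_id_isBigO :
    (fun x => Chebyshev.psi x - x) =O[atTop] fun x => x / log x := by
  obtain ⟨M, hM⟩ := exists_abs_psi_exp_sub_le
  refine IsBigO.of_bound M ?_
  filter_upwards [eventually_ge_atTop (exp 2)] with x hx
  have hx0 : 0 < x := (exp_pos 2).trans_le hx
  have hl : 2 ≤ log x := (le_log_iff_exp_le hx0).2 hx
  have h := hM (log x) hl
  rw [exp_log hx0] at h
  rwa [Real.norm_eq_abs, Real.norm_of_nonneg (by positivity)]

lemma theta_sub_id_isBigO :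
    (fun x => Chebyshev.theta x - x) =O[atTop] fun x => x / log x := by
  have h1 : (fun x : ℝ => √x) =O[atTop] fun x => x / log x := by
    refine IsBigO.of_bound 2 ?_
    filter_upwards [eventually_gt_atTop 1] with x hx
    have hl : 0 < log x := log_pos hx
    have h2 : log x ≤ 2 * √x := by
      have h3 := log_le_sub_one_of_pos (Real.sqrt_pos.2 (zero_lt_one.trans hx))
      rw [log_sqrt (by linarith)] at h3
      linarith
    rw [Real.norm_of_nonneg (by positivity), Real.norm_of_nonneg (by positivity), ← mul_div_assoc,
      le_div_iff₀ hl]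
    calc √x * log x ≤ √x * (2 * √x) := by gcongr
      _ = 2 * (√x * √x) := by ring
      _ = 2 * x := by rw [Real.mul_self_sqrt (by linarith)]
  refine (psi_sub_id_isBigO.sub (Chebyshev.isBigO_psi_sub_theta_sqrt.trans h1)).congr_left
    fun x => ?_
  simp only [Pi.sub_apply]
  ring

lemma primeCounting_sub_div_log_isBigO :
    (fun x : ℝ => (Nat.primeCounting ⌊x⌋₊ : ℝ) - x / log x) =O[atTop] fun x => x / log x ^ 2 := by
  have h1 : (fun x => (Chebyshev.theta x - x) / log x) =O[atTop] fun x => x / log x ^ 2 := by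
    refine (theta_sub_id_isBigO.mul (isBigO_refl (fun x => (log x)⁻¹) atTop)).congr
      (fun x => ?_) fun x => ?_
    · rw [div_eq_mul_inv]
    · rw [div_eq_mul_inv, div_eq_mul_inv, sq, mul_inv, mul_assoc]
  refine (Chebyshev.primeCounting_sub_theta_div_log_isBigO.add h1).congr_left fun x => ?_
  ring

lemma theta_sub_id_isLittleO : (fun x => Chebyshev.theta x - x) =o[atTop] fun x => x := by
  refine theta_sub_id_isBigO.trans_isLittleO ?_
  have h : Tendsto (fun x : ℝ => (log x)⁻¹) atTop (nhds 0) := tendsto_log_atTop.inv_tendsto_atTop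
  have h2 := (isBigO_refl (fun x : ℝ => x) atTop).mul_isLittleO ((isLittleO_one_iff ℝ).2 h)
  simpa [div_eq_mul_inv] using h2

lemma eventually_exists_prime_le_mul {c : ℝ} (hc : 1 < c) :
    ∀ᶠ x : ℝ in atTop, ∃ p : ℕ, p.Prime ∧ x < p ∧ p ≤ c * x := by
  have hc0 : 0 < c := one_pos.trans hc
  set η : ℝ := (c - 1) / (2 * (c + 1)) with hη
  have hη0 : 0 < η := div_pos (by linarith) (by linarith)
  have hηc : η * (c + 1) = (c - 1) / 2 := by rw [hη]; field_simp
  have h1 := theta_sub_id_isLittleO.bound hη0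
  have h2 := (tendsto_id.const_mul_atTop hc0).eventually h1
  filter_upwards [h1, h2, eventually_gt_atTop 0] with x hx1 hx2 hx0
  by_contra! hcon
  have heq : Chebyshev.theta (c * x) ≤ Chebyshev.theta x := by
    rw [Chebyshev.theta, Chebyshev.theta]
    refine Finset.sum_le_sum_of_subset_of_nonneg (fun p hp => ?_) fun p hp _ => ?_
    · simp only [Finset.mem_filter, Finset.mem_Ioc] at hp ⊢
      refine ⟨⟨hp.1.1, Nat.le_floor ?_⟩, hp.2⟩
      by_contra! h3
      exact (hcon p hp.2 h3).not_ge ((Nat.le_floor_iff (by positivity)).1 hp.1.2)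
    · exact log_nonneg (by exact_mod_cast (Finset.mem_filter.1 hp).2.one_le)
  simp only [id, Real.norm_eq_abs] at hx1 hx2
  rw [abs_of_pos hx0] at hx1
  rw [abs_of_pos (by positivity : 0 < c * x)] at hx2
  have h3 := (abs_le.1 hx1).2
  have h4 := (abs_le.1 hx2).1
  have h5 : η * (c * x) + η * x = (c - 1) / 2 * x := by rw [← hηc]; ring
  nlinarith [mul_pos (sub_pos.2 hc) hx0]

/-- Greedy balancing: if the weights `w k` decrease slowly to zero and have divergent sum, they can
be distributed among finitely many classes in prescribed proportions `τ i` with prescribed limiting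
deviations `b i`, the error after `k` steps being at most a constant times `w k`. -/
lemma exists_greedy_partition {ι : Type*} [Fintype ι] [DecidableEq ι] [Nonempty ι]
    {τ : ι → ℝ}
    (hτ : ∀ i, 0 < τ i) (hsum : ∑ i, τ i = 1) {b : ι → ℝ} (hb : ∑ i, b i = 0) {w : ℕ → ℝ}
    (hw : ∀ k, 0 < w k) (hdiv : Tendsto (fun k => ∑ j ∈ Finset.range k, w j) atTop atTop)
    (hgap : ∀ c : ℝ, 1 < c → ∀ᶠ k in atTop, w k ≤ c * w (k + 1)) :
    ∃ c : ℕ → ι, ∀ i, ∃ C : ℝ, 0 < C ∧ ∀ k,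
      |b i + ∑ j ∈ Finset.range k, w j * (τ i - if c j = i then 1 else 0)| ≤ C * w k := by
  have hmax : ∀ f : ι → ℝ, ∃ i, ∀ j, f j ≤ f i := fun f => Finite.exists_max f
  choose m hm using hmax
  let e : ℕ → ι → ℝ := fun k => Nat.rec b (fun k f i => f i + w k *
    (τ i - if m (fun j => f j + τ j * w k) = i then 1 else 0)) k
  let c : ℕ → ι := fun k => m fun j => e k j + τ j * w k
  have hstep : ∀ k i, e (k + 1) i = e k i + w k * (τ i - if c k = i then 1 else 0) :=
    fun k i => rfl
  have he : ∀ k i, e k i = b i + ∑ j ∈ Finset.range k, w j * (τ i - if c j = i then 1 else 0) := by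
    intro k i
    induction k with
    | zero => simp [e]
    | succ k ih => rw [hstep, ih, Finset.sum_range_succ, add_assoc]
  have hzero : ∀ k, ∑ i, e k i = 0 := by
    intro k
    induction k with
    | zero => exact hb
    | succ k ih =>
      simp only [hstep, Finset.sum_add_distrib, ih, ← Finset.mul_sum, Finset.sum_sub_distrib, hsum]
      simp
  have hchosen : ∀ k, -w k < e (k + 1) (c k) := by
    intro k
    have h1 : 0 < e k (c k) + τ (c k) * w k := by
      by_contra! h2
      have h3 : ∑ i, (e k i + τ i * w k) ≤ 0 :=
        Finset.sum_nonpos fun i _ => (hm (fun j => e k j + τ j * w k) i).trans h2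
      rw [Finset.sum_add_distrib, hzero, ← Finset.sum_mul, hsum] at h3
      linarith [hw k]
    rw [hstep, if_pos rfl]
    linarith
  have hlower : ∀ i, ∀ᶠ k in atTop, -(2 * w k) ≤ e k i := by
    intro i
    have hτ1 : τ i ≤ 1 := hsum ▸ Finset.single_le_sum (fun j _ => (hτ j).le) (Finset.mem_univ i)
    obtain ⟨k₀, hk₀⟩ := eventually_atTop.1 (hgap (1 + τ i / 2) (by linarith [hτ i]))
    have hc : ∀ k ≥ k₀, c k = i → -(2 * w (k + 1)) ≤ e (k + 1) i := by
      intro k hk hki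
      have h1 := hchosen k
      rw [hki] at h1
      nlinarith [hk₀ k hk, hw (k + 1)]
    obtain ⟨k₁, hk₁, hbase⟩ : ∃ k ≥ k₀, -(2 * w k) ≤ e k i := by
      by_contra! hcon
      have h1 : ∀ k ≥ k₀, e k i = e k₀ i + τ i * (∑ j ∈ Finset.range k, w j -
          ∑ j ∈ Finset.range k₀, w j) := by
        intro k hk
        induction k, hk using Nat.le_induction with
        | base => simp
        | succ k hk ih =>
          have h2 : c k ≠ i := fun h2 => (hc k hk h2).not_gt (hcon (k + 1) (by omega))
          rw [hstep, ih, if_neg h2, Finset.sum_range_succ]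
          ring
      obtain ⟨k, hk, hk'⟩ := ((hdiv.eventually_ge_atTop
        (∑ j ∈ Finset.range k₀, w j - e k₀ i / τ i)).and (eventually_ge_atTop k₀)).exists
      have h3 := h1 k hk'
      have h4 := hcon k hk'
      have h5 : -(e k₀ i) ≤ τ i * (∑ j ∈ Finset.range k, w j - ∑ j ∈ Finset.range k₀, w j) := by
        calc -(e k₀ i) = τ i * (-(e k₀ i / τ i)) := by have := (hτ i).ne'; field_simp
          _ ≤ _ := by
            have := (hτ i).le
            gcongr
            linarith
      linarith [hw k]
    filter_upwards [eventually_ge_atTop k₁] with k hk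
    induction k, hk using Nat.le_induction with
    | base => exact hbase
    | succ k hk ih =>
      by_cases hki : c k = i
      · exact hc k (hk₁.trans hk) hki
      · rw [hstep, if_neg hki]
        have h1 := hk₀ k (hk₁.trans hk)
        have h2 : (2 - τ i) * w k ≤ (2 - τ i) * ((1 + τ i / 2) * w (k + 1)) := by
          have : 0 ≤ 2 - τ i := by linarith
          gcongr
        nlinarith [mul_nonneg (sq_nonneg (τ i)) (hw (k + 1)).le]
  refine ⟨c, fun i => ?_⟩
  have hO : (fun k => e k i) =O[atTop] w := by
    refine IsBigO.of_bound (2 * Fintype.card ι) ?_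
    filter_upwards [eventually_all.2 hlower] with k hk
    have h1 : e k i + ∑ j ∈ Finset.univ.erase i, e k j = 0 := by
      rw [Finset.add_sum_erase _ _ (Finset.mem_univ i), hzero]
    have h2 : ∑ j ∈ Finset.univ.erase i, -(2 * w k) ≤ ∑ j ∈ Finset.univ.erase i, e k j :=
      Finset.sum_le_sum fun j _ => hk j
    rw [Finset.sum_const, nsmul_eq_mul, Finset.card_erase_of_mem (Finset.mem_univ i),
      Finset.card_univ, Nat.cast_pred Fintype.card_pos] at h2
    have h3 : (1 : ℝ) ≤ Fintype.card ι := by exact_mod_cast Fintype.card_pos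
    rw [Real.norm_eq_abs, Real.norm_of_nonneg (hw k).le, abs_le]
    constructor
    · nlinarith [hk i, hw k]
    · nlinarith [hw k]
  obtain ⟨C, hC, hbound⟩ := bound_of_isBigO_nat_atTop hO
  refine ⟨C, hC, fun k => ?_⟩
  rw [← he]
  have := hbound (hw k).ne'
  rwa [Real.norm_eq_abs, Real.norm_of_nonneg (hw k).le] at this

/-- If the weighted discrepancies of a sequence are bounded by multiples of the decreasing weights,
then the unweighted discrepancies grow at most logarithmically. -/
lemma abs_sum_le_of_abs_sum_mul_le {w d : ℕ → ℝ} {b C : ℝ} (hC : 0 ≤ C) (hw : ∀ k, 0 < w k)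
    (hanti : Antitone w) (h : ∀ k, |b + ∑ j ∈ Finset.range k, w j * d j| ≤ C * w k) (k : ℕ) :
    |∑ j ∈ Finset.range k, d j| ≤ 2 * C + C * log (w 0 / w k) := by
  set e : ℕ → ℝ := fun k => b + ∑ j ∈ Finset.range k, w j * d j with he
  have hsum : ∑ j ∈ Finset.range k, d j = e k / w k - e 0 / w 0 -
      ∑ j ∈ Finset.range k, e (j + 1) * (1 / w (j + 1) - 1 / w j) := by
    induction k with
    | zero => simp
    | succ k ih =>
      have h1 : e (k + 1) = e k + w k * d k := by
        simp only [he, Finset.sum_range_succ]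
        ring
      have h2 : d k = (e (k + 1) - e k) / w k := by
        rw [h1]
        have := (hw k).ne'
        field_simp
        ring
      rw [Finset.sum_range_succ, Finset.sum_range_succ, ih]
      nth_rewrite 1 [h2]
      ring
  have hterm : ∀ j, |e (j + 1) * (1 / w (j + 1) - 1 / w j)| ≤
      C * (log (w j) - log (w (j + 1))) := by
    intro j
    have h1 := hw j
    have h2 := hw (j + 1)
    have h3 : 0 ≤ 1 / w (j + 1) - 1 / w j :=
      sub_nonneg.2 (one_div_le_one_div_of_le h2 (hanti (Nat.le_succ j)))
    have h4 : 1 - (w j / w (j + 1))⁻¹ ≤ log (w j / w (j + 1)) :=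
      one_sub_inv_le_log_of_pos (by positivity)
    rw [abs_mul, abs_of_nonneg h3, ← log_div h1.ne' h2.ne']
    calc |e (j + 1)| * (1 / w (j + 1) - 1 / w j)
        ≤ C * w (j + 1) * (1 / w (j + 1) - 1 / w j) := by gcongr; exact h (j + 1)
      _ = C * (1 - (w j / w (j + 1))⁻¹) := by field_simp
      _ ≤ _ := by gcongr
  have hend : ∀ j, |e j / w j| ≤ C := by
    intro j
    rw [abs_div, abs_of_pos (hw j), div_le_iff₀ (hw j)]
    exact h j
  have hrest : |∑ j ∈ Finset.range k, e (j + 1) * (1 / w (j + 1) - 1 / w j)| ≤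
      C * log (w 0 / w k) := by
    refine (Finset.abs_sum_le_sum_abs _ _).trans ((Finset.sum_le_sum fun j _ => hterm j).trans ?_)
    rw [← Finset.mul_sum, Finset.sum_range_sub' fun j => log (w j), log_div (hw 0).ne' (hw k).ne']
  rw [hsum]
  have h1 := abs_le.1 (hend k)
  have h2 := abs_le.1 (hend 0)
  have h3 := abs_le.1 hrest
  rw [abs_le]
  constructor <;> linarith [h1.1, h1.2, h2.1, h2.2, h3.1, h3.2]

lemma sum_filter_prime_range (f : ℕ → ℝ) (n : ℕ) :
    ∑ q ∈ (Finset.range n).filter Nat.Prime, f q =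
      ∑ k ∈ Finset.range (Nat.primeCounting' n), f (Nat.nth Nat.Prime k) := by
  induction n with
  | zero => simp [Nat.primeCounting']
  | succ n ih =>
    rw [Finset.range_add_one, Finset.filter_insert]
    simp only [Nat.primeCounting'] at ih ⊢
    rw [Nat.count_succ]
    split_ifs with h
    · rw [Finset.sum_insert (by simp), ih, Finset.sum_range_succ, Nat.nth_count h, add_comm]
    · rw [ih, add_zero]

lemma sum_filter_prime_Icc (f : ℕ → ℝ) (n : ℕ) :
    ∑ q ∈ (Finset.Icc 1 n).filter Nat.Prime, f q =
      ∑ k ∈ Finset.range (Nat.primeCounting n), f (Nat.nth Nat.Prime k) := by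
  rw [Nat.primeCounting_eq_primeCounting'_succ, ← sum_filter_prime_range]
  congr 1
  ext q
  simp only [Finset.mem_filter, Finset.mem_Icc, Finset.mem_range]
  exact ⟨fun h => ⟨by omega, h.2⟩, fun h => ⟨⟨h.2.one_le, by omega⟩, h.2⟩⟩

lemma nth_prime_le {k q : ℕ} (hq : q.Prime) (h : k ≤ Nat.primeCounting' q) :
    Nat.nth Nat.Prime k ≤ q := by
  conv_rhs => rw [← Nat.nth_count hq]
  exact (Nat.nth_monotone Nat.infinite_setOfPred_prime) h

lemma tendsto_nth_prime : Tendsto (fun k => (Nat.nth Nat.Prime k : ℝ)) atTop atTop :=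
  tendsto_natCast_atTop_atTop.comp
    (Nat.nth_strictMono Nat.infinite_setOfPred_prime).tendsto_atTop

/-- The logarithmic weight `log (p / (p - 1))` of the `k`-th prime `p`. -/
noncomputable def primeWeight (k : ℕ) : ℝ :=
  log ((Nat.nth Nat.Prime k : ℝ) / ((Nat.nth Nat.Prime k : ℝ) - 1))

lemma two_le_nth_prime (k : ℕ) : (2 : ℝ) ≤ Nat.nth Nat.Prime k := by
  exact_mod_cast (Nat.prime_nth_prime k).two_le

lemma inv_nth_prime_le_primeWeight (k : ℕ) : (Nat.nth Nat.Prime k : ℝ)⁻¹ ≤ primeWeight k := by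
  have h := two_le_nth_prime k
  have h1 : 0 < (Nat.nth Nat.Prime k : ℝ) - 1 := by linarith
  refine le_trans (le_of_eq ?_) (one_sub_inv_le_log_of_pos (by positivity))
  rw [inv_div]
  field_simp
  ring

lemma primeWeight_le (k : ℕ) : primeWeight k ≤ ((Nat.nth Nat.Prime k : ℝ) - 1)⁻¹ := by
  have h := two_le_nth_prime k
  have h1 : 0 < (Nat.nth Nat.Prime k : ℝ) - 1 := by linarith
  refine (log_le_sub_one_of_pos (by positivity)).trans (le_of_eq ?_)
  field_simp
  ring

lemma primeWeight_pos (k : ℕ) : 0 < primeWeight k :=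
  (inv_pos.2 (by linarith [two_le_nth_prime k])).trans_le (inv_nth_prime_le_primeWeight k)

lemma antitone_primeWeight : Antitone primeWeight := by
  intro j k hjk
  have h1 := two_le_nth_prime j
  have h2 : (Nat.nth Nat.Prime j : ℝ) ≤ Nat.nth Nat.Prime k := by
    exact_mod_cast Nat.nth_monotone Nat.infinite_setOfPred_prime hjk
  have h3 : 0 < (Nat.nth Nat.Prime j : ℝ) - 1 := by linarith
  have h4 : 0 < (Nat.nth Nat.Prime k : ℝ) - 1 := by linarith
  refine log_le_log (div_pos (by linarith) h4) ?_
  rw [div_le_div_iff₀ h4 h3]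
  linarith

lemma tendsto_primeWeight : Tendsto primeWeight atTop (nhds 0) :=
  squeeze_zero (fun k => (primeWeight_pos k).le) primeWeight_le
    (tendsto_atTop_add_const_right _ (-1) tendsto_nth_prime).inv_tendsto_atTop

lemma tendsto_sum_primeWeight :
    Tendsto (fun k => ∑ j ∈ Finset.range k, primeWeight j) atTop atTop := by
  have h1 := (not_summable_iff_tendsto_nat_atTop_of_nonneg
    (fun n => Set.indicator_nonneg (fun n _ => by positivity) n)).1 not_summable_one_div_on_primes
  refine tendsto_atTop_mono (fun k => ?_)
    (h1.comp (Nat.nth_strictMono Nat.infinite_setOfPred_prime).tendsto_atTop)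
  have h2 : ∑ q ∈ Finset.range (Nat.nth Nat.Prime k),
      Set.indicator {p : ℕ | p.Prime} (fun n : ℕ => (1 : ℝ) / n) q =
        ∑ j ∈ Finset.range k, (1 : ℝ) / Nat.nth Nat.Prime j := by
    conv_rhs => rw [← Nat.primeCounting'_nth_eq k]
    rw [← sum_filter_prime_range (fun q => (1 : ℝ) / q), Finset.sum_filter]
    refine Finset.sum_congr rfl fun q _ => ?_
    simp [Set.indicator_apply]
  rw [Function.comp_apply, h2]
  refine Finset.sum_le_sum fun j _ => ?_
  rw [one_div]
  exact inv_nth_prime_le_primeWeight j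

lemma eventually_primeWeight_le_mul {c : ℝ} (hc : 1 < c) :
    ∀ᶠ k in atTop, primeWeight k ≤ c * primeWeight (k + 1) := by
  have h1 := tendsto_nth_prime.eventually
    (eventually_exists_prime_le_mul (c := (1 + c) / 2) (by linarith))
  filter_upwards [h1, tendsto_nth_prime.eventually_ge_atTop (2 * c / (c - 1))] with k hk hk2
  obtain ⟨q, hq, hlt, hle⟩ := hk
  have h2 : Nat.nth Nat.Prime (k + 1) ≤ q := by
    refine nth_prime_le hq ?_
    have h3 : Nat.nth Nat.Prime k < q := by exact_mod_cast hlt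
    have h4 := Nat.count_strict_mono (Nat.prime_nth_prime k) h3
    rwa [Nat.count_nth_of_infinite Nat.infinite_setOfPred_prime] at h4
  have h3 : (Nat.nth Nat.Prime (k + 1) : ℝ) ≤ (1 + c) / 2 * Nat.nth Nat.Prime k :=
    le_trans (by exact_mod_cast h2) hle
  have h4 := two_le_nth_prime k
  have h5 := two_le_nth_prime (k + 1)
  rw [div_le_iff₀ (by linarith)] at hk2
  have h6 : 0 < (Nat.nth Nat.Prime k : ℝ) - 1 := by linarith
  calc primeWeight k ≤ ((Nat.nth Nat.Prime k : ℝ) - 1)⁻¹ := primeWeight_le k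
    _ ≤ c * (Nat.nth Nat.Prime (k + 1) : ℝ)⁻¹ := by
      rw [← div_eq_mul_inv, ← one_div, div_le_div_iff₀ h6 (by linarith)]
      linarith
    _ ≤ _ := by
      gcongr
      exact inv_nth_prime_le_primeWeight _

lemma eventually_log_primeWeight_div_le : ∀ᶠ x : ℝ in atTop,
    log (primeWeight 0 / primeWeight (Nat.primeCounting ⌊x⌋₊)) ≤ log 2 + log x := by
  filter_upwards [eventually_exists_prime_le_mul one_lt_two, eventually_gt_atTop 0] with x hx hx0
  obtain ⟨q, hq, hlt, hle⟩ := hx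
  set k := Nat.primeCounting ⌊x⌋₊ with hk
  have h1 : Nat.nth Nat.Prime k ≤ q :=
    nth_prime_le hq (Nat.monotone_primeCounting' ((Nat.floor_lt hx0.le).2 hlt))
  have h2 : (Nat.nth Nat.Prime k : ℝ) ≤ 2 * x := le_trans (by exact_mod_cast h1) hle
  have h3 : primeWeight 0 ≤ 1 := by
    refine (primeWeight_le 0).trans (inv_le_one_of_one_le₀ ?_)
    linarith [two_le_nth_prime 0]
  have h4 := inv_nth_prime_le_primeWeight k
  have h5 := two_le_nth_prime k
  have h6 : 0 < (Nat.nth Nat.Prime k : ℝ)⁻¹ := inv_pos.2 (by linarith)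
  rw [← log_mul two_ne_zero hx0.ne']
  refine log_le_log (div_pos (primeWeight_pos _) (primeWeight_pos _)) ?_
  calc primeWeight 0 / primeWeight k ≤ 1 / (Nat.nth Nat.Prime k : ℝ)⁻¹ := by gcongr
    _ = Nat.nth Nat.Prime k := by rw [one_div, inv_inv]
    _ ≤ _ := h2

lemma log_isBigO_div_log_sq : log =O[atTop] fun x => x / log x ^ 2 := by
  have h := (isLittleO_pow_log_id_atTop (n := 3)).isBigO.mul
    (isBigO_refl (fun x : ℝ => (log x ^ 2)⁻¹) atTop)
  refine h.congr' ?_ (Eventually.of_forall fun x => (div_eq_mul_inv _ _).symm)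
  filter_upwards [eventually_gt_atTop 1] with x hx
  have := (log_pos hx).ne'
  field_simp

theorem stmt15 (h : ℕ) (hh : 1 ≤ h)
    (τ : Fin h → ℝ) (hτ : ∀ i, τ i ∈ Set.Ioo (0 : ℝ) 1) (hsum : ∑ i, τ i = 1)
    (a : Fin h → ℝ) (ha : ∀ i, 0 < a i) (hprod : ∏ i, a i = 1) :
    ∃ P : Fin h → Set ℕ,
      (⋃ i, P i) = {p : ℕ | Nat.Prime p} ∧
      (∀ i j, i ≠ j → Disjoint (P i) (P j)) ∧
      ∀ i,
        ((fun x : ℝ => (cntF (P i) x : ℝ) - τ i * x / Real.log x) =O[Filter.atTop]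
          (fun x : ℝ => x / Real.log x ^ 2)) ∧
        Filter.Tendsto (fun x : ℝ =>
            (∏ p ∈ (Finset.Icc 1 ⌊x⌋₊).filter (fun p => p ∈ P i),
              ((p : ℝ) / ((p : ℝ) - 1))) *
              (∏ p ∈ (Finset.Icc 1 ⌊x⌋₊).filter (fun p => Nat.Prime p),
                (((p : ℝ) - 1) / (p : ℝ))) ^ τ i)
          Filter.atTop (nhds (a i)) := by
  have : Nonempty (Fin h) := ⟨⟨0, hh⟩⟩
  have hlog : ∑ i, log (a i) = 0 := by
    rw [← log_prod fun i _ => (ha i).ne', hprod, log_one]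
  obtain ⟨c, hc⟩ := exists_greedy_partition (fun i => (hτ i).1) hsum hlog primeWeight_pos
    tendsto_sum_primeWeight fun _ hc => eventually_primeWeight_le_mul hc
  obtain ⟨P, hmem⟩ : ∃ P : Fin h → Set ℕ,
      ∀ i q, q ∈ P i ↔ q.Prime ∧ c (Nat.primeCounting' q) = i :=
    ⟨fun i => {q | q.Prime ∧ c (Nat.primeCounting' q) = i}, fun _ _ => Iff.rfl⟩
  have hP : ∀ i (f : ℕ → ℝ) (n : ℕ), ∑ q ∈ (Finset.Icc 1 n).filter (fun q => q ∈ P i), f q =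
      ∑ k ∈ Finset.range (Nat.primeCounting n),
        if c k = i then f (Nat.nth Nat.Prime k) else 0 := by
    intro i f n
    have h1 : (Finset.Icc 1 n).filter (fun q => q ∈ P i) =
        ((Finset.Icc 1 n).filter Nat.Prime).filter fun q => c (Nat.primeCounting' q) = i := by
      rw [Finset.filter_filter]
      exact Finset.filter_congr fun q _ => hmem i q
    rw [h1, Finset.sum_filter, sum_filter_prime_Icc]
    simp only [Nat.primeCounting'_nth_eq]
  refine ⟨P, ?_, ?_, fun i => ⟨?_, ?_⟩⟩
  · ext q
    simp [hmem]
  · intro i j hij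
    rw [Set.disjoint_left]
    exact fun q hi hj => hij (((hmem i q).1 hi).2.symm.trans ((hmem j q).1 hj).2)
  · obtain ⟨C, hC, hbound⟩ := hc i
    have hcnt : ∀ x : ℝ, (cntF (P i) x : ℝ) =
        ∑ k ∈ Finset.range (Nat.primeCounting ⌊x⌋₊), if c k = i then (1 : ℝ) else 0 := by
      intro x
      rw [← hP i (fun _ => 1), Finset.sum_const, nsmul_eq_mul, mul_one, cntF,
        ← Set.ncard_coe_finset]
      congr 2
      ext q
      simp only [Set.mem_inter_iff, Set.mem_Icc, Finset.coe_filter, Finset.mem_Icc,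
        Set.mem_ofPred_eq]
      exact and_comm
    have h1 : (fun x : ℝ => (cntF (P i) x : ℝ) - τ i * Nat.primeCounting ⌊x⌋₊) =O[atTop]
        fun x => x / log x ^ 2 := by
      refine IsBigO.trans ?_ log_isBigO_div_log_sq
      refine IsBigO.of_bound (4 * C) ?_
      filter_upwards [eventually_log_primeWeight_div_le, eventually_ge_atTop (exp 1)] with x hx hx1
      have hl : 1 ≤ log x := (le_log_iff_exp_le ((exp_pos 1).trans_le hx1)).2 hx1
      have h2 := abs_sum_le_of_abs_sum_mul_le hC.le primeWeight_pos antitone_primeWeight hbound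
        (Nat.primeCounting ⌊x⌋₊)
      rw [Finset.sum_sub_distrib, ← hcnt, Finset.sum_const, Finset.card_range, nsmul_eq_mul,
        abs_sub_comm, mul_comm (_ : ℝ) (τ i)] at h2
      rw [Real.norm_eq_abs, Real.norm_of_nonneg (by linarith)]
      have h3 : log 2 ≤ 1 := by linarith [log_two_lt_d9]
      have h4 : log (primeWeight 0 / primeWeight (Nat.primeCounting ⌊x⌋₊)) ≤ 2 * log x := by
        linarith
      have h5 := mul_le_mul_of_nonneg_left h4 hC.le
      have h6 := mul_le_mul_of_nonneg_left hl hC.le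
      linarith
    refine (h1.add (primeCounting_sub_div_log_isBigO.const_mul_left (τ i))).congr_left fun x => ?_
    ring
  · obtain ⟨C, hC, hbound⟩ := hc i
    set e : ℕ → ℝ := fun k => log (a i) +
      ∑ j ∈ Finset.range k, primeWeight j * (τ i - if c j = i then 1 else 0) with he
    have he0 : Tendsto e atTop (nhds 0) := by
      refine squeeze_zero_norm hbound ?_
      simpa using tendsto_primeWeight.const_mul C
    have hlim : Tendsto (fun x : ℝ => exp (log (a i) - e (Nat.primeCounting ⌊x⌋₊))) atTop
        (nhds (a i)) := by
      have h1 := he0.comp (Nat.tendsto_primeCounting.comp (tendsto_nat_floor_atTop (α := ℝ)))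
      have h2 := (continuous_exp.tendsto _).comp (h1.const_sub (log (a i)))
      rwa [sub_zero, exp_log (ha i)] at h2
    refine hlim.congr fun x => ?_
    have hpos : ∀ q : ℕ, q.Prime → (0 : ℝ) < (q : ℝ) / ((q : ℝ) - 1) := by
      intro q hq
      have : (2 : ℝ) ≤ q := by exact_mod_cast hq.two_le
      exact div_pos (by linarith) (by linarith)
    have h1 : ∏ p ∈ (Finset.Icc 1 ⌊x⌋₊).filter (fun p => p ∈ P i), ((p : ℝ) / ((p : ℝ) - 1)) =
        exp (∑ k ∈ Finset.range (Nat.primeCounting ⌊x⌋₊),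
          if c k = i then primeWeight k else 0) := by
      have h2 := hP i (fun q => log ((q : ℝ) / ((q : ℝ) - 1))) ⌊x⌋₊
      simp only [primeWeight]
      rw [← h2, exp_sum]
      exact Finset.prod_congr rfl fun q hq =>
        (exp_log (hpos q ((hmem i q).1 (Finset.mem_filter.1 hq).2).1)).symm
    have h2 : ∏ p ∈ (Finset.Icc 1 ⌊x⌋₊).filter (fun p => Nat.Prime p),
        (((p : ℝ) - 1) / (p : ℝ)) =
          exp (-∑ k ∈ Finset.range (Nat.primeCounting ⌊x⌋₊), primeWeight k) := by
      have h3 := sum_filter_prime_Icc (fun q => log ((q : ℝ) / ((q : ℝ) - 1))) ⌊x⌋₊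
      simp only [primeWeight]
      rw [← h3, ← Finset.sum_neg_distrib, exp_sum]
      refine Finset.prod_congr rfl fun q hq => ?_
      rw [exp_neg, exp_log (hpos q (Finset.mem_filter.1 hq).2), inv_div]
    rw [h1, h2, ← exp_mul, ← exp_add]
    congr 1
    have h3 : ∑ j ∈ Finset.range (Nat.primeCounting ⌊x⌋₊),
        primeWeight j * (τ i - if c j = i then 1 else 0) =
        (∑ k ∈ Finset.range (Nat.primeCounting ⌊x⌋₊), primeWeight k) * τ i -
          ∑ k ∈ Finset.range (Nat.primeCounting ⌊x⌋₊), if c k = i then primeWeight k else 0 := by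
      rw [Finset.sum_mul, ← Finset.sum_sub_distrib]
      refine Finset.sum_congr rfl fun j _ => ?_
      split_ifs <;> ring
    simp only [he, h3]
    ring
end

section
/- Let (b_n)_{n≥1} be a sequence of positive real numbers such that ∑_{n=1}^∞ b_n converges and b_k ≤ ∑_{n=k+1}^∞ b_n for every k ∈ ℤ⁺. Then for every real number t with 0 ≤ t ≤ ∑_{n=1}^∞ b_n, there exists a function g : ℤ⁺ → {0,1} such that ∑_{n=1}^∞ g(n)·b_n = t. (In particular, the monotonicity assumption b_{n+1} ≤ b_n in the classical version of this statement is unnecessary.) -/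
open Filter

/-- Partial sums of the greedy subsum of `∑ b n` that never exceeds `t`. -/
noncomputable def greedySum (b : ℕ → ℝ) (t : ℝ) : ℕ → ℝ
  | 0 => 0
  | n + 1 => if greedySum b t n + b n ≤ t then greedySum b t n + b n else greedySum b t n

/-- Indicator of the terms selected by the greedy subsum. -/
noncomputable def greedyChoice (b : ℕ → ℝ) (t : ℝ) (n : ℕ) : ℝ :=
  if greedySum b t n + b n ≤ t then 1 else 0

theorem sum_greedyChoice_mul (b : ℕ → ℝ) (t : ℝ) (n : ℕ) :
    ∑ i ∈ Finset.range n, greedyChoice b t i * b i = greedySum b t n := by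
  induction n with
  | zero => simp [greedySum]
  | succ n ih =>
    rw [Finset.sum_range_succ, ih, greedySum, greedyChoice]
    split_ifs <;> ring

theorem greedySum_le {b : ℕ → ℝ} {t : ℝ} (ht : 0 ≤ t) (n : ℕ) : greedySum b t n ≤ t := by
  induction n with
  | zero => exact ht
  | succ n ih =>
    rw [greedySum]
    split_ifs with h
    exacts [h, ih]

theorem le_greedySum_add_tsum {b : ℕ → ℝ} {t : ℝ} (hsum : Summable b)
    (htail : ∀ k, b k ≤ ∑' n : ℕ, b (n + (k + 1))) (ht : t ≤ ∑' n, b n) (n : ℕ) :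
    t ≤ greedySum b t n + ∑' k, b (k + n) := by
  induction n with
  | zero => simpa [greedySum] using ht
  | succ n ih =>
    have hsplit : ∑' k, b (k + n) = b n + ∑' k, b (k + (n + 1)) := by
      rw [((summable_nat_add_iff n).2 hsum).tsum_eq_zero_add]
      simp only [zero_add, add_assoc, add_comm 1 n]
    rw [greedySum]
    split_ifs with h
    · linarith
    · linarith [htail n]

theorem tendsto_greedySum {b : ℕ → ℝ} {t : ℝ} (hsum : Summable b)
    (htail : ∀ k, b k ≤ ∑' n : ℕ, b (n + (k + 1))) (ht0 : 0 ≤ t) (ht : t ≤ ∑' n, b n) :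
    Tendsto (greedySum b t) atTop (nhds t) := by
  have hlim : Tendsto (fun n => t - ∑' k, b (k + n)) atTop (nhds t) := by
    simpa using (tendsto_sum_nat_add b).const_sub t
  exact tendsto_of_tendsto_of_tendsto_of_le_of_le hlim tendsto_const_nhds
    (fun n => sub_le_iff_le_add.2 (le_greedySum_add_tsum hsum htail ht n))
    (greedySum_le ht0)

theorem stmt16 (b : ℕ → ℝ) (hb : ∀ n, 0 < b n) (hsum : Summable b)
    (htail : ∀ k, b k ≤ ∑' n : ℕ, b (k + 1 + n))
    (t : ℝ) (ht0 : 0 ≤ t) (ht : t ≤ ∑' n, b n) :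
    ∃ g : ℕ → ℝ, (∀ n, g n = 0 ∨ g n = 1) ∧ ∑' n, g n * b n = t := by
  have hchoice : ∀ n, greedyChoice b t n = 0 ∨ greedyChoice b t n = 1 := fun n => by
    unfold greedyChoice
    split_ifs <;> simp
  refine ⟨greedyChoice b t, hchoice, HasSum.tsum_eq ?_⟩
  have hnonneg : ∀ n, 0 ≤ greedyChoice b t n * b n := fun n => by
    rcases hchoice n with h | h <;> simp [h, (hb n).le]
  rw [hasSum_iff_tendsto_nat_of_nonneg hnonneg]
  simp only [sum_greedyChoice_mul]
  exact tendsto_greedySum hsum (fun k => by simpa only [add_comm] using htail k) ht0 ht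
end

section
/- The sequence h ↦ (h!)^{1/h} / Γ(1/h) is decreasing for integers h ≥ 2, and lim_{h→∞} (h!)^{1/h} / Γ(1/h) = 1/e. -/
open Filter Real

theorem log_Gamma_one_add_sub_le {x y : ℝ} (hx : 0 < x) (hxy : x < y) (hy : y < 1) :
    log (Gamma (1 + y)) - log (Gamma (1 + x)) ≤ log 2 * (y - x) := by
  have h₁ := convexOn_log_Gamma.slope_mono_adjacent (x := 1 + x) (y := 1 + y) (z := 2)
    (Set.mem_Ioi.2 (by linarith)) (Set.mem_Ioi.2 (by norm_num)) (by linarith) (by linarith)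
  have h₂ := convexOn_log_Gamma.slope_mono_adjacent (x := 1 + y) (y := 2) (z := 3)
    (Set.mem_Ioi.2 (by linarith)) (Set.mem_Ioi.2 (by norm_num)) (by linarith) (by norm_num)
  have hΓ : Gamma 3 = 2 := by
    rw [show (3 : ℝ) = 2 + 1 by norm_num, Gamma_add_one two_ne_zero, Gamma_two, mul_one]
  have h := h₁.trans h₂
  simp only [Function.comp_apply, Gamma_two, hΓ, log_one] at h
  rw [div_le_iff₀ (by linarith)] at h
  linarith

theorem log_two_lt_log_factorial_add {h : ℕ} (hh : 2 ≤ h) :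
    log 2 < log h.factorial - h * log h + (h : ℝ) ^ 2 * (log (h + 1) - log h) := by
  have h2 : (2 : ℝ) ≤ h := by exact_mod_cast hh
  have h0 : (0 : ℝ) < h := by linarith
  have hs := Stirling.le_log_factorial_stirling (n := h) (by omega)
  have hl : (h : ℝ) - 1 / 2 ≤ (h : ℝ) ^ 2 * (log (h + 1) - log h) := by
    have key := le_log_one_add_of_nonneg (x := 1 / (h : ℝ)) (by positivity)
    have e : log (h + 1) - log h = log (1 + 1 / (h : ℝ)) := by
      rw [← log_div (by positivity) h0.ne']
      congr 1
      field_simp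
    rw [e]
    refine le_trans ?_ (mul_le_mul_of_nonneg_left key (by positivity))
    have : (h : ℝ) ^ 2 * (2 * (1 / (h : ℝ)) / (1 / (h : ℝ) + 2)) = 2 * h ^ 2 / (1 + 2 * h) := by
      field_simp
    rw [this, le_div_iff₀ (by positivity)]
    nlinarith
  have hlog : log 2 ≤ log h := log_le_log (by norm_num) h2
  have hπ : 1 < log π := by
    rw [lt_log_iff_exp_lt pi_pos]
    linarith [exp_one_lt_d9, pi_gt_three]
  have : log (2 * π) = log 2 + log π := log_mul (by norm_num) pi_pos.ne'
  linarith

theorem Gamma_one_div_natCast {h : ℕ} (hh : h ≠ 0) :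
    Gamma (1 / h) = h * Gamma (1 + 1 / h) := by
  have h0 : (h : ℝ) ≠ 0 := by exact_mod_cast hh
  rw [add_comm, Gamma_add_one (one_div_ne_zero h0)]
  field_simp

theorem factorial_rpow_div_Gamma_eq {h : ℕ} (hh : h ≠ 0) :
    (h.factorial : ℝ) ^ ((1 : ℝ) / h) / Gamma (1 / h) =
      exp (log h.factorial / h - log h - log (Gamma (1 + 1 / h))) := by
  have h0 : (0 : ℝ) < h := by exact_mod_cast Nat.pos_of_ne_zero hh
  have hΓ : 0 < Gamma (1 + 1 / (h : ℝ)) := Gamma_pos_of_pos (by positivity)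
  rw [Gamma_one_div_natCast hh, exp_sub, exp_sub, exp_log h0, exp_log hΓ,
    rpow_def_of_pos (by exact_mod_cast h.factorial_pos), div_div, mul_one_div]

theorem factorial_rpow_div_Gamma_succ_lt {h : ℕ} (hh : 2 ≤ h) :
    ((h + 1).factorial : ℝ) ^ ((1 : ℝ) / (h + 1 : ℕ)) / Gamma (1 / (h + 1 : ℕ)) <
      (h.factorial : ℝ) ^ ((1 : ℝ) / h) / Gamma (1 / h) := by
  rw [factorial_rpow_div_Gamma_eq (by omega), factorial_rpow_div_Gamma_eq (by omega), exp_lt_exp]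
  have h2 : (2 : ℝ) ≤ h := by exact_mod_cast hh
  have h0 : (0 : ℝ) < h := by linarith
  have hG := log_Gamma_one_add_sub_le (x := 1 / ((h + 1 : ℕ) : ℝ)) (y := 1 / (h : ℝ))
    (by positivity) (one_div_lt_one_div_of_lt h0 (by push_cast; linarith))
    (by rw [div_lt_one h0]; linarith)
  have hf : log ((h + 1).factorial : ℝ) = log (h + 1) + log h.factorial := by
    rw [Nat.factorial_succ, Nat.cast_mul, log_mul (by positivity)
      (by exact_mod_cast h.factorial_ne_zero)]
    push_cast
    rfl
  have hL : log 2 * (1 / (h : ℝ) - 1 / ((h + 1 : ℕ) : ℝ)) <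
      (log h.factorial / h - log h) -
        (log (h + 1).factorial / (h + 1 : ℕ) - log (h + 1 : ℕ)) := by
    rw [hf]
    push_cast
    have e₁ : log 2 * (1 / (h : ℝ) - 1 / (h + 1)) = log 2 / (h * (h + 1)) := by
      field_simp
      ring
    have e₂ : log h.factorial / h - log h -
        ((log ((h : ℝ) + 1) + log h.factorial) / (h + 1) - log (h + 1)) =
        (log h.factorial - h * log h + (h : ℝ) ^ 2 * (log (h + 1) - log h)) / (h * (h + 1)) := by
      field_simp
      ring
    rw [e₁, e₂]
    exact div_lt_div_of_pos_right (log_two_lt_log_factorial_add hh) (by positivity)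
  linarith

theorem tendsto_log_factorial_div_sub_log :
    Tendsto (fun h : ℕ => log h.factorial / h - log h) atTop (nhds (-1)) := by
  have hinv : Tendsto (fun h : ℕ => ((h : ℝ))⁻¹) atTop (nhds 0) :=
    tendsto_inv_atTop_nhds_zero_nat
  have hS : Tendsto (fun h : ℕ => log (Stirling.stirlingSeq h)) atTop (nhds (log √π)) :=
    Stirling.tendsto_stirlingSeq_sqrt_pi.log (by positivity)
  have hl : Tendsto (fun h : ℕ => log h / h) atTop (nhds 0) :=
    (isLittleO_log_id_atTop.tendsto_div_nhds_zero).comp tendsto_natCast_atTop_atTop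
  have := (((hS.add_const (log 2 / 2)).mul hinv).add (hl.div_const 2)).sub_const 1
  simp only [mul_zero, zero_div, add_zero, zero_sub] at this
  refine this.congr' ?_
  filter_upwards [eventually_ne_atTop 0] with h hh
  have h0 : (h : ℝ) ≠ 0 := by exact_mod_cast hh
  rw [Stirling.log_stirlingSeq_formula, log_mul two_ne_zero h0, log_div h0 (exp_ne_zero 1), log_exp]
  field_simp
  ring

theorem tendsto_log_Gamma_one_add_one_div_natCast :
    Tendsto (fun h : ℕ => log (Gamma (1 + 1 / h))) atTop (nhds 0) := by
  have hc : ContinuousAt (fun x : ℝ => log (Gamma x)) 1 :=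
    (differentiableAt_Gamma fun m => by
      have : (0 : ℝ) ≤ m := m.cast_nonneg
      linarith).continuousAt.log (by simp)
  have ht : Tendsto (fun h : ℕ => 1 + 1 / (h : ℝ)) atTop (nhds 1) := by
    simpa using tendsto_one_div_atTop_nhds_zero_nat.const_add (1 : ℝ)
  simpa [Function.comp_def] using hc.tendsto.comp ht

theorem stmt18 :
    StrictAntiOn
      (fun h : ℕ => (Nat.factorial h : ℝ) ^ ((1 : ℝ) / h) / Real.Gamma (1 / h))
      (Set.Ici 2) ∧
    Filter.Tendsto
      (fun h : ℕ => (Nat.factorial h : ℝ) ^ ((1 : ℝ) / h) / Real.Gamma (1 / h))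
      Filter.atTop (nhds ((Real.exp 1)⁻¹)) := by
  constructor
  · refine strictAntiOn_of_succ_lt Set.ordConnected_Ici fun h _ hh _ => ?_
    exact factorial_rpow_div_Gamma_succ_lt hh
  · have := (tendsto_log_factorial_div_sub_log.sub
      tendsto_log_Gamma_one_add_one_div_natCast).rexp
    rw [sub_zero, exp_neg] at this
    refine this.congr' ?_
    filter_upwards [eventually_ne_atTop 0] with h hh
    exact (factorial_rpow_div_Gamma_eq hh).symm
end
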